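/- arXiv:math/0007008 — 2 statements merged into one kernel-verified Lean document; each statement's English description precedes it below -/
import Mathlib

section
/- Let W be a weight. The polynomials are NOT dense in C(W) if and only if there exists an entire function F of zero exponential type (for every ε > 0 there is a constant C_ε with |F(z)| ≤ C_ε e^{ε|z|} for all z), which is not a polynomial, all of whose zeros are real and simple, and whose zero set {λ_n} satisfies ∑_n W(λ_n)/|F'(λ_n)| < +∞. -/
open Complex Filter Set MeasureTheory
open scoped ENNReal

noncomputable def logPlus (t : ℝ) : ℝ := max (Real.log t) 0

/-- `W` is a weight: lower semicontinuous, `≥ 1`, dominating all powers,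
and finite on a set with a finite accumulation point. -/
def IsWeight (W : ℝ → ℝ≥0∞) : Prop :=
  LowerSemicontinuous W ∧ (∀ x, 1 ≤ W x) ∧
  (∀ n : ℕ, Tendsto (fun x : ℝ => ENNReal.ofReal (|x| ^ n) / W x)
    (comap (fun x : ℝ => |x|) atTop) (nhds 0)) ∧
  ∃ x₀ : ℝ, AccPt x₀ (Filter.principal {x | W x ≠ ⊤})

/-- Membership in the space `C(W)`. -/
def MemCW (W : ℝ → ℝ≥0∞) (f : ℝ → ℂ) : Prop :=
  Continuous f ∧
  Tendsto (fun x : ℝ => ENNReal.ofReal (‖f x‖) / W x)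
    (comap (fun x : ℝ => |x|) atTop) (nhds 0)

/-- The norm of `C(W)`. -/
noncomputable def normCW (W : ℝ → ℝ≥0∞) (f : ℝ → ℂ) : ℝ≥0∞ :=
  ⨆ x : ℝ, ENNReal.ofReal (‖f x‖) / W x

/-- The polynomials are dense in `C(W)`. -/
def PolyDense (W : ℝ → ℝ≥0∞) : Prop :=
  ∀ f : ℝ → ℂ, MemCW W f → ∀ ε : ℝ, 0 < ε →
    ∃ P : Polynomial ℂ, normCW W (fun x => f x - P.eval (x : ℂ)) < ENNReal.ofReal ε

/-- The unit ball `X_W`: polynomials bounded by `W` on `ℝ`. -/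
def XW (W : ℝ → ℝ≥0∞) : Set (Polynomial ℂ) :=
  {P | ∀ x : ℝ, ENNReal.ofReal (‖P.eval (x : ℂ)‖) ≤ W x}

/-- The Hall majorant `M_W`. -/
noncomputable def MW (W : ℝ → ℝ≥0∞) (z : ℂ) : ℝ≥0∞ :=
  ⨆ P ∈ XW W, ENNReal.ofReal (‖P.eval z‖)

/-- Logarithm on `[1,+∞]`, with `elog ⊤ = ⊤`. -/
noncomputable def elog (w : ℝ≥0∞) : ℝ≥0∞ :=
  if w = ⊤ then ⊤ else ENNReal.ofReal (Real.log w.toReal)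


open Complex Filter Set MeasureTheory
open scoped ENNReal

section PartA

lemma exists_log_ball {f : ℂ → ℂ} {R : ℝ} (hR : 0 < R)
    (hf : DifferentiableOn ℂ f (Metric.ball 0 R)) (hne : ∀ z ∈ Metric.ball (0:ℂ) R, f z ≠ 0) :
    ∃ g : ℂ → ℂ, DifferentiableOn ℂ g (Metric.ball 0 R) ∧ g 0 = 0 ∧
      ∀ z ∈ Metric.ball (0:ℂ) R, f z = f 0 * Complex.exp (g z) := by
  have hd : DifferentiableOn ℂ (fun z => deriv f z / f z) (Metric.ball 0 R) :=
    (hf.deriv Metric.isOpen_ball).div hf hne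
  obtain ⟨g₀, hg₀⟩ := hd.isExactOn_ball
  have h0 : (0:ℂ) ∈ Metric.ball (0:ℂ) R := by simpa using hR
  refine ⟨fun z => g₀ z - g₀ 0, ?_, by simp, ?_⟩
  · exact fun z hz => ((hg₀ z hz).differentiableAt.sub_const _).differentiableWithinAt
  · intro z hz
    have key : ∀ w ∈ Metric.ball (0:ℂ) R, HasDerivAt (fun w => f w * Complex.exp (-(g₀ w))) 0 w := by
      intro w hw
      have h1 := ((hf w hw).differentiableAt (Metric.isOpen_ball.mem_nhds hw)).hasDerivAt
      have h2 := ((hg₀ w hw).neg).cexp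
      refine (h1.mul h2).congr_deriv ?_
      have := hne w hw
      simp only [Pi.neg_apply]
      rw [mul_comm (Complex.exp _), ← mul_assoc, mul_neg, mul_div_cancel₀ _ this]
      ring
    have hc := (convex_ball (0:ℂ) R).is_const_of_fderivWithin_eq_zero (𝕜 := ℂ)
      (f := fun w => f w * Complex.exp (-(g₀ w)))
      (fun w hw => (key w hw).differentiableAt.differentiableWithinAt)
      (fun w hw => by
        rw [fderivWithin_of_isOpen Metric.isOpen_ball hw]
        ext
        simp [(key w hw).deriv]) hz h0
    rw [Complex.exp_sub, mul_div_assoc', eq_div_iff (Complex.exp_ne_zero _)]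
    rw [Complex.exp_neg, Complex.exp_neg] at hc
    have e1 := Complex.exp_ne_zero (g₀ z)
    have e2 := Complex.exp_ne_zero (g₀ 0)
    field_simp at hc
    linear_combination hc

lemma harnack_disc {f : ℂ → ℂ} (hf : DifferentiableOn ℂ f (Metric.ball 0 1))
    (hne : ∀ z ∈ Metric.ball (0:ℂ) 1, f z ≠ 0) (hle : ∀ z ∈ Metric.ball (0:ℂ) 1, ‖f z‖ ≤ 1)
    {z : ℂ} (hz : ‖z‖ < 1) : ‖f 0‖ ^ ((1 + ‖z‖) / (1 - ‖z‖)) ≤ ‖f z‖ := by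
  obtain ⟨g, hg, hg0, hfg⟩ := exists_log_ball one_pos hf hne
  have h0 : (0:ℂ) ∈ Metric.ball (0:ℂ) 1 := by simp
  have hz' : z ∈ Metric.ball (0:ℂ) 1 := by simpa using hz
  have hpos : 0 < ‖f 0‖ := norm_pos_iff.2 (hne 0 h0)
  have hl : Real.log ‖f 0‖ ≤ 0 := Real.log_nonpos hpos.le (hle 0 h0)
  have hlog : ∀ w ∈ Metric.ball (0:ℂ) 1, Real.log ‖f w‖ = Real.log ‖f 0‖ + (g w).re := by
    intro w hw
    rw [hfg w hw, norm_mul, Complex.norm_exp, Real.log_mul hpos.ne' (Real.exp_pos _).ne',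
      Real.log_exp]
  have hre : ∀ M, 0 < M → -Real.log ‖f 0‖ ≤ M → ‖g z‖ ≤ 2 * M * ‖z‖ / (1 - ‖z‖) := by
    intro M hM hM'
    refine Complex.borelCaratheodory_zero hM hg ?_ one_pos hz' hg0
    intro w hw
    have h1 := hlog w hw
    have h2 : Real.log ‖f w‖ ≤ 0 := Real.log_nonpos (norm_nonneg _) (hle w hw)
    simp only [Set.mem_ofPred_eq]
    linarith
  have h1z : 0 < 1 - ‖z‖ := by linarith
  have hb : ‖g z‖ ≤ 2 * (-Real.log ‖f 0‖) * ‖z‖ / (1 - ‖z‖) := by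
    refine le_of_forall_pos_le_add fun ε hε => ?_
    have h4 : 0 < ε * (1 - ‖z‖) := by positivity
    have := hre (-Real.log ‖f 0‖ + ε * (1 - ‖z‖) / 2) (by linarith) (by linarith)
    refine this.trans ?_
    rw [div_add' _ _ _ h1z.ne']
    gcongr
    nlinarith [norm_nonneg z]
  have h3 : -(‖g z‖) ≤ (g z).re := by
    have := Complex.abs_re_le_norm (g z)
    have := neg_abs_le (g z).re
    linarith
  have hfz : 0 < ‖f z‖ := norm_pos_iff.2 (hne z hz')
  rw [Real.rpow_def_of_pos hpos, ← Real.exp_log hfz]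
  gcongr
  rw [hlog z hz']
  have : Real.log ‖f 0‖ * ((1 + ‖z‖) / (1 - ‖z‖)) = Real.log ‖f 0‖ -  2 * (-Real.log ‖f 0‖) * ‖z‖ / (1 - ‖z‖) := by
    field_simp
    ring
  linarith

lemma harnack_cone {f : ℂ → ℂ} (hf : DifferentiableOn ℂ f {z | 0 < z.im})
    (hne : ∀ z : ℂ, 0 < z.im → f z ≠ 0) (hle : ∀ z : ℂ, 0 < z.im → ‖f z‖ ≤ 1)
    {z : ℂ} (hz : 1 ≤ z.im) (hz' : |z.re| ≤ z.im) : ‖f I‖ ^ (6 * ‖z‖) ≤ ‖f z‖ := by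
  set c : ℂ → ℂ := fun w => I * (1 + w) / (1 - w) with hc
  have hcim : ∀ w ∈ Metric.ball (0:ℂ) 1, 0 < (c w).im := by
    intro w hw
    have hw1 : ‖w‖ < 1 := by simpa using hw
    have hn : Complex.normSq w < 1 := by
      rw [Complex.normSq_eq_norm_sq]; nlinarith [norm_nonneg w]
    have h1w : 1 - w ≠ 0 := by
      intro h
      rw [sub_eq_zero] at h
      rw [← h] at hw1; simp at hw1
    have hpos : 0 < Complex.normSq (1 - w) := Complex.normSq_pos.2 h1w
    have : (c w).im = (1 - Complex.normSq w) / Complex.normSq (1 - w) := by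
      simp only [hc, Complex.div_im, Complex.mul_im, Complex.mul_re, Complex.I_re, Complex.I_im,
        Complex.add_re, Complex.add_im, Complex.sub_re, Complex.sub_im, Complex.one_re,
        Complex.one_im, Complex.normSq_apply]
      ring
    rw [this]
    apply div_pos _ hpos
    linarith
  have hcd : DifferentiableOn ℂ c (Metric.ball 0 1) := by
    intro w hw
    have hw1 : ‖w‖ < 1 := by simpa using hw
    have h1w : 1 - w ≠ 0 := by
      intro h
      rw [sub_eq_zero] at h
      rw [← h] at hw1; simp at hw1
    apply DifferentiableAt.differentiableWithinAt
    exact ((differentiableAt_const _).mul ((differentiableAt_const _).add differentiableAt_id)).div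
      ((differentiableAt_const _).sub differentiableAt_id) h1w
  set a := ‖z - I‖ with ha
  set b := ‖z + I‖ with hb
  have ha2 : a ^ 2 = z.re ^ 2 + (z.im - 1) ^ 2 := by
    rw [ha, ← Complex.normSq_eq_norm_sq, Complex.normSq_apply]; simp; ring
  have hb2 : b ^ 2 = z.re ^ 2 + (z.im + 1) ^ 2 := by
    rw [hb, ← Complex.normSq_eq_norm_sq, Complex.normSq_apply]; simp; ring
  have hz2 : ‖z‖ ^ 2 = z.re ^ 2 + z.im ^ 2 := by
    rw [← Complex.normSq_eq_norm_sq, Complex.normSq_apply]; ring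
  have ha0 : 0 ≤ a := norm_nonneg _
  have hb0 : 0 ≤ b := norm_nonneg _
  have hbpos : 0 < b := by
    rcases hb0.lt_or_eq with h | h
    · exact h
    · rw [← h] at hb2; nlinarith [sq_nonneg z.re]
  have hab : a < b := by
    apply lt_of_pow_lt_pow_left₀ 2 hb0
    rw [ha2, hb2]; nlinarith
  have hzI : z + I ≠ 0 := norm_pos_iff.1 hbpos
  have hcz : c ((z - I) / (z + I)) = z := by
    simp only [hc]
    have h2 : 1 - (z - I) / (z + I) = 2 * I / (z + I) := by field_simp; ring
    have h3 : 1 + (z - I) / (z + I) = 2 * z / (z + I) := by field_simp; ring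
    rw [h2, h3]
    have := Complex.I_ne_zero
    field_simp
  have hw : ‖(z - I) / (z + I)‖ = a / b := by rw [norm_div]
  have hw1 : ‖(z - I) / (z + I)‖ < 1 := by rw [hw, div_lt_one hbpos]; exact hab
  have key := harnack_disc (f := fun w => f (c w)) (hf.comp hcd fun w hw => hcim w hw)
    (fun w hw => hne _ (hcim w hw)) (fun w hw => hle _ (hcim w hw)) hw1
  simp only [hcz, hw] at key
  have hc0 : c 0 = I := by simp [hc]
  rw [hc0] at key
  have hI : 0 < (I:ℂ).im := by simp
  refine le_trans ?_ key
  apply Real.rpow_le_rpow_of_exponent_ge (norm_pos_iff.2 (hne I hI)) (hle I hI)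
  have h1 : (1 + a / b) / (1 - a / b) = (b + a) / (b - a) := by
    have : b - a ≠ 0 := by linarith
    field_simp
  rw [h1, div_le_iff₀ (by linarith)]
  have hz15 : ‖z‖ ≤ 3 / 2 * z.im := by
    apply abs_le_of_sq_le_sq' _ (by linarith) |>.2
    have : z.re ^ 2 ≤ z.im ^ 2 := sq_le_sq' (by linarith [neg_abs_le z.re]) (by linarith [le_abs_self z.re])
    nlinarith
  have hz1 : 1 ≤ ‖z‖ := hz.trans ((le_abs_self _).trans (Complex.abs_im_le_norm z))
  have hsum : a + b ≤ 4 * ‖z‖ := by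
    have e1 : a ≤ ‖z‖ + 1 := by simpa using norm_sub_le z I
    have e2 : b ≤ ‖z‖ + 1 := by simpa using norm_add_le z I
    linarith
  have hprod : (b - a) * (a + b) = 4 * z.im := by nlinarith
  have h5 : 4 * z.im ≤ (b - a) * (4 * ‖z‖) := by
    rw [← hprod]; exact mul_le_mul_of_nonneg_left hsum (by linarith)
  nlinarith

/-- factorization through finitely many simple zeros -/
lemma factor_zeros (F : ℂ → ℂ) (hF : Differentiable ℂ F) (s : Finset ℂ)
    (hs : ∀ a ∈ s, F a = 0) : ∃ G : ℂ → ℂ, Differentiable ℂ G ∧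
      ∀ z, F z = (∏ a ∈ s, (z - a)) * G z := by
  classical
  induction s using Finset.induction_on with
  | empty => exact ⟨F, hF, by simp⟩
  | insert a s ha ih =>
    obtain ⟨G, hG, hFG⟩ := ih fun b hb => hs b (Finset.mem_insert_of_mem hb)
    have hGa : G a = 0 := by
      have h1 := hs a (Finset.mem_insert_self a s)
      rw [hFG a, mul_eq_zero, Finset.prod_eq_zero_iff] at h1
      rcases h1 with ⟨b, hb, hab⟩ | h
      · rw [sub_eq_zero] at hab; subst hab; exact absurd hb ha
      · exact h
    refine ⟨dslope G a, ?_, ?_⟩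
    · rw [← differentiableOn_univ, Complex.differentiableOn_dslope (by simp), differentiableOn_univ]
      exact hG
    · intro z
      have := sub_smul_dslope G a z
      rw [hGa, sub_zero, smul_eq_mul] at this
      rw [Finset.prod_insert ha, hFG z, ← this]
      ring

lemma zeros_finite (F : ℂ → ℂ) (hF : Differentiable ℂ F)
    (hsimple : ∀ z, F z = 0 → deriv F z ≠ 0) (R : ℝ) :
    {z : ℂ | F z = 0 ∧ ‖z‖ ≤ R}.Finite := by
  by_contra h
  obtain ⟨x, hx, hacc⟩ := Set.Infinite.exists_accPt_of_subset_isCompact h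
    (isCompact_closedBall (0:ℂ) R) (fun z hz => by simpa using hz.2)
  have hfreq := accPt_iff_frequently_nhdsNE.1 hacc
  have hx0 : F x = 0 := by
    have : x ∈ closure {z : ℂ | F z = 0} := by
      rw [mem_closure_iff_frequently]
      exact (hfreq.filter_mono nhdsWithin_le_nhds).mono fun z hz => hz.1
    rwa [(isClosed_eq hF.continuous continuous_const).closure_eq] at this
  have := (hF x).hasDerivAt.eventually_ne (c := 0) (hsimple x hx0)
  exact hfreq (this.mono fun z hz h => hz h.1)

end PartA

open Complex Filter Set MeasureTheory
open scoped ENNReal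

section PartB

lemma lindelof (F : ℂ → ℂ) (hF : Differentiable ℂ F) (h0 : F 0 ≠ 0)
    (ht : ∀ ε : ℝ, 0 < ε → ∃ C : ℝ, ∀ z : ℂ, ‖F z‖ ≤ C * Real.exp (ε * ‖z‖))
    (hs : ∀ z, F z = 0 → deriv F z ≠ 0) (ε : ℝ) (hε : 0 < ε) :
    ∃ R₀ : ℝ, 0 < R₀ ∧ ∀ R, R₀ ≤ R → ∀ Z : Finset ℂ, (∀ z, z ∈ Z ↔ F z = 0 ∧ ‖z‖ ≤ R) →
      (Z.card : ℝ) ≤ ε * R ∧ ∃ g : ℂ → ℂ, ∀ z, ‖z‖ ≤ R / 2 →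
        F z = (∏ a ∈ Z, (1 - z / a)) * (F 0 * Complex.exp (g z)) ∧ ‖g z‖ ≤ ε * ‖z‖ := by
  obtain ⟨C, hC⟩ := ht (ε / 32) (by positivity)
  have hF0 : 0 < ‖F 0‖ := norm_pos_iff.2 h0
  have hCpos : 0 < C := by
    have := hC 0
    simp at this
    linarith
  set K := Real.log C - Real.log ‖F 0‖ + 1 with hK
  have hK1 : 1 ≤ K := by
    have h1 := hC 0
    simp at h1
    have := Real.log_le_log hF0 h1
    linarith
  refine ⟨8 * K / ε, by positivity, ?_⟩
  intro R hR Z hZ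
  have hRpos : 0 < R := lt_of_lt_of_le (by positivity) hR
  have hKR : K ≤ ε * R / 8 := by
    rw [div_le_iff₀ hε] at hR
    linarith
  have hZ0 : ∀ a ∈ Z, a ≠ 0 := by
    rintro a ha rfl
    exact h0 ((hZ 0).1 ha).1
  obtain ⟨G, hG, hFG⟩ := factor_zeros F hF Z fun a ha => ((hZ a).1 ha).1
  set G1 : ℂ → ℂ := fun z => (∏ a ∈ Z, (-a)) * G z with hG1
  have hG1d : Differentiable ℂ G1 := hG.const_mul _
  have hprod : ∀ z, F z = (∏ a ∈ Z, (1 - z / a)) * G1 z := by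
    intro z
    rw [hFG z, hG1]
    simp only
    rw [← mul_assoc, ← Finset.prod_mul_distrib]
    congr 1
    apply Finset.prod_congr rfl
    intro a ha
    have := hZ0 a ha
    field_simp
    ring
  have hG10 : G1 0 = F 0 := by rw [hprod 0]; simp
  have hbound : ∀ z, ‖z‖ ≤ 4 * R → ‖G1 z‖ ≤ C * Real.exp (ε * R / 8) / 3 ^ Z.card := by
    intro z hz
    have hz' : z ∈ closure (Metric.ball (0:ℂ) (4 * R)) := by
      rw [closure_ball _ (by positivity)]; simpa using hz
    refine Complex.norm_le_of_forall_mem_frontier_norm_le (U := Metric.ball (0:ℂ) (4 * R))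
      Metric.isBounded_ball hG1d.diffContOnCl ?_ hz'
    intro w hw
    rw [frontier_ball _ (by positivity)] at hw
    have hw' : ‖w‖ = 4 * R := by simpa using hw
    rw [le_div_iff₀ (by positivity)]
    have h3 : (3:ℝ) ^ Z.card ≤ ‖∏ a ∈ Z, (1 - w / a)‖ := by
      rw [norm_prod, ← Finset.prod_const]
      apply Finset.prod_le_prod
      · intros; norm_num
      · intro a ha
        have ha0 := hZ0 a ha
        have haR := ((hZ a).1 ha).2
        have h4 : 4 ≤ ‖w / a‖ := by
          rw [norm_div, hw', le_div_iff₀ (norm_pos_iff.2 ha0)]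
          linarith
        have h5 := norm_sub_norm_le (w / a) 1
        rw [norm_sub_rev] at h5
        simp only [norm_one] at h5
        linarith
    calc ‖G1 w‖ * 3 ^ Z.card ≤ ‖G1 w‖ * ‖∏ a ∈ Z, (1 - w / a)‖ := by gcongr
      _ = ‖F w‖ := by rw [hprod w, mul_comm, ← norm_mul]
      _ ≤ C * Real.exp (ε / 32 * ‖w‖) := hC w
      _ = C * Real.exp (ε * R / 8) := by rw [hw']; congr 2; ring
  have hne : ∀ z ∈ Metric.ball (0:ℂ) R, G1 z ≠ 0 := by
    intro z hz hGz
    have hzR : ‖z‖ ≤ R := by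
      have : ‖z‖ < R := by simpa using hz
      exact this.le
    have hFz : F z = 0 := by rw [hprod z, hGz, mul_zero]
    apply hs z hFz
    have hzZ : z ∈ Z := (hZ z).2 ⟨hFz, hzR⟩
    have hd1 : HasDerivAt (fun w => ∏ a ∈ Z, (1 - w / a)) (deriv (fun w => ∏ a ∈ Z, (1 - w / a)) z) z := by
      apply DifferentiableAt.hasDerivAt
      fun_prop
    have hp0 : ∏ a ∈ Z, (1 - z / a) = 0 := by
      apply Finset.prod_eq_zero hzZ
      rw [div_self (hZ0 z hzZ), sub_self]
    have hd2 := hd1.mul (hG1d z).hasDerivAt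
    have : F = (fun w => ∏ a ∈ Z, (1 - w / a)) * G1 := by
      ext w; exact hprod w
    rw [this, hd2.deriv, hp0, hGz]
    ring
  obtain ⟨g, hg, hg0, hfg⟩ := exists_log_ball hRpos hG1d.differentiableOn hne
  have h3n : Real.exp Z.card ≤ 3 ^ Z.card := by
    rw [← Real.exp_one_pow]
    gcongr
    exact Real.exp_one_lt_three.le
  have hlogF : ‖F 0‖ = Real.exp (Real.log ‖F 0‖) := (Real.exp_log hF0).symm
  have hlogC : C = Real.exp (Real.log C) := (Real.exp_log hCpos).symm
  constructor
  · have h1 := hbound 0 (by simp; positivity)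
    rw [hG10, le_div_iff₀ (by positivity)] at h1
    have h2 : Real.exp (Real.log ‖F 0‖ + Z.card) ≤ Real.exp (Real.log C + ε * R / 8) := by
      rw [Real.exp_add, Real.exp_add, ← hlogF, ← hlogC]
      exact le_trans (by gcongr) h1
    rw [Real.exp_le_exp] at h2
    nlinarith
  · refine ⟨g, fun z hz => ?_⟩
    have hzR : z ∈ Metric.ball (0:ℂ) R := by
      simp; linarith
    refine ⟨by rw [hprod z, hfg z hzR, hG10], ?_⟩
    have := Complex.borelCaratheodory_zero (M := ε * R / 4) (by positivity) hg ?_ hRpos hzR hg0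
    · refine this.trans ?_
      rw [div_le_iff₀ (by linarith)]
      have : 0 ≤ ε * ‖z‖ := by positivity
      nlinarith
    · intro w hw
      simp only [Set.mem_ofPred_eq]
      have hw4 : ‖w‖ ≤ 4 * R := by
        have : ‖w‖ < R := by simpa using hw
        linarith
      have h1 := hbound w hw4
      rw [hfg w hw, hG10, norm_mul, Complex.norm_exp, le_div_iff₀ (by positivity)] at h1
      have h1' : ‖F 0‖ * Real.exp (g w).re ≤ C * Real.exp (ε * R / 8) := by
        refine le_trans ?_ h1
        apply le_mul_of_one_le_right (by positivity)
        exact one_le_pow₀ (by norm_num)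
      rw [hlogF, hlogC, ← Real.exp_add, ← Real.exp_add, Real.exp_le_exp] at h1'
      linarith

end PartB

open Complex Filter Set MeasureTheory
open scoped ENNReal

section PartC

lemma PL_half_gen {H : ℂ → ℂ} (hH : DiffContOnCl ℂ H {z | 0 < z.re})
    (ht : ∀ ε : ℝ, 0 < ε → ∃ C : ℝ, ∀ z : ℂ, 0 ≤ z.re → ‖H z‖ ≤ C * Real.exp (ε * ‖z‖))
    {B : ℝ} (hB : ∀ y : ℝ, ‖H (y * I)‖ ≤ B) (z : ℂ) (hz : 0 ≤ z.re) : ‖H z‖ ≤ B := by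
  have key : ∀ ε : ℝ, 0 < ε → ‖H z‖ ≤ B * Real.exp (ε * z.re) := by
    intro ε hε
    obtain ⟨C, hC⟩ := ht ε hε
    have := PhragmenLindelof.right_half_plane_of_bounded_on_real
      (f := fun z => Complex.exp (-ε * z) * H z) (C := B) (z := z) ?_ ?_ ?_ ?_ hz
    · rw [norm_mul, Complex.norm_exp] at this
      have h2 : ((-ε : ℂ) * z).re = -(ε * z.re) := by simp
      rw [h2, Real.exp_neg, inv_mul_le_iff₀ (Real.exp_pos _)] at this
      linarith
    · have h0 : DiffContOnCl ℂ (fun z : ℂ => Complex.exp (-ε * z)) {z | 0 < z.re} := by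
        apply Differentiable.diffContOnCl
        fun_prop
      exact h0.smul hH
    · refine ⟨1, by norm_num, ε, ?_⟩
      apply Asymptotics.IsBigO.of_bound C
      rw [eventually_inf_principal]
      refine Eventually.of_forall fun w hw => ?_
      rw [norm_mul, Complex.norm_exp, Real.norm_eq_abs, Real.abs_exp, Real.rpow_one]
      have h2 : ((-ε : ℂ) * w).re = -(ε * w.re) := by simp
      rw [h2]
      have h3 : Real.exp (-(ε * w.re)) ≤ 1 := by
        rw [Real.exp_le_one_iff]
        have : 0 < w.re := hw
        nlinarith
      calc _ ≤ 1 * ‖H w‖ := by gcongr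
        _ ≤ _ := by rw [one_mul]; exact hC w (le_of_lt hw)
    · refine ⟨C, ?_⟩
      rw [eventually_map]
      filter_upwards [eventually_ge_atTop 0] with x hx
      rw [norm_mul, Complex.norm_exp]
      have h2 : ((-ε : ℂ) * x).re = -(ε * x) := by simp
      have h3 := hC x (by simpa using hx)
      rw [h2, Real.exp_neg, inv_mul_le_iff₀ (Real.exp_pos _)]
      rw [Complex.norm_real, Real.norm_eq_abs, abs_of_nonneg hx] at h3
      linarith
    · intro y
      rw [norm_mul, Complex.norm_exp]
      have h2 : ((-ε : ℂ) * (y * I)).re = 0 := by simp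
      rw [h2, Real.exp_zero, one_mul]
      exact hB y
  have hlim : Tendsto (fun ε : ℝ => B * Real.exp (ε * z.re)) (nhdsWithin 0 (Ioi 0)) (nhds B) := by
    have : Tendsto (fun ε : ℝ => B * Real.exp (ε * z.re)) (nhds 0) (nhds (B * Real.exp (0 * z.re))) := by
      apply Continuous.tendsto; fun_prop
    simp only [zero_mul, Real.exp_zero, mul_one] at this
    exact this.mono_left nhdsWithin_le_nhds
  exact ge_of_tendsto hlim (by filter_upwards [self_mem_nhdsWithin] with ε hε using key ε hε)

lemma PL_half {H : ℂ → ℂ} (hH : Differentiable ℂ H)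
    (ht : ∀ ε : ℝ, 0 < ε → ∃ C : ℝ, ∀ z : ℂ, ‖H z‖ ≤ C * Real.exp (ε * ‖z‖))
    {B : ℝ} (hB : ∀ y : ℝ, ‖H (y * I)‖ ≤ B) (z : ℂ) (hz : 0 ≤ z.re) : ‖H z‖ ≤ B := by
  refine PL_half_gen hH.diffContOnCl (fun ε hε => ?_) hB z hz
  obtain ⟨C, hC⟩ := ht ε hε
  exact ⟨C, fun z _ => hC z⟩

lemma PL_zero {H : ℂ → ℂ} (hH : Differentiable ℂ H)
    (ht : ∀ ε : ℝ, 0 < ε → ∃ C : ℝ, ∀ z : ℂ, ‖H z‖ ≤ C * Real.exp (ε * ‖z‖))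
    {B : ℝ} (hB : ∀ y : ℝ, ‖H (y * I)‖ ≤ B)
    (hlim : Tendsto (fun y : ℝ => H (y * I)) atTop (nhds 0)) (z : ℂ) : H z = 0 := by
  have hbd : ∀ z, ‖H z‖ ≤ B := by
    intro z
    rcases le_total 0 z.re with h | h
    · exact PL_half hH ht hB z h
    · have := PL_half (H := fun z => H (-z)) (B := B) (hH.comp differentiable_neg) ?_ ?_ (-z) (by simpa using h)
      · simpa using this
      · intro ε hε
        obtain ⟨C, hC⟩ := ht ε hε
        exact ⟨C, fun z => by simpa using hC (-z)⟩
      · intro y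
        have := hB (-y)
        simpa using this
  have hconst : ∀ w, H w = H z := fun w => hH.apply_eq_apply_of_bounded
    (isBounded_iff_forall_norm_le.2 ⟨B, by rintro _ ⟨w, rfl⟩; exact hbd w⟩) w z
  have : Tendsto (fun y : ℝ => H (y * I)) atTop (nhds (H z)) := by
    simp only [hconst]; exact tendsto_const_nhds
  exact tendsto_nhds_unique this hlim

lemma exists_quotient {A F : ℂ → ℂ} (hA : Differentiable ℂ A) (hF : Differentiable ℂ F)
    (hs : ∀ z, F z = 0 → deriv F z ≠ 0) (hAF : ∀ z, F z = 0 → A z = 0) :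
    ∃ H : ℂ → ℂ, Differentiable ℂ H ∧ ∀ z, A z = F z * H z := by
  classical
  refine ⟨fun z => if F z = 0 then deriv A z / deriv F z else A z / F z, ?_, ?_⟩
  · intro a
    by_cases ha : F a = 0
    · have h1 : Differentiable ℂ (dslope F a) := by
        rw [← differentiableOn_univ, Complex.differentiableOn_dslope (by simp), differentiableOn_univ]
        exact hF
      have h2 : Differentiable ℂ (dslope A a) := by
        rw [← differentiableOn_univ, Complex.differentiableOn_dslope (by simp), differentiableOn_univ]
        exact hA
      have h3 : dslope F a a ≠ 0 := by rw [dslope_same]; exact hs a ha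
      have h4 : DifferentiableAt ℂ (fun z => dslope A a z / dslope F a z) a := (h2 a).div (h1 a) h3
      refine h4.congr_of_eventuallyEq ?_
      filter_upwards [h1.continuous.continuousAt.eventually_ne h3] with z hz
      by_cases hza : z = a
      · subst hza
        simp [ha, dslope_same]
      · have e1 := sub_smul_dslope F a z
        have e2 := sub_smul_dslope A a z
        rw [ha, sub_zero, smul_eq_mul] at e1
        rw [hAF a ha, sub_zero, smul_eq_mul] at e2
        have hza' : z - a ≠ 0 := sub_ne_zero.2 hza
        have : F z ≠ 0 := by rw [← e1]; exact mul_ne_zero hza' hz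
        simp only [this, if_false]
        rw [← e1, ← e2]
        field_simp
    · have h4 : DifferentiableAt ℂ (fun z => A z / F z) a := (hA a).div (hF a) ha
      refine h4.congr_of_eventuallyEq ?_
      filter_upwards [hF.continuous.continuousAt.eventually_ne ha] with z hz
      simp [hz]
  · intro z
    by_cases hz : F z = 0
    · simp [hz, hAF z hz]
    · simp only [hz, if_false]
      field_simp

/-- lower bound on the imaginary axis -/
lemma imag_lower (F : ℂ → ℂ) (hF : Differentiable ℂ F) (h0 : F 0 ≠ 0)
    (ht : ∀ ε : ℝ, 0 < ε → ∃ C : ℝ, ∀ z : ℂ, ‖F z‖ ≤ C * Real.exp (ε * ‖z‖))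
    (hs : ∀ z, F z = 0 → deriv F z ≠ 0) (hreal : ∀ z, F z = 0 → z.im = 0)
    (T : Finset ℂ) (hT : ∀ a ∈ T, F a = 0) (y : ℝ) :
    ‖F 0‖ * ∏ a ∈ T, (|y| / ‖a‖) ≤ ‖F (y * I)‖ := by
  have hfac : ∀ a : ℂ, F a = 0 → 1 ≤ ‖1 - (y * I) / a‖ ∧ |y| / ‖a‖ ≤ ‖1 - (y * I) / a‖ := by
    intro a ha
    have ha0 : a ≠ 0 := by rintro rfl; exact h0 ha
    have : 1 - (y * I) / a = 1 + ((-(y / a.re) : ℝ) : ℂ) * I := by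
      have : a = (a.re : ℂ) := by
        apply Complex.ext <;> simp [hreal a ha]
      conv_lhs => rw [this]
      push_cast
      ring
    have hre : (1 - (y * I) / a).re = 1 := by rw [this]; simp
    have him : (1 - (y * I) / a).im = -(y / a.re) := by
      rw [this]; simp
    constructor
    · have := Complex.abs_re_le_norm (1 - (y * I) / a)
      rwa [hre, abs_one] at this
    · have := Complex.abs_im_le_norm (1 - (y * I) / a)
      rw [him, abs_neg, abs_div] at this
      have h2 : ‖a‖ = |a.re| := by
        conv_lhs => rw [show a = (a.re : ℂ) by apply Complex.ext <;> simp [hreal a ha]]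
        simp
      rw [h2]; exact this
  have key : ∀ ε : ℝ, 0 < ε → ‖F 0‖ * ∏ a ∈ T, (|y| / ‖a‖) ≤ ‖F (y * I)‖ * Real.exp (ε * |y|) := by
    intro ε hε
    obtain ⟨R₀, hR₀, hR⟩ := lindelof F hF h0 ht hs ε hε
    obtain ⟨R₁, hR₁⟩ : ∃ R₁ : ℝ, ∀ a ∈ T, ‖a‖ ≤ R₁ := by
      obtain ⟨R₁, h⟩ := (T.finite_toSet.isBounded).exists_norm_le
      exact ⟨R₁, h⟩
    set R := max R₀ (max R₁ (2 * |y|))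
    set Z := (zeros_finite F hF hs R).toFinset
    have hZ : ∀ z, z ∈ Z ↔ F z = 0 ∧ ‖z‖ ≤ R := by intro z; simp [Z]
    obtain ⟨-, g, hg⟩ := hR R (le_max_left _ _) Z hZ
    have hy : ‖(y * I : ℂ)‖ = |y| := by simp
    have hyR : ‖(y * I : ℂ)‖ ≤ R / 2 := by
      rw [hy]
      have : 2 * |y| ≤ R := (le_max_right _ _).trans (le_max_right _ _)
      linarith
    obtain ⟨h1, h2⟩ := hg _ hyR
    rw [hy] at h2
    have hTZ : T ⊆ Z := fun a ha => (hZ a).2 ⟨hT a ha, (hR₁ a ha).trans ((le_max_left _ _).trans (le_max_right _ _))⟩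
    have hprod : ∏ a ∈ T, (|y| / ‖a‖) ≤ ∏ a ∈ Z, ‖1 - (y * I) / a‖ := by
      calc ∏ a ∈ T, (|y| / ‖a‖) ≤ ∏ a ∈ T, ‖1 - (y * I) / a‖ :=
            Finset.prod_le_prod (fun _ _ => by positivity) fun a ha => (hfac a (hT a ha)).2
        _ ≤ _ := by
            apply Finset.prod_le_prod_of_subset_of_one_le hTZ
            · intros; positivity
            · intro a ha _
              exact (hfac a ((hZ a).1 ha).1).1
    have h3 : 1 ≤ Real.exp (g (y * I)).re * Real.exp (ε * |y|) := by
      rw [← Real.exp_add]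
      apply Real.one_le_exp
      have := Complex.abs_re_le_norm (g (y * I))
      have := neg_abs_le (g (y * I)).re
      linarith
    calc ‖F 0‖ * ∏ a ∈ T, (|y| / ‖a‖) ≤ ‖F 0‖ * ∏ a ∈ Z, ‖1 - (y * I) / a‖ := by gcongr
      _ ≤ ‖F 0‖ * (∏ a ∈ Z, ‖1 - (y * I) / a‖) * (Real.exp (g (y * I)).re * Real.exp (ε * |y|)) := by
          apply le_mul_of_one_le_right _ h3
          have := Finset.prod_nonneg (s := Z) (f := fun a => ‖1 - (y * I) / a‖) (fun _ _ => norm_nonneg _)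
          positivity
      _ = ‖F (y * I)‖ * Real.exp (ε * |y|) := by
          conv_rhs => rw [h1]
          rw [norm_mul, norm_mul, norm_prod, Complex.norm_exp]
          ring
  have hlim : Tendsto (fun ε : ℝ => ‖F (y * I)‖ * Real.exp (ε * |y|)) (nhdsWithin 0 (Ioi 0)) (nhds ‖F (y * I)‖) := by
    have : Tendsto (fun ε : ℝ => ‖F (y * I)‖ * Real.exp (ε * |y|)) (nhds 0) (nhds (‖F (y * I)‖ * Real.exp (0 * |y|))) := by
      apply Continuous.tendsto; fun_prop
    simp only [zero_mul, Real.exp_zero, mul_one] at this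
    exact this.mono_left nhdsWithin_le_nhds
  exact ge_of_tendsto hlim (by filter_upwards [self_mem_nhdsWithin] with ε hε using key ε hε)

end PartC

open Complex Filter Set MeasureTheory
open scoped ENNReal

section PartD

lemma imag_super (F : ℂ → ℂ) (hF : Differentiable ℂ F) (h0 : F 0 ≠ 0)
    (ht : ∀ ε : ℝ, 0 < ε → ∃ C : ℝ, ∀ z : ℂ, ‖F z‖ ≤ C * Real.exp (ε * ‖z‖))
    (hs : ∀ z, F z = 0 → deriv F z ≠ 0) (hreal : ∀ z, F z = 0 → z.im = 0)
    (hinf : {z | F z = 0}.Infinite) (k : ℕ) :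
    ∃ c : ℝ, 0 < c ∧ ∀ y : ℝ, c * |y| ^ k ≤ ‖F (y * I)‖ := by
  obtain ⟨T, hT, hcard⟩ := hinf.exists_subset_card_eq k
  have hT' : ∀ a ∈ T, F a = 0 := fun a ha => hT ha
  refine ⟨‖F 0‖ * ∏ a ∈ T, (1 / ‖a‖), ?_, fun y => ?_⟩
  · apply mul_pos (norm_pos_iff.2 h0)
    apply Finset.prod_pos
    intro a ha
    have : a ≠ 0 := by rintro rfl; exact h0 (hT' _ ha)
    positivity
  · refine le_trans (le_of_eq ?_) (imag_lower F hF h0 ht hs hreal T hT' y)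
    rw [mul_assoc]
    congr 1
    rw [← hcard, ← Finset.prod_const, ← Finset.prod_mul_distrib]
    apply Finset.prod_congr rfl
    intros
    ring

lemma off_lower (F : ℂ → ℂ) (hF : Differentiable ℂ F) (h0 : F 0 ≠ 0)
    (ht : ∀ ε : ℝ, 0 < ε → ∃ C : ℝ, ∀ z : ℂ, ‖F z‖ ≤ C * Real.exp (ε * ‖z‖))
    (hs : ∀ z, F z = 0 → deriv F z ≠ 0) (hreal : ∀ z, F z = 0 → z.im = 0)
    (ε : ℝ) (hε : 0 < ε) : ∃ R₀ : ℝ, 0 < R₀ ∧ ∀ r, R₀ ≤ r → ∃ n : ℕ, (n : ℝ) ≤ 2 * ε * r ∧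
      ∀ z : ℂ, ‖z‖ ≤ r → ‖F 0‖ * Real.exp (-(ε * r)) * (|z.im| / (2 * r)) ^ n ≤ ‖F z‖ := by
  obtain ⟨R₀, hR₀, hR⟩ := lindelof F hF h0 ht hs ε hε
  refine ⟨R₀, hR₀, fun r hr => ?_⟩
  have hr0 : 0 < r := lt_of_lt_of_le hR₀ hr
  set Z := (zeros_finite F hF hs (2 * r)).toFinset
  have hZ : ∀ z, z ∈ Z ↔ F z = 0 ∧ ‖z‖ ≤ 2 * r := by intro z; simp [Z]
  obtain ⟨hn, g, hg⟩ := hR (2 * r) (by linarith) Z hZ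
  refine ⟨Z.card, by linarith, fun z hz => ?_⟩
  obtain ⟨h1, h2⟩ := hg z (by linarith)
  rw [h1, norm_mul, norm_mul, norm_prod, Complex.norm_exp]
  have h3 : Real.exp (-(ε * r)) ≤ Real.exp (g z).re := by
    rw [Real.exp_le_exp]
    have := Complex.abs_re_le_norm (g z)
    have := neg_abs_le (g z).re
    nlinarith
  have h4 : (|z.im| / (2 * r)) ^ Z.card ≤ ∏ a ∈ Z, ‖1 - z / a‖ := by
    rw [← Finset.prod_const]
    apply Finset.prod_le_prod
    · intros; positivity
    · intro a ha
      obtain ⟨ha, har⟩ := (hZ a).1 ha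
      have ha0 : a ≠ 0 := by rintro rfl; exact h0 ha
      have hanorm : 0 < ‖a‖ := norm_pos_iff.2 ha0
      have e1 : ‖1 - z / a‖ = ‖a - z‖ / ‖a‖ := by
        rw [← norm_div]; congr 1; field_simp
      have e2 : |z.im| ≤ ‖a - z‖ := by
        have := Complex.abs_im_le_norm (a - z)
        rw [Complex.sub_im, hreal a ha, zero_sub, abs_neg] at this
        exact this
      rw [e1]
      gcongr
  calc _ = (|z.im| / (2 * r)) ^ Z.card * (‖F 0‖ * Real.exp (-(ε * r))) := by ring
    _ ≤ _ := by gcongr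

lemma dslope_bound (F : ℂ → ℂ) (hF : Differentiable ℂ F) (r : ℝ) :
    ∃ B : ℝ, 0 ≤ B ∧ ∀ a z : ℂ, ‖z‖ ≤ r → ‖dslope F a z‖ ≤ B * (1 + ‖F a‖) := by
  obtain ⟨B₁, hB₁⟩ := (isCompact_closedBall (0:ℂ) (r + 2)).exists_bound_of_continuousOn
    (f := deriv F) (hF.deriv.continuous.continuousOn)
  obtain ⟨B₂, hB₂⟩ := (isCompact_closedBall (0:ℂ) (r + 2)).exists_bound_of_continuousOn
    (f := F) (hF.continuous.continuousOn)
  refine ⟨max B₁ 0 + max B₂ 0 + 1, by positivity, fun a z hz => ?_⟩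
  have hm1 := le_max_left B₁ 0
  have hm2 := le_max_left B₂ 0
  have hm3 := le_max_right B₁ 0
  have hm4 := le_max_right B₂ 0
  have hFa := norm_nonneg (F a)
  by_cases hza : z = a
  · subst hza
    rw [dslope_same]
    have := hB₁ z (by simp; linarith)
    nlinarith
  rw [dslope_of_ne F hza, slope_def_field, norm_div]
  have hpos : 0 < ‖z - a‖ := norm_pos_iff.2 (sub_ne_zero.2 hza)
  rw [div_le_iff₀ hpos]
  by_cases h1 : ‖z - a‖ ≤ 1
  · have ha : a ∈ Metric.closedBall (0:ℂ) (r + 2) := by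
      have := norm_sub_norm_le a z
      rw [norm_sub_rev] at this
      simp; linarith
    have hz' : z ∈ Metric.closedBall (0:ℂ) (r + 2) := by simp; linarith
    have := (convex_closedBall (0:ℂ) (r + 2)).norm_image_sub_le_of_norm_deriv_le
      (f := F) (C := B₁) (fun x _ => hF x) (fun x hx => hB₁ x hx) ha hz'
    refine this.trans ?_
    gcongr
    nlinarith
  · push Not at h1
    have h2 := hB₂ z (by simp; linarith)
    have h3 := norm_sub_le (F z) (F a)
    have h4 : ‖F z - F a‖ ≤ (max B₁ 0 + max B₂ 0 + 1) * (1 + ‖F a‖) := by nlinarith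
    refine h4.trans ?_
    apply le_mul_of_one_le_right _ h1.le
    positivity

end PartD

open Complex Filter Set MeasureTheory
open scoped ENNReal

section PartE

lemma zero_type_of_bound {H : ℂ → ℂ} (h : ∀ ε : ℝ, 0 < ε → ∃ D R₁ : ℝ, ∀ r, R₁ ≤ r → ∀ z : ℂ,
    ‖z‖ ≤ r / 2 → ‖H z‖ ≤ D * Real.exp (ε * r)) :
    ∀ ε : ℝ, 0 < ε → ∃ C : ℝ, ∀ z : ℂ, ‖H z‖ ≤ C * Real.exp (ε * ‖z‖) := by
  intro ε hε
  obtain ⟨D, R₁, hD⟩ := h (ε / 2) (by positivity)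
  have hDpos : 0 ≤ D := by
    have := (norm_nonneg _).trans (hD (max R₁ 0) (le_max_left _ _) 0 (by simp; positivity))
    exact nonneg_of_mul_nonneg_left this (Real.exp_pos _)
  refine ⟨D * Real.exp (ε * |R₁|), fun z => ?_⟩
  refine (hD (|R₁| + 2 * ‖z‖) (by linarith [le_abs_self R₁, norm_nonneg z]) z
    (by linarith [abs_nonneg R₁])).trans ?_
  rw [mul_assoc, ← Real.exp_add]
  gcongr
  nlinarith [abs_nonneg R₁]

lemma annihil (F : ℂ → ℂ) (hF : Differentiable ℂ F) (h0 : F 0 ≠ 0)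
    (ht : ∀ ε : ℝ, 0 < ε → ∃ C : ℝ, ∀ z : ℂ, ‖F z‖ ≤ C * Real.exp (ε * ‖z‖))
    (lam : ℕ → ℝ) (hinj : Function.Injective lam)
    (hz : ∀ z : ℂ, F z = 0 ↔ ∃ n, z = (lam n : ℂ)) (hd : ∀ n, deriv F (lam n) ≠ 0) (k : ℕ)
    (hsum : Summable fun n => ‖(lam n : ℂ) ^ k / deriv F (lam n)‖) :
    ∑' n, (lam n : ℂ) ^ k / deriv F (lam n) = 0 := by
  have hs : ∀ z, F z = 0 → deriv F z ≠ 0 := by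
    intro z hFz
    obtain ⟨n, rfl⟩ := (hz z).1 hFz
    exact hd n
  have hreal : ∀ z, F z = 0 → z.im = 0 := by
    intro z hFz
    obtain ⟨n, rfl⟩ := (hz z).1 hFz
    simp
  have hlam0 : ∀ n, F (lam n) = 0 := fun n => (hz _).2 ⟨n, rfl⟩
  have hinf : {z | F z = 0}.Infinite := by
    apply Set.infinite_of_injective_forall_mem (f := fun n => (lam n : ℂ))
    · intro a b hab
      exact hinj (Complex.ofReal_injective hab)
    · exact hlam0
  set c : ℕ → ℂ := fun n => (lam n : ℂ) ^ k / deriv F (lam n) with hc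
  set S := ∑' n, ‖c n‖ with hS
  have hS0 : 0 ≤ S := tsum_nonneg fun _ => norm_nonneg _
  set Φ : ℂ → ℂ := fun z => ∑' n, c n * dslope F (lam n) z with hΦ
  have hdd : ∀ n, Differentiable ℂ (dslope F (lam n)) := by
    intro n
    rw [← differentiableOn_univ, Complex.differentiableOn_dslope (by simp), differentiableOn_univ]
    exact hF
  have hΦd : Differentiable ℂ Φ := by
    intro z
    obtain ⟨B, hB0, hB⟩ := dslope_bound F hF (‖z‖ + 1)
    have : DifferentiableOn ℂ Φ (Metric.ball 0 (‖z‖ + 1)) := by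
      apply differentiableOn_tsum_of_summable_norm (u := fun n => ‖c n‖ * B) (hsum.mul_right B)
      · intro n
        exact ((hdd n).const_mul _).differentiableOn
      · exact Metric.isOpen_ball
      · intro n w hw
        have := hB (lam n) w (by simpa using (mem_ball_zero_iff.1 hw).le)
        rw [hlam0, norm_zero, add_zero, mul_one] at this
        rw [norm_mul]
        gcongr
    exact (this z (by simp)).differentiableAt (Metric.isOpen_ball.mem_nhds (by simp))
  have hΦlam : ∀ m, Φ (lam m) = (lam m : ℂ) ^ k := by
    intro m
    simp only [hΦ]
    rw [tsum_eq_single m]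
    · rw [dslope_same, hc]
      simp only
      rw [div_mul_cancel₀ _ (hd m)]
    · intro n hn
      have : (lam m : ℂ) ≠ lam n := by
        intro h; exact hn (hinj (by exact_mod_cast h.symm))
      rw [dslope_of_ne F this, slope_def_field, hlam0, hlam0]
      simp
  obtain ⟨H, hH, hAH⟩ := exists_quotient (A := fun z => z ^ k - Φ z) (F := F)
    ((differentiable_pow k).sub hΦd) hF hs (by
      intro z hFz
      obtain ⟨n, rfl⟩ := (hz z).1 hFz
      simp [hΦlam])
  have hFne : ∀ z : ℂ, z.im ≠ 0 → F z ≠ 0 := fun z h h' => h (hreal z h')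
  have hΦoff : ∀ z : ℂ, z.im ≠ 0 → Φ z = F z * ∑' n, c n / (z - lam n) := by
    intro z hzi
    rw [← tsum_mul_left]
    simp only [hΦ]
    congr 1
    ext n
    have : z ≠ lam n := by rintro rfl; simp at hzi
    rw [dslope_of_ne F this, slope_def_field, hlam0]
    ring
  have hHoff : ∀ z : ℂ, z.im ≠ 0 → H z = z ^ k / F z - ∑' n, c n / (z - lam n) := by
    intro z hzi
    have h1 := hAH z
    rw [hΦoff z hzi] at h1
    have := hFne z hzi
    field_simp
    linear_combination -h1
  have him : ∀ (z : ℂ) (n : ℕ), |z.im| ≤ ‖z - lam n‖ := by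
    intro z n
    have := Complex.abs_im_le_norm (z - lam n)
    simpa using this
  have hCauchy : ∀ z : ℂ, z.im ≠ 0 → ‖∑' n, c n / (z - lam n)‖ ≤ S / |z.im| := by
    intro z hzi
    have hpos : 0 < |z.im| := abs_pos.2 hzi
    rw [hS, ← tsum_div_const]
    apply tsum_of_norm_bounded (hsum.div_const _).hasSum
    intro n
    rw [norm_div]
    have := him z n
    gcongr
  have hHbound : ∀ z : ℂ, z.im ≠ 0 → ‖H z‖ ≤ ‖z‖ ^ k / ‖F z‖ + S / |z.im| := by
    intro z hzi
    rw [hHoff z hzi]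
    refine (norm_sub_le _ _).trans ?_
    rw [norm_div, norm_pow]
    gcongr
    exact hCauchy z hzi
  have hF0 : 0 < ‖F 0‖ := norm_pos_iff.2 h0
  -- zero type
  have hHt : ∀ ε : ℝ, 0 < ε → ∃ C : ℝ, ∀ z : ℂ, ‖H z‖ ≤ C * Real.exp (ε * ‖z‖) := by
    apply zero_type_of_bound
    intro ε' hε'
    set ε := ε' / 6 with hε
    have hεpos : 0 < ε := by positivity
    obtain ⟨R₀, hR₀, hlow⟩ := off_lower F hF h0 ht hs hreal ε hεpos
    refine ⟨3 * ((k.factorial / ε ^ k) / ‖F 0‖ + S), max R₀ 1, fun r hr z hzr => ?_⟩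
    have hr1 : 1 ≤ r := (le_max_right _ _).trans hr
    have hr0 : 0 < r := by linarith
    obtain ⟨n, hn, hlo⟩ := hlow r ((le_max_left _ _).trans hr)
    set m : ℂ → ℂ := fun z => ((z ^ 2 - r ^ 2) / (2 * r ^ 2)) ^ (n + 1) with hm
    have hmd : Differentiable ℂ m := by
      simp only [hm]; fun_prop
    have hcirc : ∀ w : ℂ, ‖w‖ = r → ‖(w ^ 2 - r ^ 2) / (2 * r ^ 2)‖ = |w.im| / r := by
      intro w hw
      have e1 : (r : ℂ) ^ 2 = w * (starRingEnd ℂ) w := by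
        rw [Complex.mul_conj, Complex.normSq_eq_norm_sq, hw]; push_cast; ring
      have e2 : w ^ 2 - (r:ℂ) ^ 2 = w * ((2 * w.im : ℝ) * I) := by
        rw [e1, ← Complex.sub_conj]; ring
      rw [norm_div, e2]
      simp only [norm_mul, norm_pow, Complex.norm_real, Complex.norm_I, hw, Real.norm_eq_abs,
        abs_mul, Complex.norm_two, abs_two, abs_of_pos hr0]
      field_simp
    set Br := (r ^ k * Real.exp (ε * r) / ‖F 0‖ * 2 ^ n + S) with hBr
    have hBr0 : 0 ≤ Br := by positivity
    have hHm : ∀ w : ℂ, ‖w‖ ≤ r → ‖H w * m w‖ ≤ Br := by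
      intro w hw
      have hw' : w ∈ closure (Metric.ball (0:ℂ) r) := by
        rw [closure_ball _ hr0.ne']; simpa using hw
      refine Complex.norm_le_of_forall_mem_frontier_norm_le (U := Metric.ball (0:ℂ) r)
        (f := fun w => H w * m w)
        Metric.isBounded_ball (hH.mul hmd).diffContOnCl ?_ hw'
      intro w hw
      rw [frontier_ball _ hr0.ne'] at hw
      have hw' : ‖w‖ = r := by simpa using hw
      by_cases hwi : w.im = 0
      · have : m w = 0 := by
          rw [← norm_eq_zero]
          simp only [hm]
          rw [norm_pow, hcirc w hw', hwi]
          simp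
        simp only [this, mul_zero, norm_zero]
        exact hBr0
      · have hpos : 0 < |w.im| := abs_pos.2 hwi
        have hyr : |w.im| ≤ r := by rw [← hw']; exact Complex.abs_im_le_norm w
        have h1 := hHbound w hwi
        have h2 := hlo w hw'.le
        have hmw : ‖m w‖ = (|w.im| / r) ^ (n + 1) := by
          simp only [hm]; rw [norm_pow, hcirc w hw']
        have hq : |w.im| / r ≤ 1 := by rw [div_le_one hr0]; exact hyr
        rw [norm_mul, hmw]
        calc ‖H w‖ * (|w.im| / r) ^ (n + 1)
            ≤ (r ^ k / (‖F 0‖ * Real.exp (-(ε * r)) * (|w.im| / (2 * r)) ^ n) + S / |w.im|)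
              * (|w.im| / r) ^ (n + 1) := by
              gcongr
              refine h1.trans ?_
              rw [hw']
              gcongr
          _ = r ^ k * Real.exp (ε * r) / ‖F 0‖ * 2 ^ n * (|w.im| / r)
              + S / r * (|w.im| / r) ^ n := by
              rw [Real.exp_neg, pow_succ, div_pow, div_pow, mul_pow]
              have := hpos.ne'
              have := Real.exp_pos (ε * r)
              field_simp
          _ ≤ Br := by
              rw [hBr]
              apply add_le_add
              · apply mul_le_of_le_one_right _ hq
                positivity
              · have e1 : S / r ≤ S := div_le_self hS0 hr1
                have e2 : (|w.im| / r) ^ n ≤ 1 := pow_le_one₀ (by positivity) hq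
                calc S / r * (|w.im| / r) ^ n ≤ S / r * 1 := by gcongr
                  _ ≤ S := by linarith
    have h1 := hHm z (by linarith)
    have hmz : (1 / 3 : ℝ) ^ (n + 1) ≤ ‖m z‖ := by
      simp only [hm]
      rw [norm_pow]
      gcongr
      rw [norm_div, norm_mul, norm_pow, Complex.norm_real, Complex.norm_two, Real.norm_eq_abs,
        sq_abs, le_div_iff₀ (by positivity)]
      have := norm_sub_norm_le ((r:ℂ) ^ 2) (z ^ 2)
      rw [norm_sub_rev, norm_pow, norm_pow, Complex.norm_real, Real.norm_eq_abs, sq_abs] at this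
      have : ‖z‖ ^ 2 ≤ (r / 2) ^ 2 := by gcongr
      nlinarith
    rw [norm_mul] at h1
    have h2 : ‖H z‖ ≤ Br * 3 ^ (n + 1) := by
      have h3 : ‖H z‖ * (1 / 3 : ℝ) ^ (n + 1) ≤ Br := le_trans (by gcongr) h1
      rw [one_div, inv_pow, ← div_eq_mul_inv, div_le_iff₀ (by positivity)] at h3
      exact h3
    refine h2.trans ?_
    have hk : r ^ k ≤ (k.factorial / ε ^ k) * Real.exp (ε * r) := by
      have := Real.pow_div_factorial_le_exp (ε * r) (by positivity) k
      rw [mul_pow, div_le_iff₀ (by positivity)] at this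
      rw [div_mul_eq_mul_div, le_div_iff₀ (by positivity)]
      linarith
    have h6 : (2:ℝ) ^ n * 3 ^ n ≤ Real.exp (4 * ε * r) := by
      rw [← mul_pow]
      calc ((2:ℝ) * 3) ^ n ≤ (Real.exp 2) ^ n := by
            gcongr
            have : Real.exp 2 = Real.exp 1 * Real.exp 1 := by rw [← Real.exp_add]; norm_num
            rw [this]
            have := Real.exp_one_gt_d9
            nlinarith
        _ = Real.exp (2 * n) := by rw [← Real.exp_nat_mul]; ring_nf
        _ ≤ _ := by
            rw [Real.exp_le_exp]; linarith
    have h31 : (3:ℝ) ^ n ≤ Real.exp (4 * ε * r) := by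
      refine le_trans ?_ h6
      apply le_mul_of_one_le_left (by positivity)
      exact one_le_pow₀ (by norm_num)
    calc Br * 3 ^ (n + 1) = 3 * (r ^ k * Real.exp (ε * r) / ‖F 0‖ * (2 ^ n * 3 ^ n) + S * 3 ^ n) := by
          rw [hBr]; ring
      _ ≤ 3 * (((k.factorial / ε ^ k) * Real.exp (ε * r)) * Real.exp (ε * r) / ‖F 0‖ * Real.exp (4 * ε * r)
            + S * (Real.exp (4 * ε * r) * (Real.exp (ε * r) * Real.exp (ε * r)))) := by
          have h1e : 1 ≤ Real.exp (ε * r) := Real.one_le_exp (by positivity)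
          gcongr
          refine h31.trans ?_
          apply le_mul_of_one_le_right (by positivity)
          nlinarith
      _ = 3 * ((k.factorial / ε ^ k) / ‖F 0‖ + S) * (Real.exp (4 * ε * r) * (Real.exp (ε * r) * Real.exp (ε * r))) := by
          ring
      _ = _ := by
          rw [← Real.exp_add, ← Real.exp_add]
          congr 2
          rw [hε]; ring
  -- imaginary axis
  obtain ⟨c₀, hc₀, hsup⟩ := imag_super F hF h0 ht hs hreal hinf (k + 2)
  have hquot : ∀ (j : ℕ), j ≤ k + 1 → ∀ y : ℝ, 1 ≤ |y| → |y| ^ j / ‖F (y * I)‖ ≤ (1 / c₀) / |y| := by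
    intro j hj y hy
    have hypos : 0 < |y| := by linarith
    have hFpos : 0 < ‖F (y * I)‖ := lt_of_lt_of_le (by positivity) (hsup y)
    rw [div_le_iff₀ hFpos, div_div, div_mul_eq_mul_div, one_mul, le_div_iff₀ (by positivity)]
    refine le_trans ?_ (hsup y)
    have : |y| ^ j ≤ |y| ^ (k + 1) := pow_le_pow_right₀ hy hj
    calc |y| ^ j * (c₀ * |y|) ≤ |y| ^ (k + 1) * (c₀ * |y|) := by gcongr
      _ = _ := by ring
  have hyim : ∀ y : ℝ, ((y : ℂ) * I).im = y := by intro y; simp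
  have hynorm : ∀ y : ℝ, ‖(y : ℂ) * I‖ = |y| := by intro y; simp
  have hHim : ∀ y : ℝ, 1 ≤ |y| → ‖H (y * I)‖ ≤ (1 / c₀ + S) / |y| := by
    intro y hy
    have hy0 : y ≠ 0 := by rintro rfl; simp at hy; linarith
    have h1 := hHbound (y * I) (by rw [hyim]; exact hy0)
    rw [hyim, hynorm] at h1
    have := hquot k (by omega) y hy
    rw [add_div]
    linarith
  obtain ⟨B₁, hB₁⟩ := (isCompact_Icc (a := (-1:ℝ)) (b := 1)).exists_bound_of_continuousOn
    (f := fun y : ℝ => H (y * I)) (by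
      apply Continuous.continuousOn
      exact hH.continuous.comp (by fun_prop))
  have hHlim : Tendsto (fun y : ℝ => H (y * I)) atTop (nhds 0) := by
    apply squeeze_zero_norm' (a := fun y : ℝ => (1 / c₀ + S) / y)
    · filter_upwards [eventually_ge_atTop 1] with y hy
      have := hHim y (by rw [abs_of_nonneg (by linarith)]; exact hy)
      rwa [abs_of_nonneg (by linarith)] at this
    · exact tendsto_const_nhds.div_atTop tendsto_id
  have hHzero : ∀ z, H z = 0 := by
    apply PL_zero hH hHt (B := max B₁ (1 / c₀ + S)) _ hHlim
    intro y
    by_cases hy : |y| ≤ 1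
    · exact (hB₁ y (abs_le.1 hy)).trans (le_max_left _ _)
    · push Not at hy
      refine (hHim y hy.le).trans (le_trans ?_ (le_max_right _ _))
      exact div_le_self (by positivity) hy.le
  -- conclusion
  have hlim1 : Tendsto (fun y : ℝ => ((y:ℂ) * I) ^ (k + 1) / F (y * I)) atTop (nhds 0) := by
    apply squeeze_zero_norm' (a := fun y : ℝ => (1 / c₀) / y)
    · filter_upwards [eventually_ge_atTop 1] with y hy
      have := hquot (k + 1) le_rfl y (by rw [abs_of_nonneg (by linarith)]; exact hy)
      rw [norm_div, norm_pow, hynorm]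
      rwa [abs_of_nonneg (by linarith)] at this ⊢
    · exact tendsto_const_nhds.div_atTop tendsto_id
  have hlim2 : Tendsto (fun y : ℝ => ∑' n, c n * ((y * I) / (y * I - lam n))) atTop (nhds (∑' n, c n * 1)) := by
    apply tendsto_tsum_of_dominated_convergence hsum
    · intro n
      apply Tendsto.const_mul
      have : Tendsto (fun y : ℝ => (1 : ℂ) + lam n / (y * I - lam n)) atTop (nhds (1 + 0)) := by
        apply Tendsto.const_add
        apply squeeze_zero_norm' (a := fun y : ℝ => |lam n| / y)
        · filter_upwards [eventually_ge_atTop 1] with y hy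
          have := him (y * I) n
          rw [hyim, abs_of_nonneg (by linarith)] at this
          rw [norm_div, Complex.norm_real, Real.norm_eq_abs]
          gcongr
        · exact tendsto_const_nhds.div_atTop tendsto_id
      rw [add_zero] at this
      refine this.congr' ?_
      filter_upwards [eventually_ge_atTop 1] with y hy
      have hne : (y * I - lam n : ℂ) ≠ 0 := by
        intro h
        have := him (y * I) n
        rw [hyim, h, norm_zero, abs_of_nonneg (by linarith)] at this
        linarith
      field_simp
      ring
    · filter_upwards [eventually_ge_atTop 1] with y hy n
      rw [norm_mul]
      apply mul_le_of_le_one_right (norm_nonneg _)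
      rw [norm_div]
      apply div_le_one_of_le₀ _ (norm_nonneg _)
      have := him (y * I) n
      rw [hyim] at this
      rwa [hynorm]
  simp only [mul_one] at hlim2
  refine tendsto_nhds_unique hlim2 (hlim1.congr' ?_)
  filter_upwards [eventually_ge_atTop 1] with y hy
  have h1 := hHoff (y * I) (by rw [hyim]; linarith)
  rw [hHzero] at h1
  have h2 : ((y:ℂ) * I) ^ k / F (y * I) = ∑' n, c n / (y * I - lam n) := by linear_combination -h1
  rw [pow_succ, mul_div_right_comm, h2, ← tsum_mul_right]
  congr 1
  ext n
  ring

end PartE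

open Complex Filter Set MeasureTheory
open scoped ENNReal

section PartF

lemma weight_pow {W : ℝ → ℝ≥0∞} (hW : IsWeight W) (k : ℕ) :
    ∃ C : ℝ, 1 ≤ C ∧ ∀ x : ℝ, ENNReal.ofReal (|x| ^ k) ≤ ENNReal.ofReal C * W x := by
  obtain ⟨-, h1, h2, -⟩ := hW
  have h3 := (h2 k).eventually (gt_mem_nhds (show (0:ℝ≥0∞) < 1 by norm_num))
  rw [eventually_comap] at h3
  obtain ⟨R, hR⟩ := eventually_atTop.1 h3
  refine ⟨max 1 (R ^ k), le_max_left _ _, fun x => ?_⟩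
  by_cases hx : R ≤ |x|
  · have h4 := hR _ hx x rfl
    have h5 : ENNReal.ofReal (|x| ^ k) ≤ W x := by
      have := h4.le
      rw [ENNReal.div_le_iff_le_mul (Or.inl (by have := h1 x; intro h; simp [h] at this))
        (Or.inr (by simp)), one_mul] at this
      exact this
    refine h5.trans ?_
    calc W x = 1 * W x := (one_mul _).symm
      _ ≤ _ := by
        gcongr
        rw [← ENNReal.ofReal_one]
        exact ENNReal.ofReal_le_ofReal (le_max_left _ _)
  · push Not at hx
    calc ENNReal.ofReal (|x| ^ k) ≤ ENNReal.ofReal (max 1 (R ^ k)) := by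
          apply ENNReal.ofReal_le_ofReal
          exact le_trans (by gcongr) (le_max_right _ _)
      _ = ENNReal.ofReal (max 1 (R ^ k)) * 1 := (mul_one _).symm
      _ ≤ _ := by gcongr; exact h1 x

lemma norm_le_of_normCW {W : ℝ → ℝ≥0∞} (h1 : ∀ x, 1 ≤ W x) {f : ℝ → ℂ} {ε : ℝ} (hε : 0 ≤ ε)
    (h : normCW W f ≤ ENNReal.ofReal ε) (x : ℝ) (hx : W x ≠ ⊤) : ‖f x‖ ≤ ε * (W x).toReal := by
  have h2 : ENNReal.ofReal ‖f x‖ / W x ≤ ENNReal.ofReal ε := (le_iSup (fun x : ℝ => ENNReal.ofReal (‖f x‖) / W x) x).trans h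
  rw [ENNReal.div_le_iff_le_mul (Or.inl (by have := h1 x; intro h; simp [h] at this))
        (Or.inl hx)] at h2
  have h3 := ENNReal.toReal_mono (by finiteness) h2
  rwa [ENNReal.toReal_mul, ENNReal.toReal_ofReal (norm_nonneg _), ENNReal.toReal_ofReal hε] at h3

lemma back_dir (W : ℝ → ℝ≥0∞) (hW : IsWeight W) (F : ℂ → ℂ) (hF : Differentiable ℂ F)
    (ht : ∀ ε : ℝ, 0 < ε → ∃ C : ℝ, ∀ z : ℂ, ‖F z‖ ≤ C * Real.exp (ε * ‖z‖))
    (lam : ℕ → ℝ) (hinj : Function.Injective lam)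
    (hz : ∀ z : ℂ, F z = 0 ↔ ∃ n, z = (lam n : ℂ)) (hd : ∀ n, deriv F (lam n) ≠ 0)
    (hsum : (∑' n, W (lam n) / ENNReal.ofReal (‖deriv F (lam n)‖)) < ⊤) : ¬ PolyDense W := by
  have hW' := hW
  obtain ⟨-, h1, h2, -⟩ := hW
  have hs : ∀ z, F z = 0 → deriv F z ≠ 0 := by
    intro z hFz
    obtain ⟨n, rfl⟩ := (hz z).1 hFz
    exact hd n
  have hfin : ∀ n, W (lam n) ≠ ⊤ := by
    intro n h
    have := (ENNReal.le_tsum n).trans_lt hsum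
    rw [h, ENNReal.top_div_of_ne_top (by finiteness)] at this
    exact lt_irrefl _ this
  set w : ℕ → ℝ := fun n => (W (lam n)).toReal with hw
  have hw1 : ∀ n, 1 ≤ w n := by
    intro n
    have := ENNReal.toReal_mono (hfin n) (h1 (lam n))
    simpa using this
  have hsw : Summable fun n => w n / ‖deriv F (lam n)‖ := by
    have := ENNReal.summable_toReal hsum.ne
    refine this.congr fun n => ?_
    rw [ENNReal.toReal_div, ENNReal.toReal_ofReal (norm_nonneg _)]
  set S := ∑' n, w n / ‖deriv F (lam n)‖ with hS
  have hS0 : 0 ≤ S := tsum_nonneg fun n => div_nonneg (by linarith [hw1 n]) (norm_nonneg _)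
  have hbd : ∀ (g : ℕ → ℂ) (C : ℝ), (∀ n, ‖g n‖ ≤ C * w n) →
      Summable (fun n => ‖g n / deriv F (lam n)‖) ∧ ‖∑' n, g n / deriv F (lam n)‖ ≤ C * S := by
    intro g C hg
    have hb : ∀ n, ‖g n / deriv F (lam n)‖ ≤ C * (w n / ‖deriv F (lam n)‖) := by
      intro n
      rw [norm_div, ← mul_div_assoc]
      gcongr
      exact hg n
    refine ⟨Summable.of_nonneg_of_le (fun _ => norm_nonneg _) hb (hsw.mul_left C), ?_⟩
    rw [hS, ← tsum_mul_left]
    exact tsum_of_norm_bounded (hsw.mul_left C).hasSum hb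
  obtain ⟨a, ha⟩ : ∃ a : ℝ, ∀ n, a ≠ lam n := by
    by_contra hcon
    push Not at hcon
    have h4 : range lam = univ := by
      ext x; obtain ⟨n, hn⟩ := hcon x; simp; exact ⟨n, hn.symm⟩
    have h3 := Set.countable_range lam
    rw [h4] at h3
    exact Cardinal.not_countable_real h3
  have hpow : ∀ k : ℕ, ∃ C : ℝ, ∀ n, ‖((lam n - a : ℝ) : ℂ) ^ k‖ ≤ C * w n := by
    intro k
    obtain ⟨C, hC1, hC⟩ := weight_pow hW' k
    refine ⟨2 ^ (k - 1) * (C + |a| ^ k), fun n => ?_⟩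
    have h3 : |lam n| ^ k ≤ C * w n := by
      have := ENNReal.toReal_mono (ENNReal.mul_ne_top (by finiteness) (hfin n)) (hC (lam n))
      rwa [ENNReal.toReal_mul, ENNReal.toReal_ofReal (by positivity),
        ENNReal.toReal_ofReal (by linarith)] at this
    rw [norm_pow, Complex.norm_real, Real.norm_eq_abs]
    calc |lam n - a| ^ k ≤ (|lam n| + |a|) ^ k := by gcongr; exact abs_sub _ _
      _ ≤ 2 ^ (k - 1) * (|lam n| ^ k + |a| ^ k) := add_pow_le (abs_nonneg _) (abs_nonneg _) k
      _ ≤ 2 ^ (k - 1) * (C * w n + |a| ^ k * w n) := by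
          gcongr
          exact le_mul_of_one_le_right (by positivity) (hw1 n)
      _ = _ := by ring
  have hann : ∀ k : ℕ, ∑' n, ((lam n - a : ℝ) : ℂ) ^ k / deriv F (lam n) = 0 := by
    intro k
    obtain ⟨C, hC⟩ := hpow k
    have h3 := (hbd _ C hC).1
    have hder : ∀ z, deriv (fun z => F (z + a)) z = deriv F (z + a) := by
      intro z; exact deriv_comp_add_const F (a:ℂ) z
    have hla : ∀ n, ((lam n - a : ℝ) : ℂ) + a = lam n := by intro n; push_cast; ring
    have := annihil (fun z => F (z + a)) (hF.comp (by fun_prop)) (by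
        intro h
        obtain ⟨n, hn⟩ := (hz _).1 h
        rw [zero_add] at hn
        exact ha n (Complex.ofReal_injective hn)) (by
        intro ε hε
        obtain ⟨C, hC⟩ := ht ε hε
        have hC0 : 0 ≤ C := by
          have := (norm_nonneg _).trans (hC 0)
          exact nonneg_of_mul_nonneg_left this (Real.exp_pos _)
        refine ⟨C * Real.exp (ε * |a|), fun z => (hC (z + a)).trans ?_⟩
        rw [mul_assoc, ← Real.exp_add]
        gcongr
        have := norm_add_le z a
        rw [Complex.norm_real, Real.norm_eq_abs] at this
        nlinarith) (fun n => lam n - a) (fun m n h => hinj (by simpa using h)) (by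
        intro z
        rw [hz]
        apply exists_congr
        intro n
        push_cast
        exact eq_sub_iff_add_eq.symm) (by
        intro n
        rw [hder, hla]
        exact hd n) k (by
        simp only [hder, hla]
        exact h3)
    simpa only [hder, hla] using this
  have hannP : ∀ P : Polynomial ℂ, Summable (fun n => P.eval (lam n : ℂ) / deriv F (lam n)) ∧
      ∑' n, P.eval (lam n : ℂ) / deriv F (lam n) = 0 := by
    intro P
    have hsk : ∀ k : ℕ, Summable fun n => ((lam n - a : ℝ) : ℂ) ^ k / deriv F (lam n) := by
      intro k
      obtain ⟨C, hC⟩ := hpow k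
      exact (hbd _ C hC).1.of_norm
    have e : ∀ n, P.eval (lam n : ℂ) / deriv F (lam n) =
        ∑ k ∈ Finset.range ((Polynomial.taylor (a:ℂ) P).natDegree + 1),
          (Polynomial.taylor (a:ℂ) P).coeff k * (((lam n - a : ℝ) : ℂ) ^ k / deriv F (lam n)) := by
      intro n
      have := Polynomial.taylor_eval_sub (a:ℂ) P (lam n)
      rw [← this, Polynomial.eval_eq_sum_range, Finset.sum_div]
      apply Finset.sum_congr rfl
      intro k _
      push_cast
      ring
    simp only [e]
    refine ⟨summable_sum fun k _ => (hsk k).mul_left _, ?_⟩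
    rw [Summable.tsum_finsetSum fun k _ => (hsk k).mul_left _]
    apply Finset.sum_eq_zero
    intro k _
    rw [tsum_mul_left, hann, mul_zero]
  -- bump
  intro hdense
  obtain ⟨r, hr0, hr⟩ : ∃ r : ℝ, 0 < r ∧ ∀ n, n ≠ 0 → r ≤ |lam n - lam 0| := by
    have hfz := zeros_finite F hF hs (|lam 0| + 1)
    have hf2 : {n : ℕ | ‖(lam n : ℂ)‖ ≤ |lam 0| + 1}.Finite := by
      apply Set.Finite.of_finite_image (f := fun n => (lam n : ℂ))
      · apply hfz.subset
        rintro _ ⟨n, hn, rfl⟩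
        exact ⟨(hz _).2 ⟨n, rfl⟩, hn⟩
      · intro m _ n _ h
        exact hinj (Complex.ofReal_injective h)
    obtain ⟨r, hr, hr'⟩ : ∃ r : ℝ, 0 < r ∧ ∀ n ∈ hf2.toFinset, n ≠ 0 → r ≤ |lam n - lam 0| := by
      induction hf2.toFinset using Finset.induction_on with
      | empty => exact ⟨1, one_pos, by simp⟩
      | insert m s hm ih =>
        obtain ⟨r, hr, h⟩ := ih
        by_cases hm0 : m = 0
        · refine ⟨r, hr, fun n hn hn0 => ?_⟩
          rw [Finset.mem_insert] at hn
          rcases hn with rfl | hn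
          · exact absurd hm0 hn0
          · exact h n hn hn0
        · refine ⟨min r |lam m - lam 0|, lt_min hr (abs_pos.2 (sub_ne_zero.2 fun h => hm0 (hinj h))),
            fun n hn hn0 => ?_⟩
          rw [Finset.mem_insert] at hn
          rcases hn with rfl | hn
          · exact min_le_right _ _
          · exact (min_le_left _ _).trans (h n hn hn0)
    refine ⟨min r 1, by positivity, fun n hn => ?_⟩
    by_cases hn' : ‖(lam n : ℂ)‖ ≤ |lam 0| + 1
    · exact (min_le_left _ _).trans (hr' n (by simpa using hn') hn)
    · push Not at hn'
      rw [Complex.norm_real, Real.norm_eq_abs] at hn'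
      have := abs_sub_abs_le_abs_sub (lam n) (lam 0)
      exact (min_le_right _ _).trans (by linarith)
  set f : ℝ → ℂ := fun x => ((max 0 (1 - |x - lam 0| / r) : ℝ) : ℂ) with hf
  have hf0 : f (lam 0) = 1 := by simp [hf]
  have hfn : ∀ x, r ≤ |x - lam 0| → f x = 0 := by
    intro x hx
    simp only [hf]
    rw [max_eq_left]; · simp
    have : 1 ≤ |x - lam 0| / r := by rwa [le_div_iff₀ hr0, one_mul]
    linarith
  have hfm : MemCW W f := by
    constructor
    · simp only [hf]; fun_prop
    · apply tendsto_const_nhds.congr'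
      have : ∀ᶠ t in (atTop : Filter ℝ), |lam 0| + r ≤ t := eventually_ge_atTop _
      filter_upwards [this.comap (fun x : ℝ => |x|)] with x hx
      rw [hfn x]
      · simp
      · have := abs_sub_abs_le_abs_sub x (lam 0)
        linarith
  have hd0 : 0 < ‖(1:ℂ) / deriv F (lam 0)‖ := by
    rw [norm_pos_iff]; exact one_div_ne_zero (hd 0)
  set δ := ‖(1:ℂ) / deriv F (lam 0)‖ with hδ
  obtain ⟨P, hP⟩ := hdense f hfm (δ / (2 * (S + 1))) (by positivity)
  have hP2 : ∀ n, ‖f (lam n) - P.eval (lam n : ℂ)‖ ≤ δ / (2 * (S + 1)) * w n := by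
    intro n
    exact norm_le_of_normCW (f := fun x => f x - P.eval (x:ℂ)) h1 (by positivity) hP.le (lam n) (hfin n)
  have h5 := (hbd _ _ hP2).2
  have hff : HasSum (fun n => f (lam n) / deriv F (lam n)) (f (lam 0) / deriv F (lam 0)) := by
    apply hasSum_single
    intro n hn
    rw [hfn _ (hr n hn), zero_div]
  have h6 : ∑' n, (f (lam n) - P.eval (lam n : ℂ)) / deriv F (lam n) = 1 / deriv F (lam 0) := by
    simp only [sub_div]
    rw [hff.summable.tsum_sub (hannP P).1, (hannP P).2, hff.tsum_eq, hf0, sub_zero]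
  rw [h6, ← hδ, div_mul_eq_mul_div, le_div_iff₀ (by positivity)] at h5
  nlinarith

end PartF

open Complex Filter Set MeasureTheory
open scoped ENNReal

section PartG

/-- weighted bound -/
def Bd (W : ℝ → ℝ≥0∞) (g : ℝ → ℂ) (C : ℝ) : Prop :=
  ∀ x, W x ≠ ⊤ → ‖g x‖ ≤ C * (W x).toReal

/-- approximable by polynomials -/
def Appr (W : ℝ → ℝ≥0∞) (g : ℝ → ℂ) : Prop :=
  ∀ ε : ℝ, 0 < ε → ∃ P : Polynomial ℂ, Bd W (fun x => g x - P.eval (x:ℂ)) ε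

lemma toReal_ge_one {W : ℝ → ℝ≥0∞} (h1 : ∀ x, 1 ≤ W x) {x : ℝ} (hx : W x ≠ ⊤) :
    1 ≤ (W x).toReal := by
  simpa using ENNReal.toReal_mono hx (h1 x)

lemma normCW_le_of_Bd {W : ℝ → ℝ≥0∞} {g : ℝ → ℂ} {C : ℝ} (hC : 0 ≤ C) (h : Bd W g C) :
    normCW W g ≤ ENNReal.ofReal C := by
  apply iSup_le
  intro x
  by_cases hx : W x = ⊤
  · simp [hx]
  · apply ENNReal.div_le_of_le_mul
    rw [← ENNReal.ofReal_toReal hx, ← ENNReal.ofReal_mul hC]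
    exact ENNReal.ofReal_le_ofReal (h x hx)

lemma Bd.add {W : ℝ → ℝ≥0∞} {g h : ℝ → ℂ} {C D : ℝ} (hg : Bd W g C) (hh : Bd W h D) :
    Bd W (fun x => g x + h x) (C + D) := by
  intro x hx
  have h1 := hg x hx
  have h2 := hh x hx
  have := norm_add_le (g x) (h x)
  simp only
  linarith

lemma Bd.congr {W : ℝ → ℝ≥0∞} {g h : ℝ → ℂ} {C D : ℝ} (hg : Bd W g C) (hh : ∀ x, g x = h x) (hCD : C = D) :
    Bd W h D := by
  intro x hx
  rw [← hh, ← hCD]; exact hg x hx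

lemma Bd.mono {W : ℝ → ℝ≥0∞} {g h : ℝ → ℂ} {C : ℝ} (hg : Bd W g C) (hh : ∀ x, ‖h x‖ ≤ ‖g x‖) :
    Bd W h C := fun x hx => (hh x).trans (hg x hx)

lemma Appr.add {W : ℝ → ℝ≥0∞} {g h : ℝ → ℂ} (hg : Appr W g) (hh : Appr W h) :
    Appr W (fun x => g x + h x) := by
  intro ε hε
  obtain ⟨P, hP⟩ := hg (ε / 2) (by positivity)
  obtain ⟨Q, hQ⟩ := hh (ε / 2) (by positivity)
  refine ⟨P + Q, (hP.add hQ).congr (fun x => ?_) (by ring)⟩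
  simp; ring

lemma Appr.const_mul {W : ℝ → ℝ≥0∞} {g : ℝ → ℂ} (hg : Appr W g) (c : ℂ) :
    Appr W (fun x => c * g x) := by
  intro ε hε
  obtain ⟨P, hP⟩ := hg (ε / (‖c‖ + 1)) (by positivity)
  refine ⟨Polynomial.C c * P, fun x hx => ?_⟩
  have := hP x hx
  simp only [Polynomial.eval_mul, Polynomial.eval_C, ← mul_sub, norm_mul] at this ⊢
  calc ‖c‖ * ‖g x - Polynomial.eval (x:ℂ) P‖ ≤ (‖c‖ + 1) * (ε / (‖c‖ + 1) * (W x).toReal) := by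
        gcongr; linarith
    _ = _ := by field_simp

lemma conj_eval (P : Polynomial ℂ) (z : ℂ) :
    (P.map (starRingEnd ℂ)).eval z = (starRingEnd ℂ) (P.eval ((starRingEnd ℂ) z)) := by
  have := Polynomial.eval_map_apply (f := starRingEnd ℂ) (p := P) (starRingEnd ℂ z)
  simpa using this

lemma Appr.conj {W : ℝ → ℝ≥0∞} {g : ℝ → ℂ} (hg : Appr W g) :
    Appr W (fun x => (starRingEnd ℂ) (g x)) := by
  intro ε hε
  obtain ⟨P, hP⟩ := hg ε hε
  refine ⟨P.map (starRingEnd ℂ), hP.mono fun x => ?_⟩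
  rw [conj_eval, Complex.conj_ofReal, ← map_sub, RCLike.norm_conj]

lemma Appr.poly {W : ℝ → ℝ≥0∞} (P : Polynomial ℂ) : Appr W (fun x => P.eval (x:ℂ)) := by
  intro ε hε
  refine ⟨P, fun x hx => ?_⟩
  simp; positivity

lemma Appr.lim {W : ℝ → ℝ≥0∞} {g : ℝ → ℂ}
    (h : ∀ ε : ℝ, 0 < ε → ∃ k, Appr W k ∧ Bd W (fun x => g x - k x) ε) : Appr W g := by
  intro ε hε
  obtain ⟨k, hk, hkg⟩ := h (ε / 2) (by positivity)
  obtain ⟨P, hP⟩ := hk (ε / 2) (by positivity)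
  exact ⟨P, (hkg.add hP).congr (fun x => by ring) (by ring)⟩

lemma Bd.of_bounded {W : ℝ → ℝ≥0∞} (h1 : ∀ x, 1 ≤ W x) {g : ℝ → ℂ} {C : ℝ} (h : ∀ x, ‖g x‖ ≤ C) :
    Bd W g C := by
  intro x hx
  have hC : 0 ≤ C := (norm_nonneg _).trans (h x)
  exact (h x).trans (le_mul_of_one_le_right hC (toReal_ge_one h1 hx))

lemma x_sub_I_ne (x : ℝ) : (x : ℂ) - I ≠ 0 := by
  intro h; have := congrArg Complex.im h; simp at this

lemma norm_u_le (x : ℝ) : ‖1 / ((x : ℂ) - I)‖ ≤ 1 := by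
  rw [norm_div, norm_one, div_le_one (norm_pos_iff.2 (x_sub_I_ne x))]
  have := Complex.abs_im_le_norm ((x:ℂ) - I)
  simpa using this

lemma exists_div_I (P : Polynomial ℂ) : ∃ q : Polynomial ℂ, ∀ x : ℝ,
    P.eval (x:ℂ) * (1 / ((x:ℂ) - I)) = q.eval (x:ℂ) + P.eval I * (1 / ((x:ℂ) - I)) := by
  obtain ⟨q, hq⟩ := Polynomial.X_sub_C_dvd_sub_C_eval (a := I) (p := P)
  refine ⟨q, fun x => ?_⟩
  have := congrArg (Polynomial.eval (x:ℂ)) hq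
  simp only [Polynomial.eval_sub, Polynomial.eval_C, Polynomial.eval_mul, Polynomial.eval_X] at this
  have hne := x_sub_I_ne x
  field_simp
  linear_combination this

lemma Appr.mul_u {W : ℝ → ℝ≥0∞} (hu : Appr W fun x => 1 / ((x:ℂ) - I)) {g : ℝ → ℂ}
    (hg : Appr W g) : Appr W (fun x => (1 / ((x:ℂ) - I)) * g x) := by
  apply Appr.lim
  intro ε hε
  obtain ⟨P, hP⟩ := hg ε hε
  obtain ⟨q, hq⟩ := exists_div_I P
  refine ⟨fun x => q.eval (x:ℂ) + P.eval I * (1 / ((x:ℂ) - I)), (Appr.poly q).add (hu.const_mul _),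
    hP.mono fun x => ?_⟩
  simp only []
  rw [← hq, mul_comm, ← sub_mul, norm_mul]
  exact mul_le_of_le_one_right (norm_nonneg _) (norm_u_le x)

/-- multiplier algebra -/
def multAlg (W : ℝ → ℝ≥0∞) : StarSubalgebra ℂ C(OnePoint ℝ, ℂ) where
  carrier := {φ | ∀ g, Appr W g → Appr W fun x => φ (x : OnePoint ℝ) * g x}
  mul_mem' := by
    intro a b ha hb g hg
    have := ha _ (hb _ hg)
    simpa [mul_assoc] using this
  add_mem' := by
    intro a b ha hb g hg
    have := (ha _ hg).add (hb _ hg)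
    simpa [add_mul] using this
  algebraMap_mem' := by
    intro r g hg
    exact hg.const_mul r
  star_mem' := by
    intro a ha g hg
    have := (ha _ hg.conj).conj
    simpa using this

lemma one_div_tendsto : Tendsto (fun x : ℝ => 1 / ((x:ℂ) - I)) (coclosedCompact ℝ) (nhds 0) := by
  rw [coclosedCompact_eq_cocompact]
  apply squeeze_zero_norm' (a := fun x : ℝ => 1 / ‖x‖)
  · filter_upwards [(isCompact_singleton (x := (0:ℝ))).compl_mem_cocompact] with x hx
    have hx0 : 0 < ‖x‖ := norm_pos_iff.2 hx
    rw [norm_div, norm_one]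
    have h1 := Complex.abs_re_le_norm ((x:ℂ) - I)
    have : ‖x‖ ≤ ‖(x:ℂ) - I‖ := by simpa using h1
    gcongr
  · simp only [one_div]
    exact tendsto_inv_atTop_zero.comp (tendsto_norm_cocompact_atTop)

lemma appr_of_compact {W : ℝ → ℝ≥0∞} (h1 : ∀ x, 1 ≤ W x)
    (hu : Appr W fun x => 1 / ((x:ℂ) - I)) (f : ℝ → ℂ) (hf : Continuous f) (hc : HasCompactSupport f) :
    Appr W f := by
  set U : C(OnePoint ℝ, ℂ) := OnePoint.continuousMapMk
    ⟨fun x : ℝ => 1 / ((x:ℂ) - I), by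
      apply Continuous.div continuous_const (by fun_prop) x_sub_I_ne⟩ 0 one_div_tendsto with hU
  have hUx : ∀ x : ℝ, U (x : OnePoint ℝ) = 1 / ((x:ℂ) - I) := fun x => rfl
  have hUi : U (OnePoint.infty) = 0 := rfl
  have hUm : U ∈ multAlg W := fun g hg => hu.mul_u hg
  have hne : ∀ x : ℝ, 1 / ((x:ℂ) - I) ≠ 0 := fun x => one_div_ne_zero (x_sub_I_ne x)
  have hsep : (multAlg W).SeparatesPoints := by
    intro p q hpq
    refine ⟨U, ⟨U, hUm, rfl⟩, ?_⟩
    induction p using OnePoint.rec with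
    | infty =>
      induction q using OnePoint.rec with
      | infty => exact absurd rfl hpq
      | coe x => rw [hUx, hUi]; exact (hne x).symm
    | coe y =>
      induction q using OnePoint.rec with
      | infty => rw [hUx, hUi]; exact hne y
      | coe x =>
        rw [hUx, hUx]
        intro h
        apply hpq
        rw [one_div, one_div, inv_inj, sub_left_inj] at h
        rw [Complex.ofReal_injective h]
  have htop := ContinuousMap.starSubalgebra_topologicalClosure_eq_top_of_separatesPoints _ hsep
  have hft : Tendsto f (coclosedCompact ℝ) (nhds 0) := by
    rw [coclosedCompact_eq_cocompact]
    apply tendsto_const_nhds.congr'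
    have := hc.isCompact.compl_mem_cocompact
    filter_upwards [this] with x hx
    exact (image_eq_zero_of_notMem_tsupport hx).symm
  set φ : C(OnePoint ℝ, ℂ) := OnePoint.continuousMapMk ⟨f, hf⟩ 0 hft with hφ
  have hφm : φ ∈ (multAlg W).topologicalClosure := by rw [htop]; trivial
  have hφm' : φ ∈ closure ((multAlg W : Set C(OnePoint ℝ, ℂ))) := hφm
  rw [Metric.mem_closure_iff] at hφm'
  apply Appr.lim
  intro ε hε
  obtain ⟨ψ, hψ, hd⟩ := hφm' ε hε
  have h2 : Appr W fun x => ψ (x : OnePoint ℝ) * 1 := by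
    apply hψ (fun _ => 1)
    simpa using Appr.poly (W := W) 1
  refine ⟨_, h2, Bd.of_bounded h1 fun x => ?_⟩
  have := (ContinuousMap.dist_apply_le_dist (f := φ) (g := ψ) (x : OnePoint ℝ)).trans hd.le
  rw [dist_eq_norm] at this
  simp only [mul_one]
  exact this

lemma polyDense_of_appr {W : ℝ → ℝ≥0∞} (h1 : ∀ x, 1 ≤ W x)
    (hu : Appr W fun x => 1 / ((x:ℂ) - I)) : PolyDense W := by
  intro f hf ε hε
  suffices h : Appr W f by
    obtain ⟨P, hP⟩ := h (ε / 2) (by positivity)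
    refine ⟨P, (normCW_le_of_Bd (by positivity) hP).trans_lt ?_⟩
    rw [ENNReal.ofReal_lt_ofReal_iff hε]
    linarith
  apply Appr.lim
  intro δ hδ
  have h3 := hf.2.eventually (gt_mem_nhds (show (0:ℝ≥0∞) < ENNReal.ofReal δ by simpa using hδ))
  rw [eventually_comap] at h3
  obtain ⟨R, hR⟩ := eventually_atTop.1 h3
  set χ : ℝ → ℝ := fun x => max 0 (min 1 (R + 1 - |x|)) with hχ
  have hχ0 : ∀ x, 0 ≤ χ x := fun x => le_max_left _ _
  have hχ1 : ∀ x, χ x ≤ 1 := fun x => max_le (by norm_num) (min_le_left _ _)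
  refine ⟨fun x => f x * (χ x : ℂ), appr_of_compact h1 hu _ ?_ ?_, ?_⟩
  · apply hf.1.mul
    simp only [hχ]; fun_prop
  · apply HasCompactSupport.intro (isCompact_closedBall (0:ℝ) (R + 1))
    intro x hx
    rw [mem_closedBall_zero_iff, Real.norm_eq_abs, not_le] at hx
    have : χ x = 0 := by
      simp only [hχ]
      apply max_eq_left
      exact (min_le_right _ _).trans (by linarith)
    simp [this]
  · intro x hx
    simp only []
    by_cases hxR : R ≤ |x|
    · have h4 := hR _ hxR x rfl
      have h5 : ‖f x‖ ≤ δ * (W x).toReal := by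
        have := h4.le
        rw [ENNReal.div_le_iff_le_mul (Or.inl (by have := h1 x; intro h; simp [h] at this))
          (Or.inl hx)] at this
        have h3 := ENNReal.toReal_mono (by finiteness) this
        rwa [ENNReal.toReal_mul, ENNReal.toReal_ofReal (norm_nonneg _), ENNReal.toReal_ofReal hδ.le] at h3
      refine le_trans ?_ h5
      have e : f x - f x * (χ x : ℂ) = f x * ((1 - χ x : ℝ) : ℂ) := by push_cast; ring
      rw [e, norm_mul, Complex.norm_real, Real.norm_eq_abs, abs_of_nonneg (by linarith [hχ1 x])]
      exact mul_le_of_le_one_right (norm_nonneg _) (by linarith [hχ0 x])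
    · push Not at hxR
      have : χ x = 1 := by
        simp only [hχ]
        rw [min_eq_left (by linarith), max_eq_right (by norm_num)]
      rw [this]
      simp only [Complex.ofReal_one, mul_one, sub_self, norm_zero]
      positivity

lemma bound_at_I {W : ℝ → ℝ≥0∞} (h : ¬ Appr W fun x => 1 / ((x:ℂ) - I)) :
    ∃ C : ℝ, 0 < C ∧ ∀ P : Polynomial ℂ, Bd W (fun x => P.eval (x:ℂ)) 1 → ‖P.eval I‖ ≤ C := by
  by_contra hcon
  push Not at hcon
  apply h
  intro ε hε
  obtain ⟨P, hP, hPI⟩ := hcon (1 / ε) (by positivity)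
  obtain ⟨q, hq⟩ := exists_div_I P
  have hpos : 0 < ‖P.eval I‖ := lt_trans (by positivity) hPI
  have hne : P.eval I ≠ 0 := norm_pos_iff.1 hpos
  refine ⟨- (Polynomial.C (P.eval I)⁻¹ * q), fun x hx => ?_⟩
  have e : 1 / ((x:ℂ) - I) - (-(Polynomial.C (P.eval I)⁻¹ * q)).eval (x:ℂ) =
      (P.eval I)⁻¹ * (P.eval (x:ℂ) * (1 / ((x:ℂ) - I))) := by
    rw [hq]
    simp only [Polynomial.eval_neg, Polynomial.eval_mul, Polynomial.eval_C]
    field_simp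
    ring
  simp only [] at e ⊢
  rw [e, norm_mul, norm_mul, norm_inv]
  have h1 := hP x hx
  have h2 := norm_u_le x
  have h3 : ‖P.eval I‖⁻¹ ≤ ε := by
    rw [inv_le_comm₀ hpos hε]; simpa using hPI.le
  calc ‖P.eval I‖⁻¹ * (‖P.eval (x:ℂ)‖ * ‖1 / ((x:ℂ) - I)‖) ≤ ε * ((1 * (W x).toReal) * 1) := by
        gcongr
    _ = _ := by ring

lemma real_dist {W : ℝ → ℝ≥0∞} (h : ¬ Appr W fun x => 1 / ((x:ℂ) - I)) :
    ∃ α β d : ℝ, 0 < d ∧ (∀ x : ℝ, |(α * x + β) / (x ^ 2 + 1)| ≤ 1) ∧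
      ∀ P : Polynomial ℝ, ∃ x, W x ≠ ⊤ ∧
        d * (W x).toReal < |(α * x + β) / (x ^ 2 + 1) - P.eval x| := by
  by_contra hcon
  push Not at hcon
  apply h
  intro ε hε
  have hb0 : ∀ x : ℝ, |((1:ℝ) * x + 0) / (x ^ 2 + 1)| ≤ 1 := by
    intro x
    rw [abs_div, abs_of_pos (show 0 < x ^ 2 + 1 by positivity), div_le_one (by positivity), abs_le]
    constructor <;> nlinarith [sq_nonneg (x - 1), sq_nonneg (x + 1)]
  have hb1 : ∀ x : ℝ, |((0:ℝ) * x + 1) / (x ^ 2 + 1)| ≤ 1 := by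
    intro x
    rw [abs_div, abs_of_pos (show 0 < x ^ 2 + 1 by positivity), div_le_one (by positivity), abs_le]
    constructor <;> nlinarith
  obtain ⟨P, hP⟩ := hcon 1 0 (ε / 2) (by positivity) hb0
  obtain ⟨Q, hQ⟩ := hcon 0 1 (ε / 2) (by positivity) hb1
  refine ⟨P.map (algebraMap ℝ ℂ) + Polynomial.C I * Q.map (algebraMap ℝ ℂ), fun x hx => ?_⟩
  have h1 := hP x hx
  have h2 := hQ x hx
  have hx2 : (x:ℂ) ^ 2 + 1 ≠ 0 := by
    have : x ^ 2 + 1 ≠ 0 := by positivity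
    exact_mod_cast this
  have ev : ∀ p : Polynomial ℝ, (p.map (algebraMap ℝ ℂ)).eval (x:ℂ) = ((p.eval x : ℝ) : ℂ) := by
    intro p
    exact Polynomial.eval_map_apply (f := algebraMap ℝ ℂ) (p := p) x
  have e : 1 / ((x:ℂ) - I) - (P.map (algebraMap ℝ ℂ) + Polynomial.C I * Q.map (algebraMap ℝ ℂ)).eval (x:ℂ)
      = (((1 * x + 0) / (x ^ 2 + 1) - P.eval x : ℝ) : ℂ) + I * (((0 * x + 1) / (x ^ 2 + 1) - Q.eval x : ℝ) : ℂ) := by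
    simp only [Polynomial.eval_add, Polynomial.eval_mul, Polynomial.eval_C, ev]
    push_cast
    have := x_sub_I_ne x
    field_simp
    ring_nf
    simp only [I_sq]
    ring
  simp only [] at e ⊢
  rw [e]
  refine (norm_add_le _ _).trans ?_
  rw [norm_mul, Complex.norm_I, Complex.norm_real, Complex.norm_real, Real.norm_eq_abs, Real.norm_eq_abs]
  linarith

end PartG

open Complex Filter Set MeasureTheory
open scoped ENNReal

section PartH

lemma poly_growth (P : Polynomial ℂ) (ε : ℝ) (hε : 0 < ε) :
    ∃ C : ℝ, 0 ≤ C ∧ ∀ z : ℂ, ‖P.eval z‖ ≤ C * Real.exp (ε * ‖z‖) := by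
  induction P using Polynomial.induction_on' with
  | add p q hp hq =>
    obtain ⟨C, hC0, hC⟩ := hp
    obtain ⟨D, hD0, hD⟩ := hq
    refine ⟨C + D, by positivity, fun z => ?_⟩
    rw [Polynomial.eval_add, add_mul]
    exact (norm_add_le _ _).trans (add_le_add (hC z) (hD z))
  | monomial k c =>
    refine ⟨‖c‖ * (k.factorial / ε ^ k), by positivity, fun z => ?_⟩
    rw [Polynomial.eval_monomial, norm_mul, norm_pow, mul_assoc]
    gcongr
    have := Real.pow_div_factorial_le_exp (ε * ‖z‖) (by positivity) k
    rw [mul_pow, div_le_iff₀ (by positivity)] at this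
    rw [div_mul_eq_mul_div, le_div_iff₀ (by positivity)]
    linarith

lemma nozero_lower (q : Polynomial ℂ) (hq : ∀ z : ℂ, 0 ≤ z.im → q.eval z ≠ 0) :
    ∃ c : ℝ, 0 < c ∧ ∀ z : ℂ, 0 ≤ z.im → c ≤ ‖q.eval z‖ := by
  have key : ∀ s : Multiset ℂ, (∀ a ∈ s, a.im < 0) → ∃ c : ℝ, 0 < c ∧ ∀ z : ℂ, 0 ≤ z.im →
      c ≤ ‖(s.map fun a => z - a).prod‖ := by
    intro s
    induction s using Multiset.induction_on with
    | empty => intro _; exact ⟨1, one_pos, by simp⟩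
    | cons a s ih =>
      intro h
      obtain ⟨c, hc, hcz⟩ := ih (fun b hb => h b (Multiset.mem_cons_of_mem hb))
      have ha := h a (Multiset.mem_cons_self a s)
      refine ⟨-a.im * c, by nlinarith, fun z hz => ?_⟩
      rw [Multiset.map_cons, Multiset.prod_cons, norm_mul]
      have h1 := Complex.abs_im_le_norm (z - a)
      rw [Complex.sub_im] at h1
      have h2 := le_abs_self (z.im - a.im)
      gcongr
      · linarith
      · exact hcz z hz
  have hq0 : q ≠ 0 := by rintro rfl; exact hq 0 (by simp) (by simp)
  obtain ⟨c, hc, hcz⟩ := key q.roots (by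
    intro a ha
    by_contra hcon
    exact hq a (not_lt.1 hcon) (Polynomial.isRoot_of_mem_roots ha))
  refine ⟨‖q.leadingCoeff‖ * c, mul_pos (norm_pos_iff.2 (by simpa using hq0)) hc, fun z hz => ?_⟩
  have := Polynomial.Splits.eval_eq_prod_roots (IsAlgClosed.splits q) z
  rw [this, norm_mul]
  gcongr
  exact hcz z hz

lemma max_UHP (p q : Polynomial ℂ) (hq : ∀ z : ℂ, 0 ≤ z.im → q.eval z ≠ 0)
    (h : ∀ x : ℝ, ‖p.eval (x:ℂ)‖ ≤ ‖q.eval (x:ℂ)‖) (z : ℂ) (hz : 0 ≤ z.im) :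
    ‖p.eval z‖ ≤ ‖q.eval z‖ := by
  obtain ⟨c, hc, hcz⟩ := nozero_lower q hq
  have hne : ∀ w : ℂ, 0 ≤ w.re → q.eval (I * w) ≠ 0 := fun w hw => hq _ (by simpa using hw)
  have := PL_half_gen (H := fun w => p.eval (I * w) / q.eval (I * w)) (B := 1) (by
    have hd : ∀ w : ℂ, 0 ≤ w.re → DifferentiableAt ℂ (fun w => p.eval (I * w) / q.eval (I * w)) w := by
      intro w hw
      apply DifferentiableAt.div
      · exact p.differentiable.differentiableAt.comp w (by fun_prop)
      · exact q.differentiable.differentiableAt.comp w (by fun_prop)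
      · exact hne w hw
    apply DifferentiableOn.diffContOnCl
    intro w hw
    rw [Complex.closure_setOf_lt_re] at hw
    exact (hd w hw).differentiableWithinAt) (by
    intro ε hε
    obtain ⟨C, hC0, hC⟩ := poly_growth p ε hε
    refine ⟨C / c, fun w hw => ?_⟩
    have h1 := hC (I * w)
    rw [norm_mul, Complex.norm_I, one_mul] at h1
    have h2 := hcz (I * w) (by simpa using hw)
    rw [norm_div]
    calc ‖p.eval (I * w)‖ / ‖q.eval (I * w)‖ ≤ C * Real.exp (ε * ‖w‖) / c := by gcongr
      _ = _ := by ring) (by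
    intro y
    have e : I * (y * I) = ((-y : ℝ) : ℂ) := by
      push_cast; rw [mul_comm, mul_assoc, I_mul_I]; ring
    simp only [e]
    rw [norm_div]
    exact div_le_one_of_le₀ (h _) (norm_nonneg _)) (-I * z) (by simpa using hz)
  have e : I * (-I * z) = z := by rw [← mul_assoc, mul_neg, I_mul_I]; ring
  simp only [e] at this
  rwa [norm_div, div_le_one (norm_pos_iff.2 (hq z hz))] at this

lemma factor_pos (n : ℕ) : ∀ T : Polynomial ℂ, T.natDegree ≤ n →
    (∀ x : ℝ, 0 < (T.eval (x:ℂ)).re ∧ (T.eval (x:ℂ)).im = 0) →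
    ∃ R : Polynomial ℂ, (∀ x : ℝ, ‖R.eval (x:ℂ)‖ ^ 2 = (T.eval (x:ℂ)).re) ∧
      ∀ z : ℂ, 0 ≤ z.im → R.eval z ≠ 0 := by
  induction n with
  | zero =>
    intro T hn hT
    obtain ⟨c, rfl⟩ := Polynomial.natDegree_eq_zero.1 (Nat.le_zero.1 hn)
    have h0 := hT 0
    simp only [Polynomial.eval_C] at h0
    refine ⟨Polynomial.C ((Real.sqrt c.re : ℝ) : ℂ), fun x => ?_, fun z _ => ?_⟩
    · simp only [Polynomial.eval_C]
      rw [Complex.norm_real, Real.norm_eq_abs, sq_abs, Real.sq_sqrt h0.1.le]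
    · simp only [Polynomial.eval_C]
      exact_mod_cast (Real.sqrt_pos.2 h0.1).ne'
  | succ n ih =>
    intro T hn hT
    by_cases hn' : T.natDegree ≤ n
    · exact ih T hn' hT
    have hdeg : 0 < T.degree := by
      rw [← Polynomial.natDegree_pos_iff_degree_pos]; omega
    obtain ⟨a₀, ha₀⟩ := Complex.exists_root hdeg
    have hconj : T.map (starRingEnd ℂ) = T := by
      apply Polynomial.eq_of_infinite_eval_eq
      apply (Set.infinite_range_of_injective Complex.ofReal_injective).mono
      rintro _ ⟨x, rfl⟩
      simp only [mem_setOf_eq]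
      rw [conj_eval, Complex.conj_ofReal]
      exact Complex.conj_eq_iff_im.2 (hT x).2
    have hroot : ∀ a, T.eval a = 0 → T.eval ((starRingEnd ℂ) a) = 0 := by
      intro a h
      rw [← hconj, conj_eval]; simp [h]
    have him : ∀ a, T.eval a = 0 → a.im ≠ 0 := by
      intro a h hi
      have e : a = (a.re : ℂ) := by apply Complex.ext <;> simp [hi]
      have := (hT a.re).1
      rw [← e, h] at this
      simp at this
    obtain ⟨a, ha, hai⟩ : ∃ a, T.eval a = 0 ∧ a.im < 0 := by
      rcases lt_or_gt_of_ne (him a₀ ha₀) with h | h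
      · exact ⟨a₀, ha₀, h⟩
      · exact ⟨(starRingEnd ℂ) a₀, hroot _ ha₀, by simpa using h⟩
    set b := (starRingEnd ℂ) a with hb
    have hba : b - a ≠ 0 := by
      intro h
      have := congrArg Complex.im h
      simp [hb] at this
      linarith
    obtain ⟨T₁, hT₁⟩ := Polynomial.dvd_iff_isRoot.2 (show T.IsRoot a from ha)
    have hb1 : T₁.eval b = 0 := by
      have := hroot a ha
      rw [← hb, hT₁] at this
      simp only [Polynomial.eval_mul, Polynomial.eval_sub, Polynomial.eval_X, Polynomial.eval_C] at this
      exact (mul_eq_zero.1 this).resolve_left hba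
    obtain ⟨T₂, hT₂⟩ := Polynomial.dvd_iff_isRoot.2 (show T₁.IsRoot b from hb1)
    have hTe : ∀ z, T.eval z = (z - a) * ((z - b) * T₂.eval z) := by
      intro z
      rw [hT₁, hT₂]; simp
    have hTx : ∀ x : ℝ, T.eval (x:ℂ) = ((‖(x:ℂ) - a‖ ^ 2 : ℝ) : ℂ) * T₂.eval (x:ℂ) := by
      intro x
      rw [hTe, ← mul_assoc]
      congr 1
      have e : (x:ℂ) - b = (starRingEnd ℂ) ((x:ℂ) - a) := by simp [hb]
      rw [e, Complex.mul_conj, Complex.normSq_eq_norm_sq]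
    have hpos : ∀ x : ℝ, 0 < ‖(x:ℂ) - a‖ ^ 2 := by
      intro x
      have : (x:ℂ) - a ≠ 0 := by
        intro h
        have := congrArg Complex.im h
        simp at this
        linarith
      positivity
    have hT0 : T ≠ 0 := by rintro rfl; simp at hdeg
    have hT₁0 : T₁ ≠ 0 := by rintro rfl; simp at hT₁; exact hT0 hT₁
    have hT₂0 : T₂ ≠ 0 := by rintro rfl; simp at hT₂; exact hT₁0 hT₂
    have hd2 : T₂.natDegree ≤ n := by
      have h1 : T.natDegree = 1 + T₁.natDegree := by
        conv_lhs => rw [hT₁]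
        rw [Polynomial.natDegree_mul (Polynomial.X_sub_C_ne_zero a) hT₁0, Polynomial.natDegree_X_sub_C]
      have h2 : T₁.natDegree = 1 + T₂.natDegree := by
        conv_lhs => rw [hT₂]
        rw [Polynomial.natDegree_mul (Polynomial.X_sub_C_ne_zero b) hT₂0, Polynomial.natDegree_X_sub_C]
      omega
    obtain ⟨R, hR1, hR2⟩ := ih T₂ hd2 (by
      intro x
      have h1 := hT x
      rw [hTx, Complex.re_ofReal_mul, Complex.im_ofReal_mul] at h1
      exact ⟨(pos_iff_pos_of_mul_pos h1.1).1 (hpos x), (mul_eq_zero.1 h1.2).resolve_left (hpos x).ne'⟩)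
    refine ⟨(Polynomial.X - Polynomial.C a) * R, fun x => ?_, fun z hz => ?_⟩
    · rw [Polynomial.eval_mul, norm_mul, mul_pow, hR1, hTx, Complex.re_ofReal_mul]
      simp
    · rw [Polynomial.eval_mul]
      apply mul_ne_zero _ (hR2 z hz)
      simp only [Polynomial.eval_sub, Polynomial.eval_X, Polynomial.eval_C]
      intro h
      have := congrArg Complex.im h
      simp at this
      linarith

end PartH

open Complex Filter Set MeasureTheory
open scoped ENNReal

section PartI

lemma conj_mul_eval (P : Polynomial ℂ) (x : ℝ) :
    (P * P.map (starRingEnd ℂ)).eval (x:ℂ) = ((‖P.eval (x:ℂ)‖ ^ 2 : ℝ) : ℂ) := by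
  rw [Polynomial.eval_mul, conj_eval, Complex.conj_ofReal, Complex.mul_conj, Complex.normSq_eq_norm_sq]

lemma cone_bound {W : ℝ → ℝ≥0∞} (h1 : ∀ x, 1 ≤ W x) {C : ℝ} (hC0 : 0 < C)
    (hC : ∀ P : Polynomial ℂ, Bd W (fun x => P.eval (x:ℂ)) 1 → ‖P.eval I‖ ≤ C) (a : ℝ) (ha : 0 < a) :
    ∃ B : ℝ, ∀ P : Polynomial ℂ, Bd W (fun x => P.eval (x:ℂ)) 1 → ∀ z : ℂ, 1 ≤ z.im →
      |z.re| ≤ z.im → ‖P.eval z‖ ≤ B * Real.exp (a * ‖z‖) := by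
  by_contra hcon
  push Not at hcon
  choose P hP z hz hz' hPz using fun j : ℕ => hcon (4 ^ j)
  set T : ℕ → Polynomial ℂ := fun N => 1 + ∑ j ∈ Finset.range N,
    Polynomial.C (((1/4 : ℝ) ^ j : ℝ) : ℂ) * (P j * (P j).map (starRingEnd ℂ)) with hT
  set t : ℕ → ℝ → ℝ := fun N x => 1 + ∑ j ∈ Finset.range N, (1/4 : ℝ) ^ j * ‖(P j).eval (x:ℂ)‖ ^ 2 with ht
  have hTt : ∀ N (x : ℝ), (T N).eval (x:ℂ) = ((t N x : ℝ) : ℂ) := by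
    intro N x
    simp only [hT, ht, Polynomial.eval_add, Polynomial.eval_one, Polynomial.eval_finset_sum,
      Polynomial.eval_mul (p := Polynomial.C _), Polynomial.eval_C, conj_mul_eval]
    push_cast
    rfl
  have ht1 : ∀ N x, 1 ≤ t N x := by
    intro N x
    have : 0 ≤ ∑ j ∈ Finset.range N, (1/4 : ℝ) ^ j * ‖(P j).eval (x:ℂ)‖ ^ 2 :=
      Finset.sum_nonneg fun j _ => by positivity
    simp only [ht]; linarith
  have hex : ∀ N, ∃ R : Polynomial ℂ, (∀ x : ℝ, ‖R.eval (x:ℂ)‖ ^ 2 = t N x) ∧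
      ∀ z : ℂ, 0 ≤ z.im → R.eval z ≠ 0 := by
    intro N
    obtain ⟨R, hR, hR'⟩ := factor_pos (T N).natDegree (T N) le_rfl (by
      intro x
      rw [hTt]
      refine ⟨?_, by simp⟩
      rw [Complex.ofReal_re]; linarith [ht1 N x])
    refine ⟨R, fun x => ?_, hR'⟩
    rw [hR, hTt, Complex.ofReal_re]
  choose R hR hRne using hex
  have htmono : ∀ x, Monotone fun N => t N x := by
    intro x
    apply monotone_nat_of_le_succ
    intro N
    simp only [ht, Finset.sum_range_succ]
    have : 0 ≤ (1/4 : ℝ) ^ N * ‖(P N).eval (x:ℂ)‖ ^ 2 := by positivity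
    linarith
  have hRmono : ∀ M N, M ≤ N → ∀ z : ℂ, 0 ≤ z.im → ‖(R M).eval z‖ ≤ ‖(R N).eval z‖ := by
    intro M N hMN z hz
    apply max_UHP _ _ (hRne N) _ z hz
    intro x
    rw [← pow_le_pow_iff_left₀ (norm_nonneg _) (norm_nonneg _) two_ne_zero, hR, hR]
    exact htmono x hMN
  have hR1 : ∀ N, ∀ z : ℂ, 0 ≤ z.im → 1 ≤ ‖(R N).eval z‖ := by
    intro N z hz
    have := max_UHP 1 (R N) (hRne N) (by
      intro x
      rw [← pow_le_pow_iff_left₀ (norm_nonneg _) (norm_nonneg _) two_ne_zero, hR]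
      simpa using ht1 N x) z hz
    simpa using this
  have hPR : ∀ j N, j < N → ∀ z : ℂ, 0 ≤ z.im → ‖(P j).eval z‖ ≤ 2 ^ j * ‖(R N).eval z‖ := by
    intro j N hjN z hz
    have := max_UHP (Polynomial.C (((1/2 : ℝ) ^ j : ℝ) : ℂ) * P j) (R N) (hRne N) (by
      intro x
      rw [← pow_le_pow_iff_left₀ (norm_nonneg _) (norm_nonneg _) two_ne_zero, hR, Polynomial.eval_mul,
        Polynomial.eval_C, norm_mul, Complex.norm_real, Real.norm_eq_abs, abs_of_pos (by positivity), mul_pow,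
        ← pow_mul, mul_comm j 2, pow_mul]
      have h2 := Finset.single_le_sum (f := fun j => (1/4 : ℝ) ^ j * ‖(P j).eval (x:ℂ)‖ ^ 2)
        (fun i _ => by positivity) (Finset.mem_range.2 hjN)
      simp only [ht]
      have e : ((1:ℝ)/2) ^ 2 = 1 / 4 := by norm_num
      rw [e]
      linarith) z hz
    rw [Polynomial.eval_mul, Polynomial.eval_C, norm_mul, Complex.norm_real, Real.norm_eq_abs,
      abs_of_pos (by positivity), one_div, inv_pow, inv_mul_le_iff₀ (by positivity)] at this
    exact this
  have hRC : ∀ N, ‖(R N).eval I‖ ≤ 2 * C := by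
    intro N
    have := hC (Polynomial.C (1/2) * R N) (by
      intro x hx
      simp only [Polynomial.eval_mul, Polynomial.eval_C, norm_mul]
      have hw := toReal_ge_one h1 hx
      set w := (W x).toReal
      have hS : t N x ≤ (2 * w) ^ 2 := by
        have h3 : ∑ j ∈ Finset.range N, (1/4 : ℝ) ^ j * ‖(P j).eval (x:ℂ)‖ ^ 2 ≤
            ∑ j ∈ Finset.range N, (1/4 : ℝ) ^ j * w ^ 2 := by
          apply Finset.sum_le_sum
          intro j _
          have := hP j x hx
          rw [one_mul] at this
          gcongr
        have h4 : ∑ j ∈ Finset.range N, (1/4 : ℝ) ^ j ≤ 4 / 3 := by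
          rw [geom_sum_eq (by norm_num)]
          have : 0 ≤ (1/4 : ℝ) ^ N := by positivity
          rw [div_le_iff_of_neg (by norm_num)]
          linarith
        rw [← Finset.sum_mul] at h3
        simp only [ht]
        nlinarith
      rw [← hR, pow_le_pow_iff_left₀ (norm_nonneg _) (by positivity) two_ne_zero] at hS
      have e : ‖(1/2 : ℂ)‖ = 1 / 2 := by simp
      rw [e]
      linarith)
    simp only [Polynomial.eval_mul, Polynomial.eval_C, norm_mul] at this
    have e : ‖(1/2 : ℂ)‖ = 1 / 2 := by simp
    rw [e] at this
    linarith
  have hbdd : BddAbove (range fun N => ‖(R N).eval I‖) := ⟨2 * C, by rintro _ ⟨N, rfl⟩; exact hRC N⟩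
  set s := ⨆ N, ‖(R N).eval I‖ with hs
  have hI : (0:ℝ) ≤ I.im := by simp
  have hs1 : 1 ≤ s := (hR1 0 I hI).trans (le_ciSup hbdd 0)
  obtain ⟨N₀, hN₀⟩ : ∃ N₀, s * Real.exp (-(a / 12)) < ‖(R N₀).eval I‖ := by
    apply exists_lt_of_lt_ciSup
    have : Real.exp (-(a/12)) < 1 := by rw [Real.exp_lt_one_iff]; linarith
    rw [← hs]
    nlinarith
  obtain ⟨B₀, hB₀, hB⟩ := poly_growth (R N₀) (a / 2) (by positivity)
  have hfin : ∀ N, N₀ ≤ N → ∀ z : ℂ, 1 ≤ z.im → |z.re| ≤ z.im →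
      ‖(R N).eval z‖ ≤ B₀ * Real.exp (a * ‖z‖) := by
    intro N hN z hz hz'
    have hne : ∀ z : ℂ, 0 < z.im → (R N).eval z ≠ 0 := fun z h => hRne N z h.le
    have := harnack_cone (f := fun z => (R N₀).eval z / (R N).eval z)
      (fun z hz => ((R N₀).differentiable.differentiableAt.div (R N).differentiable.differentiableAt
        (hne z hz)).differentiableWithinAt)
      (fun z hz => div_ne_zero (hRne N₀ z (le_of_lt hz)) (hne z hz))
      (fun z hz => by
        rw [norm_div]
        exact div_le_one_of_le₀ (hRmono N₀ N hN z hz.le) (norm_nonneg _)) hz hz'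
    simp only [norm_div] at this
    have hRIpos : 0 < ‖(R N).eval I‖ := lt_of_lt_of_le one_pos (hR1 N I hI)
    have hRzpos : 0 < ‖(R N).eval z‖ := lt_of_lt_of_le one_pos (hR1 N z (by linarith))
    have h5 : Real.exp (-(a/12)) ≤ ‖(R N₀).eval I‖ / ‖(R N).eval I‖ := by
      rw [le_div_iff₀ hRIpos]
      have := le_ciSup hbdd N
      nlinarith [Real.exp_pos (-(a/12))]
    have h6 : Real.exp (-(a/12) * (6 * ‖z‖)) ≤ ‖(R N₀).eval z‖ / ‖(R N).eval z‖ := by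
      refine le_trans ?_ this
      rw [Real.exp_mul]
      apply Real.rpow_le_rpow (Real.exp_pos _).le h5 (by positivity)
    rw [le_div_iff₀ hRzpos] at h6
    have h7 := h6.trans (hB z)
    have e1 : -(a/12) * (6 * ‖z‖) = -(a / 2 * ‖z‖) := by ring
    rw [e1, Real.exp_neg, inv_mul_le_iff₀ (Real.exp_pos _)] at h7
    refine h7.trans (le_of_eq ?_)
    have : a * ‖z‖ = a / 2 * ‖z‖ + a / 2 * ‖z‖ := by ring
    rw [this, Real.exp_add]; ring
  obtain ⟨j, hj⟩ := pow_unbounded_of_one_lt B₀ (show (1:ℝ) < 2 by norm_num)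
  have h8 := hPR j (max N₀ (j + 1)) (by omega) (z j) (by linarith [hz j])
  have h9 := hfin (max N₀ (j + 1)) (le_max_left _ _) (z j) (hz j) (hz' j)
  have h10 := hPz j
  have h11 : (4:ℝ) ^ j * Real.exp (a * ‖z j‖) < 2 ^ j * (B₀ * Real.exp (a * ‖z j‖)) :=
    h10.trans_le (h8.trans (by gcongr))
  have e4 : (4:ℝ) ^ j = 2 ^ j * 2 ^ j := by rw [← mul_pow]; norm_num
  rw [e4, mul_assoc] at h11
  have h12 := lt_of_mul_lt_mul_left h11 (by positivity)
  have h13 := lt_of_mul_lt_mul_right h12 (Real.exp_pos _).le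
  linarith

end PartI

open Complex Filter Set MeasureTheory
open scoped ENNReal

section PartJ

lemma compact_convexHull {E : Type} [NormedAddCommGroup E] [NormedSpace ℝ E] [FiniteDimensional ℝ E]
    {s : Set E} (hs : IsCompact s) (h0 : (0:E) ∈ s) : IsCompact (convexHull ℝ s) := by
  classical
  set N := Module.finrank ℝ E + 1 with hN
  set φ : (Fin N → ℝ) × (Fin N → E) → E := fun p => ∑ i, p.1 i • p.2 i with hφ
  have hφc : Continuous φ := by
    simp only [hφ]
    fun_prop
  have hK : IsCompact ((stdSimplex ℝ (Fin N)) ×ˢ (Set.pi univ fun _ : Fin N => s)) :=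
    (isCompact_stdSimplex ℝ (Fin N)).prod (isCompact_univ_pi fun _ => hs)
  have : convexHull ℝ s = φ '' ((stdSimplex ℝ (Fin N)) ×ˢ (Set.pi univ fun _ : Fin N => s)) := by
    apply Subset.antisymm
    · intro x hx
      obtain ⟨ι, hι, z, w, hz, haff, hw, hsum, hx⟩ := eq_pos_convex_span_of_mem_convexHull hx
      have hcard : Fintype.card ι ≤ N := by
        refine haff.card_le_finrank_succ.trans ?_
        rw [hN]
        gcongr
        exact Submodule.finrank_le _
      obtain ⟨e⟩ : Nonempty (ι ↪ Fin N) := by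
        apply Function.Embedding.nonempty_of_card_le
        simpa using hcard
      refine ⟨(Function.extend e w 0, Function.extend e z 0), ⟨⟨?_, ?_⟩, ?_⟩, ?_⟩
      · intro j
        by_cases hj : ∃ i, e i = j
        · obtain ⟨i, rfl⟩ := hj
          simp only [e.injective.extend_apply]
          exact (hw i).le
        · simp [Function.extend_apply' _ _ _ hj]
      · simp only
        rw [← hsum]
        rw [← Finset.sum_subset (Finset.subset_univ (Finset.univ.map e)), Finset.sum_map]
        · simp only [e.injective.extend_apply]
        · intro j _ hj
          rw [Function.extend_apply' _ _ _ (by simpa using hj)]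
          rfl
      · intro j _
        simp only
        by_cases hj : ∃ i, e i = j
        · obtain ⟨i, rfl⟩ := hj
          simp only [e.injective.extend_apply]
          exact hz ⟨i, rfl⟩
        · rw [Function.extend_apply' _ _ _ hj]
          exact h0
      · simp only [hφ]
        rw [← hx]
        rw [← Finset.sum_subset (Finset.subset_univ (Finset.univ.map e)), Finset.sum_map]
        · simp only [e.injective.extend_apply]
        · intro j _ hj
          rw [Function.extend_apply' _ _ _ (by simpa using hj)]
          simp
    · rintro _ ⟨⟨t, z⟩, ⟨ht, hz⟩, rfl⟩
      exact (convex_convexHull ℝ s).sum_mem (fun i _ => ht.1 i) ht.2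
        (fun i _ => subset_convexHull ℝ s (hz i (mem_univ i)))
  rw [this]
  exact hK.image hφc

/-- the curve -/
def vcurve (f : ℝ → ℝ) (n : ℕ) (x : ℝ) : ℝ × (Fin (n + 1) → ℝ) := (f x, fun k => x ^ (k : ℕ))

/-- star hull -/
def starset (W : ℝ → ℝ≥0∞) (f : ℝ → ℝ) (n : ℕ) : Set (ℝ × (Fin (n + 1) → ℝ)) :=
  (fun p : ℝ × ℝ => p.1 • vcurve f n p.2) '' {p | W p.2 ≤ (ENNReal.ofReal |p.1|)⁻¹}

lemma mem_D {W : ℝ → ℝ≥0∞} (h1 : ∀ x, 1 ≤ W x) {s x : ℝ} (h : W x ≤ (ENNReal.ofReal |s|)⁻¹) (hs : s ≠ 0) :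
    W x ≠ ⊤ ∧ |s| * (W x).toReal ≤ 1 := by
  have hs' : 0 < |s| := abs_pos.2 hs
  have hne : (ENNReal.ofReal |s|)⁻¹ ≠ ⊤ := by
    simp [hs]
  have hx : W x ≠ ⊤ := ne_top_of_le_ne_top hne h
  refine ⟨hx, ?_⟩
  have := ENNReal.toReal_mono hne h
  rw [ENNReal.toReal_inv, ENNReal.toReal_ofReal hs'.le] at this
  calc |s| * (W x).toReal ≤ |s| * |s|⁻¹ := by gcongr
    _ = 1 := mul_inv_cancel₀ hs'.ne'

lemma D_mem {W : ℝ → ℝ≥0∞} {s x : ℝ} (hx : W x ≠ ⊤) (h : |s| * (W x).toReal ≤ 1) :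
    W x ≤ (ENNReal.ofReal |s|)⁻¹ := by
  rw [ENNReal.le_inv_iff_mul_le, mul_comm, ← ENNReal.ofReal_toReal hx, ← ENNReal.ofReal_mul (abs_nonneg _)]
  rw [← ENNReal.ofReal_one]
  exact ENNReal.ofReal_le_ofReal h

lemma weight_tail {W : ℝ → ℝ≥0∞} (hW : IsWeight W) (n : ℕ) (δ : ℝ) (hδ : 0 < δ) :
    ∃ R : ℝ, 1 ≤ R ∧ ∀ x, R ≤ |x| → W x ≠ ⊤ → |x| ^ n ≤ δ * (W x).toReal := by
  obtain ⟨-, h1, h2, -⟩ := hW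
  have h3 := (h2 n).eventually (gt_mem_nhds (show (0:ℝ≥0∞) < ENNReal.ofReal δ by simpa using hδ))
  rw [eventually_comap] at h3
  obtain ⟨R, hR⟩ := eventually_atTop.1 h3
  refine ⟨max R 1, le_max_right _ _, fun x hx hWx => ?_⟩
  have h4 := (hR _ ((le_max_left _ _).trans hx) x rfl).le
  rw [ENNReal.div_le_iff_le_mul (Or.inl (by have := h1 x; intro h; simp [h] at this))
    (Or.inl hWx)] at h4
  have h3 := ENNReal.toReal_mono (by finiteness) h4
  rwa [ENNReal.toReal_mul, ENNReal.toReal_ofReal (by positivity), ENNReal.toReal_ofReal hδ.le] at h3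

lemma starset_compact {W : ℝ → ℝ≥0∞} (hW : IsWeight W) (f : ℝ → ℝ) (hf : Continuous f)
    (hf1 : ∀ x, |f x| ≤ 1) (n : ℕ) : IsCompact (starset W f n) := by
  have h1 := hW.2.1
  set D : Set (ℝ × ℝ) := {p | W p.2 ≤ (ENNReal.ofReal |p.1|)⁻¹} with hD
  have hDc : IsClosed D := by
    have := hW.1.isClosed_epigraph
    exact this.preimage (f := fun p : ℝ × ℝ => (p.2, (ENNReal.ofReal |p.1|)⁻¹))
      (continuous_snd.prodMk (continuous_inv.comp (ENNReal.continuous_ofReal.comp (continuous_abs.comp continuous_fst))))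
  set ψ : ℝ × ℝ → ℝ × (Fin (n + 1) → ℝ) := fun p => p.1 • vcurve f n p.2 with hψ
  have hψc : Continuous ψ := by
    simp only [hψ, vcurve]
    fun_prop
  have hDR : ∀ R : ℝ, IsCompact (D ∩ (Icc (-1) 1 ×ˢ Icc (-R) R)) := fun R =>
    (isCompact_Icc.prod isCompact_Icc).inter_left hDc
  have hs1 : ∀ p ∈ D, |p.1| ≤ 1 := by
    intro p hp
    by_cases h : p.1 = 0
    · simp [h]
    · obtain ⟨h2, h3⟩ := mem_D h1 hp h
      have := toReal_ge_one h1 h2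
      nlinarith [abs_nonneg p.1]
  have hsub : ∀ δ : ℝ, 0 < δ → ∃ R, starset W f n ⊆ ψ '' (D ∩ (Icc (-1) 1 ×ˢ Icc (-R) R)) ∪
      Metric.closedBall 0 δ := by
    intro δ hδ
    obtain ⟨R, hR1, hR⟩ := weight_tail hW n δ hδ
    refine ⟨R, ?_⟩
    rintro _ ⟨p, hp, rfl⟩
    by_cases hpR : |p.2| ≤ R
    · left
      exact ⟨p, ⟨hp, abs_le.1 (hs1 p hp), abs_le.1 hpR⟩, rfl⟩
    · right
      push Not at hpR
      rw [mem_closedBall_zero_iff]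
      by_cases h : p.1 = 0
      · simp [h, hδ.le]
      · obtain ⟨h2, h3⟩ := mem_D h1 hp h
        have h4 := hR p.2 hpR.le h2
        have hx1 : 1 ≤ |p.2| := by linarith
        have h5 : ‖vcurve f n p.2‖ ≤ |p.2| ^ n := by
          simp only [vcurve]
          rw [Prod.norm_def]
          apply max_le
          · exact (hf1 _).trans (one_le_pow₀ hx1)
          · rw [pi_norm_le_iff_of_nonneg (by positivity)]
            intro k
            rw [Real.norm_eq_abs, abs_pow]
            exact pow_le_pow_right₀ hx1 (by omega)
        rw [norm_smul, Real.norm_eq_abs]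
        calc |p.1| * ‖vcurve f n p.2‖ ≤ |p.1| * (δ * (W p.2).toReal) := by
              gcongr; exact h5.trans h4
          _ = δ * (|p.1| * (W p.2).toReal) := by ring
          _ ≤ δ := mul_le_of_le_one_right hδ.le h3
  have h0 : (0 : ℝ × (Fin (n + 1) → ℝ)) ∈ starset W f n := ⟨(0, 0), by simp, by simp⟩
  apply Metric.isCompact_of_isClosed_isBounded
  · rw [← closure_subset_iff_isClosed]
    intro y hy
    by_cases hy0 : y = 0
    · rw [hy0]; exact h0
    · have hyp : 0 < ‖y‖ := norm_pos_iff.2 hy0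
      obtain ⟨R, hR⟩ := hsub (‖y‖ / 2) (by positivity)
      have h2 := closure_mono hR hy
      rw [closure_union, ((hDR R).image hψc).isClosed.closure_eq, Metric.isClosed_closedBall.closure_eq] at h2
      rcases h2 with ⟨p, hp, hpy⟩ | h2
      · exact ⟨p, hp.1, hpy⟩
      · rw [mem_closedBall_zero_iff] at h2
        linarith
  · obtain ⟨R, hR⟩ := hsub 1 one_pos
    exact (((hDR R).image hψc).isBounded.union Metric.isBounded_closedBall).subset hR

end PartJ

open Complex Filter Set MeasureTheory
open scoped ENNReal

section PartK

lemma lin_eval {n : ℕ} (l : (ℝ × (Fin (n + 1) → ℝ)) →ₗ[ℝ] ℝ) (f : ℝ → ℝ) :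
    ∃ p : Polynomial ℝ, p.natDegree ≤ n ∧ (∀ x, l (vcurve f n x) = l (1, 0) * f x + p.eval x) ∧
      (l (1, 0) = 0 → p = 0 → l = 0) := by
  refine ⟨∑ k : Fin (n + 1), Polynomial.C (l (0, Pi.single k 1)) * Polynomial.X ^ (k : ℕ), ?_, ?_, ?_⟩
  · apply Polynomial.natDegree_sum_le_of_forall_le
    intro k _
    exact (Polynomial.natDegree_C_mul_X_pow_le _ _).trans (by omega)
  · intro x
    have h : vcurve f n x = f x • ((1 : ℝ), (0 : Fin (n + 1) → ℝ)) +
        ∑ k : Fin (n + 1), (x ^ (k : ℕ)) • ((0 : ℝ), (Pi.single k 1 : Fin (n + 1) → ℝ)) := by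
      ext j
      · simp [vcurve, Prod.fst_sum]
      · simp [vcurve, Prod.snd_sum, Finset.sum_apply, Pi.single_apply]
    rw [h, map_add, map_sum, map_smul]
    simp only [map_smul, smul_eq_mul, Polynomial.eval_finset_sum, Polynomial.eval_mul, Polynomial.eval_C,
      Polynomial.eval_pow, Polynomial.eval_X]
    congr 1
    · ring
    · exact Finset.sum_congr rfl fun k _ => by ring
  · intro h0 hp
    have hc : ∀ k : Fin (n + 1), l (0, Pi.single k 1) = 0 := by
      intro k
      have := congrArg (fun q => Polynomial.coeff q (k : ℕ)) hp
      simp only [Polynomial.finset_sum_coeff, Polynomial.coeff_C_mul, Polynomial.coeff_X_pow,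
        Polynomial.coeff_zero] at this
      rw [Finset.sum_eq_single k] at this
      · simpa using this
      · intro b _ hb
        have : (k : ℕ) ≠ b := fun h => hb (Fin.ext h.symm)
        simp [this]
      · simp
    apply LinearMap.ext
    rintro ⟨u, v⟩
    have h : ((u, v) : ℝ × (Fin (n + 1) → ℝ)) = u • ((1 : ℝ), (0 : Fin (n + 1) → ℝ)) +
        ∑ k : Fin (n + 1), (v k) • ((0 : ℝ), (Pi.single k 1 : Fin (n + 1) → ℝ)) := by
      ext j
      · simp [Prod.fst_sum]
      · simp [Prod.snd_sum, Finset.sum_apply, Pi.single_apply]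
    rw [h, map_add, map_sum, map_smul]
    simp only [map_smul, h0, hc, smul_zero, Finset.sum_const_zero, add_zero, LinearMap.zero_apply]

lemma ext1 {W : ℝ → ℝ≥0∞} (hW : IsWeight W) (f : ℝ → ℝ) (hf : Continuous f)
    (hf1 : ∀ x, |f x| ≤ 1) (d : ℝ) (hd : 0 < d)
    (hdist : ∀ P : Polynomial ℝ, ∃ x, W x ≠ ⊤ ∧ d * (W x).toReal < |f x - P.eval x|) (n : ℕ) :
    ∃ (P : Polynomial ℝ) (dn : ℝ) (ι : Type) (_ : Fintype ι) (x t s : ι → ℝ),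
      P.natDegree ≤ n ∧ d ≤ dn ∧ dn ≤ 1 ∧ (∀ x, W x ≠ ⊤ → |f x - P.eval x| ≤ dn * (W x).toReal) ∧
      Fintype.card ι ≤ n + 2 ∧ Function.Injective x ∧ (∀ i, 0 < t i) ∧ ∑ i, t i = 1 ∧
      (∀ i, W (x i) ≠ ⊤ ∧ |s i| * (W (x i)).toReal = 1 ∧ s i * (f (x i) - P.eval (x i)) = dn) ∧
      ∀ k, k ≤ n → ∑ i, t i * s i * x i ^ k = 0 := by
  classical
  have h1 := hW.2.1
  have hAinf : {x | W x ≠ ⊤}.Infinite := by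
    obtain ⟨x₀, hx₀⟩ := hW.2.2.2
    exact (accPt_iff_frequently.1 hx₀ |>.mono fun _ h => h) |> fun h hfin => by
      have := hx₀
      rw [accPt_iff_frequently] at this
      have h2 : ∀ᶠ y in nhds x₀, y ∉ {x | W x ≠ ⊤} \ {x₀} :=
        (hfin.subset diff_subset).isClosed.isOpen_compl.mem_nhds (by simp)
      exact this (h2.mono fun y hy hy2 => hy ⟨hy2.2, hy2.1⟩)
  set E := ℝ × (Fin (n + 1) → ℝ) with hE
  set S : Set E := starset W f n with hS
  have h0S : (0 : E) ∈ S := ⟨(0, 0), by simp, by simp⟩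
  set K := convexHull ℝ S with hK
  have hKc : IsCompact K := compact_convexHull (starset_compact hW f hf hf1 n) h0S
  have hKconv : Convex ℝ K := convex_convexHull ℝ S
  have hSneg : ∀ z ∈ S, -z ∈ S := by
    rintro _ ⟨p, hp, rfl⟩
    refine ⟨(-p.1, p.2), by simpa using hp, by simp⟩
  have hKneg : ∀ z ∈ K, -z ∈ K := by
    have : K ⊆ -K := by
      apply convexHull_min
      · intro z hz
        exact subset_convexHull ℝ S (hSneg z hz)
      · exact hKconv.neg
    exact fun z hz => this hz
  have hvS : ∀ x, W x ≠ ⊤ → (W x).toReal⁻¹ • vcurve f n x ∈ S := by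
    intro x hx
    have hp : 0 < (W x).toReal := lt_of_lt_of_le one_pos (toReal_ge_one h1 hx)
    refine ⟨((W x).toReal⁻¹, x), D_mem hx ?_, rfl⟩
    rw [abs_of_pos (by positivity), inv_mul_cancel₀ hp.ne']
  have hspan : Submodule.span ℝ S = ⊤ := by
    by_contra hne
    obtain ⟨l, hl0, hl⟩ := Submodule.exists_le_ker_of_lt_top _ (lt_top_iff_ne_top.2 hne)
    obtain ⟨p, -, hp2, hp3⟩ := lin_eval l f
    have hv : ∀ x, W x ≠ ⊤ → l (1, 0) * f x + p.eval x = 0 := by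
      intro x hx
      have hp : 0 < (W x).toReal := lt_of_lt_of_le one_pos (toReal_ge_one h1 hx)
      have := hl (Submodule.subset_span (hvS x hx))
      rw [LinearMap.mem_ker, map_smul, hp2, smul_eq_mul] at this
      rcases mul_eq_zero.1 this with h | h
      · exact absurd h (by positivity)
      · exact h
    by_cases ha : l (1, 0) = 0
    · apply hl0 (hp3 ha _)
      refine Polynomial.eq_zero_of_infinite_isRoot p (hAinf.mono ?_)
      intro x hx
      have := hv x hx
      rw [ha] at this
      simpa using this
    · obtain ⟨x, hx, hx2⟩ := hdist (Polynomial.C (-(l (1, 0))⁻¹) * p)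
      have h3 := hv x hx
      have h4 : f x - (Polynomial.C (-(l (1, 0))⁻¹) * p).eval x = 0 := by
        rw [Polynomial.eval_mul, Polynomial.eval_C]
        field_simp
        linarith
      rw [h4, abs_zero] at hx2
      have := toReal_ge_one h1 hx
      nlinarith
  have haff : affineSpan ℝ S = ⊤ := by
    rw [← AffineSubspace.direction_eq_top_iff_of_nonempty ⟨0, subset_affineSpan ℝ S h0S⟩]
    rw [eq_top_iff, ← hspan, Submodule.span_le]
    intro z hz
    have := AffineSubspace.vsub_mem_direction (subset_affineSpan ℝ S hz) (subset_affineSpan ℝ S h0S)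
    simpa using this
  have hint : (interior K).Nonempty := interior_convexHull_nonempty_iff_affineSpan_eq_top.2 haff
  have h0int : (0 : E) ∈ interior K := by
    obtain ⟨y, hy⟩ := hint
    have := hKconv.combo_interior_self_mem_interior hy (hKneg y (interior_subset hy)) (a := 1/2) (b := 1/2)
      (by norm_num) (by norm_num) (by norm_num)
    simpa using this
  -- maximal point
  have hTc : IsCompact {s : ℝ | ((s, 0) : E) ∈ K} := by
    have hcl : IsClosed {s : ℝ | ((s, 0) : E) ∈ K} :=
      hKc.isClosed.preimage (f := fun s : ℝ => ((s, 0) : E)) (by fun_prop)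
    refine Metric.isCompact_of_isClosed_isBounded hcl ?_
    obtain ⟨R, hR⟩ := hKc.isBounded.exists_norm_le
    refine isBounded_iff_forall_norm_le.2 ⟨R, fun s hs => ?_⟩
    exact (le_max_left _ _).trans (hR _ hs)
  obtain ⟨dn, hdn, hmax⟩ := hTc.exists_isGreatest ⟨0, show (0 : E) ∈ K from interior_subset h0int⟩
  have hpint : ((dn, 0) : E) ∉ interior K := by
    intro h
    have : ∀ᶠ s in nhds dn, ((s, 0) : E) ∈ K := by
      have hc : ContinuousAt (fun s : ℝ => ((s, 0) : E)) dn := by fun_prop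
      exact hc.eventually (mem_interior_iff_mem_nhds.1 h)
    obtain ⟨ε, hε, h2⟩ := Metric.eventually_nhds_iff.1 this
    have h3 : dn + ε / 2 ≤ dn := hmax (h2 (by
      rw [Real.dist_eq]
      simp only [add_sub_cancel_left]
      rw [abs_of_pos (by positivity)]; linarith))
    linarith
  obtain ⟨l, hl⟩ := geometric_hahn_banach_open_point hKconv.interior isOpen_interior hpint
  have hlK : ∀ z ∈ K, l z ≤ l (dn, 0) := by
    intro z hz
    have : z ∈ closure (interior K) := by
      rw [hKconv.closure_interior_eq_closure_of_nonempty_interior hint]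
      exact subset_closure hz
    have hcl : IsClosed {z | l z ≤ l (dn, 0)} := isClosed_le l.continuous continuous_const
    exact closure_minimal (fun y hy => (hl y hy).le) hcl this
  have hlp : 0 < l (dn, 0) := by simpa using hl 0 h0int
  have hlp2 : l (dn, 0) = dn * l (1, 0) := by
    have e : ((dn, 0) : E) = dn • ((1, 0) : E) := by
      show ((dn, 0) : ℝ × (Fin (n + 1) → ℝ)) = dn • ((1, 0) : ℝ × (Fin (n + 1) → ℝ))
      simp
    rw [e, map_smul, smul_eq_mul]
  have hdn0 : 0 ≤ dn := hmax (show (0 : E) ∈ K from interior_subset h0int)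
  have hdnp : 0 < dn := lt_of_le_of_ne hdn0 (by rintro h; rw [hlp2, ← h] at hlp; simp at hlp)
  set a := l (1, 0) with ha
  have hap : 0 < a := by
    rw [hlp2] at hlp
    by_contra h; push Not at h; nlinarith
  obtain ⟨p, hp1, hp2, -⟩ := lin_eval l.toLinearMap f
  have hp2 : ∀ x, l (vcurve f n x) = a * f x + p.eval x := hp2
  set P : Polynomial ℝ := Polynomial.C (-a⁻¹) * p with hP
  have hPe : ∀ x, l (vcurve f n x) = a * (f x - P.eval x) := by
    intro x
    rw [hp2, hP, Polynomial.eval_mul, Polynomial.eval_C]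
    field_simp
    ring
  have hbd : ∀ x, W x ≠ ⊤ → |f x - P.eval x| ≤ dn * (W x).toReal := by
    intro x hx
    have hp : 0 < (W x).toReal := lt_of_lt_of_le one_pos (toReal_ge_one h1 hx)
    have h2 := hlK _ (subset_convexHull ℝ S (hvS x hx))
    have h3 := hlK _ (subset_convexHull ℝ S (hSneg _ (hvS x hx)))
    rw [map_neg, map_smul, hPe, hlp2, smul_eq_mul] at h3
    rw [map_smul, hPe, hlp2, smul_eq_mul] at h2
    have e : (W x).toReal⁻¹ * (a * (f x - P.eval x)) = a * ((f x - P.eval x) / (W x).toReal) := by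
      field_simp
    rw [e] at h2 h3
    have h4 : (f x - P.eval x) / (W x).toReal ≤ dn := by
      by_contra h; push Not at h; nlinarith
    have h5 : -dn ≤ (f x - P.eval x) / (W x).toReal := by
      by_contra h; push Not at h; nlinarith
    rw [div_le_iff₀ hp] at h4
    rw [le_div_iff₀ hp] at h5
    rw [abs_le]; constructor <;> linarith
  have hddn : d ≤ dn := by
    obtain ⟨x, hx, hx2⟩ := hdist P
    have := hbd x hx
    have hp : 0 < (W x).toReal := lt_of_lt_of_le one_pos (toReal_ge_one h1 hx)
    by_contra h
    push Not at h
    nlinarith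
  obtain ⟨ι, hι, z, t, hz, haffi, ht, htsum, hzp⟩ := eq_pos_convex_span_of_mem_convexHull
    (show ((dn, 0) : E) ∈ convexHull ℝ S from hdn)
  have hlz : ∀ i, l (z i) = l (dn, 0) := by
    have hle : ∀ i ∈ Finset.univ, t i * l (z i) ≤ t i * l (dn, 0) := fun i _ =>
      mul_le_mul_of_nonneg_left (hlK _ (subset_convexHull ℝ S (hz ⟨i, rfl⟩))) (ht i).le
    have hsum : ∑ i, t i * l (z i) = ∑ i, t i * l (dn, 0) := by
      rw [← Finset.sum_mul, htsum, one_mul, ← hzp, map_sum]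
      simp
    intro i
    have := (Finset.sum_eq_sum_iff_of_le hle).1 hsum i (Finset.mem_univ i)
    exact mul_left_cancel₀ (ht i).ne' this
  choose q hqD hqz using fun i => hz ⟨i, rfl⟩
  have hqz : ∀ i, (q i).1 • vcurve f n (q i).2 = z i := hqz
  have hs1 : ∀ i, (q i).1 * (f (q i).2 - P.eval (q i).2) = dn := by
    intro i
    have := hlz i
    rw [← hqz, map_smul, hPe, hlp2, smul_eq_mul] at this
    have h2 : a * ((q i).1 * (f (q i).2 - P.eval (q i).2)) = a * dn := by linarith
    exact mul_left_cancel₀ hap.ne' h2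
  have hs0 : ∀ i, (q i).1 ≠ 0 := by
    intro i h
    have := hs1 i
    rw [h, zero_mul] at this
    exact hdnp.ne this
  have hs2 : ∀ i, W (q i).2 ≠ ⊤ ∧ |(q i).1| * (W (q i).2).toReal = 1 := by
    intro i
    obtain ⟨h2, h3⟩ := mem_D h1 (hqD i) (hs0 i)
    refine ⟨h2, le_antisymm h3 ?_⟩
    have h4 := hbd _ h2
    have h5 : |(q i).1| * |f (q i).2 - P.eval (q i).2| = dn := by
      rw [← abs_mul, hs1, abs_of_pos hdnp]
    have h6 : |(q i).1| * |f (q i).2 - P.eval (q i).2| ≤ |(q i).1| * (dn * (W (q i).2).toReal) := by gcongr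
    rw [h5] at h6
    have : dn * 1 ≤ dn * (|(q i).1| * (W (q i).2).toReal) := by linarith
    exact le_of_mul_le_mul_left this hdnp
  refine ⟨P, dn, ι, hι, fun i => (q i).2, t, fun i => (q i).1, ?_, hddn, ?_, hbd, ?_, ?_, ht, htsum,
    fun i => ⟨(hs2 i).1, (hs2 i).2, hs1 i⟩, ?_⟩
  · rw [hP]
    exact (Polynomial.natDegree_C_mul_le _ _).trans hp1
  · have h2 := congrArg Prod.fst hzp
    rw [Prod.fst_sum] at h2
    simp only [Prod.smul_fst, smul_eq_mul] at h2
    rw [← h2, ← htsum]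
    apply Finset.sum_le_sum
    intro i _
    apply mul_le_of_le_one_right (ht i).le
    rw [← hqz i]
    simp only [vcurve, Prod.smul_fst, smul_eq_mul]
    have h3 := (hs2 i).2
    have h4 := toReal_ge_one h1 (hs2 i).1
    have h5 : |(q i).1| ≤ 1 := by nlinarith [abs_nonneg (q i).1]
    refine (le_abs_self _).trans ?_
    rw [abs_mul]
    exact mul_le_one₀ h5 (abs_nonneg _) (hf1 _)
  · refine haffi.card_le_finrank_succ.trans ?_
    have hle : vectorSpan ℝ (range z) ≤ LinearMap.ker l.toLinearMap := by
      rw [vectorSpan_def, Submodule.span_le]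
      rintro _ ⟨_, ⟨i, rfl⟩, _, ⟨j, rfl⟩, rfl⟩
      simp [hlz]
    have hlt : LinearMap.ker l.toLinearMap < ⊤ := by
      rw [lt_top_iff_ne_top]
      intro h
      have h2 : ((1, 0) : E) ∈ LinearMap.ker l.toLinearMap := by rw [h]; trivial
      have : a = 0 := h2
      exact hap.ne' this
    have h3 := Submodule.finrank_lt_finrank_of_lt hlt
    have h4 : Module.finrank ℝ (vectorSpan ℝ (range z)) ≤ Module.finrank ℝ (LinearMap.ker l.toLinearMap) :=
      Submodule.finrank_mono hle
    have h5 : Module.finrank ℝ (⊤ : Submodule ℝ E) = n + 2 := by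
      rw [finrank_top]
      show Module.finrank ℝ (ℝ × (Fin (n + 1) → ℝ)) = n + 2
      rw [Module.finrank_prod, Module.finrank_self, Module.finrank_fin_fun]; omega
    omega
  · intro i j hij
    have hij : (q i).2 = (q j).2 := hij
    apply haffi.injective
    rw [← hqz, ← hqz, ← hij]
    congr 1
    have h2 := hs1 i
    have h3 := hs1 j
    rw [← hij] at h3
    have h4 : f (q i).2 - P.eval (q i).2 ≠ 0 := by
      intro h; rw [h, mul_zero] at h2; exact hdnp.ne h2
    exact mul_right_cancel₀ h4 (h2.trans h3.symm)
  · intro k hk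
    have h2 := congrFun (congrArg Prod.snd hzp) ⟨k, by omega⟩
    rw [Prod.snd_sum, Finset.sum_apply] at h2
    refine Eq.trans ?_ h2
    apply Finset.sum_congr rfl
    intro i _
    rw [← hqz]
    simp [vcurve]
    ring

end PartK

open Complex Filter Set MeasureTheory
open scoped ENNReal

section PartL

lemma moment_poly {ι : Type} [Fintype ι] (x c : ι → ℝ) (n : ℕ)
    (h : ∀ k, k ≤ n → ∑ i, c i * x i ^ k = 0) (g : Polynomial ℝ) (hg : g.natDegree ≤ n) :
    ∑ i, c i * g.eval (x i) = 0 := by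
  simp_rw [Polynomial.eval_eq_sum_range, Finset.mul_sum]
  rw [Finset.sum_comm]
  apply Finset.sum_eq_zero
  intro k hk
  have hk' : k ≤ n := by
    have := Finset.mem_range.1 hk; omega
  calc ∑ i, c i * (g.coeff k * x i ^ k) = g.coeff k * ∑ i, c i * x i ^ k := by
        rw [Finset.mul_sum]; exact Finset.sum_congr rfl fun i _ => by ring
    _ = 0 := by rw [h k hk', mul_zero]

lemma deriv_prod_eval {s : Finset ℝ} {a : ℝ} (ha : a ∈ s) :
    (Polynomial.derivative (∏ b ∈ s, (Polynomial.X - Polynomial.C b))).eval a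
      = ∏ b ∈ s.erase a, (a - b) := by
  classical
  rw [← Finset.mul_prod_erase s _ ha, Polynomial.derivative_mul]
  simp [Polynomial.eval_prod]

lemma lagrange_const (s : Finset ℝ) (c : ℝ → ℝ) (n : ℕ) (hc : ∀ a ∈ s, c a ≠ 0) (hs : s.Nonempty)
    (hcard : s.card ≤ n + 2)
    (h : ∀ g : Polynomial ℝ, g.natDegree ≤ n → ∑ a ∈ s, c a * g.eval a = 0) :
    s.card = n + 2 ∧ ∃ κ : ℝ, κ ≠ 0 ∧ ∀ a ∈ s, c a * ∏ b ∈ s.erase a, (a - b) = κ := by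
  classical
  have hne : ∀ a ∈ s, ∏ b ∈ s.erase a, (a - b) ≠ 0 := by
    intro a ha
    rw [Finset.prod_ne_zero_iff]
    intro b hb
    exact sub_ne_zero.2 (Finset.ne_of_mem_erase hb).symm
  have hdeg : ∀ u : Finset ℝ, (∏ b ∈ u, (Polynomial.X - Polynomial.C b)).natDegree = u.card := by
    intro u
    rw [Polynomial.natDegree_finset_prod_X_sub_C_eq_card]
  obtain ⟨a₀, ha₀⟩ := hs
  refine ⟨?_, c a₀ * ∏ b ∈ s.erase a₀, (a₀ - b), mul_ne_zero (hc _ ha₀) (hne _ ha₀), ?_⟩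
  · by_contra hcn
    have h2 := h (∏ b ∈ s.erase a₀, (Polynomial.X - Polynomial.C b)) (by
      rw [hdeg, Finset.card_erase_of_mem ha₀]; omega)
    rw [Finset.sum_eq_single a₀] at h2
    · rw [Polynomial.eval_prod] at h2
      simp only [Polynomial.eval_sub, Polynomial.eval_X, Polynomial.eval_C] at h2
      exact mul_ne_zero (hc _ ha₀) (hne _ ha₀) h2
    · intro b hb hba
      rw [Polynomial.eval_prod, Finset.prod_eq_zero (Finset.mem_erase.2 ⟨hba, hb⟩), mul_zero]
      simp
    · intro h; exact absurd ha₀ h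
  · intro a ha
    by_cases hab : a = a₀
    · rw [hab]
    have haa : a ∈ s.erase a₀ := Finset.mem_erase.2 ⟨hab, ha⟩
    have haa' : a₀ ∈ s.erase a := Finset.mem_erase.2 ⟨Ne.symm hab, ha₀⟩
    set u := (s.erase a₀).erase a with hu
    have hu2 : (s.erase a).erase a₀ = u := by rw [hu, Finset.erase_right_comm]
    have h2 := h (∏ b ∈ u, (Polynomial.X - Polynomial.C b)) (by
      rw [hdeg, Finset.card_erase_of_mem haa, Finset.card_erase_of_mem ha₀]; omega)
    rw [← Finset.add_sum_erase _ _ ha₀, ← Finset.add_sum_erase _ _ haa, Finset.sum_eq_zero] at h2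
    · rw [← Finset.mul_prod_erase _ _ haa, ← Finset.mul_prod_erase _ _ haa', hu2]
      simp only [Polynomial.eval_prod, Polynomial.eval_sub, Polynomial.eval_X, Polynomial.eval_C] at h2
      linear_combination (a - a₀) * h2
    · intro b hb
      rw [Polynomial.eval_prod, Finset.prod_eq_zero hb, mul_zero]
      simp

lemma extremalQ {W : ℝ → ℝ≥0∞} (hW : IsWeight W) (f : ℝ → ℝ) (hf : Continuous f)
    (hf1 : ∀ x, |f x| ≤ 1) (d : ℝ) (hd : 0 < d)
    (hdist : ∀ P : Polynomial ℝ, ∃ x, W x ≠ ⊤ ∧ d * (W x).toReal < |f x - P.eval x|) (n : ℕ) :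
    ∃ (P : Polynomial ℝ) (dn : ℝ) (s : Finset ℝ) (t : ℝ → ℝ) (κ : ℝ),
      κ ≠ 0 ∧ P.natDegree ≤ n ∧ d ≤ dn ∧ dn ≤ 1 ∧
      (∀ x, W x ≠ ⊤ → |f x - P.eval x| ≤ dn * (W x).toReal) ∧
      s.card = n + 2 ∧ ∑ a ∈ s, t a = 1 ∧
      ∀ a ∈ s, 0 < t a ∧ W a ≠ ⊤ ∧ f a - P.eval a = dn * t a * (κ⁻¹ * ∏ b ∈ s.erase a, (a - b)) ∧
        |κ⁻¹ * ∏ b ∈ s.erase a, (a - b)| * t a = (W a).toReal := by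
  classical
  obtain ⟨P, dn, ι, hι, x, t, σ, hP, h2, h3, h4, h5, hx, ht, htsum, h6, h7⟩ := ext1 hW f hf hf1 d hd hdist n
  set s : Finset ℝ := Finset.univ.map ⟨x, hx⟩ with hs
  set t' : ℝ → ℝ := Function.extend x t 0 with ht'
  set σ' : ℝ → ℝ := Function.extend x σ 0 with hσ'
  have et : ∀ i, t' (x i) = t i := fun i => hx.extend_apply _ _ _
  have eσ : ∀ i, σ' (x i) = σ i := fun i => hx.extend_apply _ _ _
  have hmem : ∀ a ∈ s, ∃ i, x i = a := by
    intro a ha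
    simpa [hs] using ha
  have hσ0 : ∀ i, σ i ≠ 0 := by
    intro i h
    have := (h6 i).2.1
    rw [h] at this; simp at this
  obtain ⟨hcard, κ, hκ, hκ2⟩ := lagrange_const s (fun a => t' a * σ' a) n
    (by
      intro a ha
      obtain ⟨i, rfl⟩ := hmem a ha
      simp only [et, eσ]
      exact mul_ne_zero (ht i).ne' (hσ0 i))
    (by
      by_contra hne
      rw [Finset.not_nonempty_iff_eq_empty] at hne
      have : (Finset.univ : Finset ι) = ∅ := by simpa [hs] using hne
      rw [this] at htsum; simp at htsum)
    (by simpa [hs] using h5)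
    (by
      intro g hg
      rw [hs, Finset.sum_map]
      simp only [Function.Embedding.coeFn_mk, et, eσ]
      exact moment_poly x (fun i => t i * σ i) n h7 g hg)
  refine ⟨P, dn, s, t', κ, hκ, hP, h2, h3, h4, hcard, ?_, ?_⟩
  · rw [hs, Finset.sum_map]
    simpa [et] using htsum
  · intro a ha
    have h8 := hκ2 a ha
    obtain ⟨i, rfl⟩ := hmem a ha
    obtain ⟨h9, h10, h11⟩ := h6 i
    simp only [et, eσ] at h8 ⊢
    have e : t i * (κ⁻¹ * ∏ b ∈ s.erase (x i), (x i - b)) = (σ i)⁻¹ := by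
      apply eq_inv_of_mul_eq_one_left
      field_simp
      linarith
    refine ⟨ht i, h9, ?_, ?_⟩
    · rw [mul_assoc, e, eq_comm, ← div_eq_mul_inv, div_eq_iff (hσ0 i)]
      linarith
    · rw [mul_comm]
      nth_rewrite 1 [← abs_of_pos (ht i)]
      rw [← abs_mul, e, abs_inv]
      exact inv_eq_of_mul_eq_one_right h10

end PartL

open Complex Filter Set MeasureTheory
open scoped ENNReal

section PartM

/-- polynomial with simple real zeros -/
noncomputable def QQ (κ : ℝ) (s : Finset ℝ) (z : ℂ) : ℂ := (κ : ℂ)⁻¹ * ∏ a ∈ s, (z - (a : ℂ))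

/-- derivative at nodes -/
noncomputable def DD (κ : ℝ) (s : Finset ℝ) (a : ℝ) : ℝ := κ⁻¹ * ∏ b ∈ s.erase a, (a - b)

lemma DD_ne {κ : ℝ} (hκ : κ ≠ 0) (s : Finset ℝ) (a : ℝ) : DD κ s a ≠ 0 := by
  refine mul_ne_zero (inv_ne_zero hκ) ?_
  rw [Finset.prod_ne_zero_iff]
  intro b hb
  exact sub_ne_zero.2 (Finset.ne_of_mem_erase hb).symm

lemma part_frac (κ : ℝ) (hκ : κ ≠ 0) (s : Finset ℝ) (g : Polynomial ℂ) (hg : g.natDegree ≤ s.card)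
    (z : ℂ) (hz : ∀ a ∈ s, z ≠ (a : ℂ)) :
    g.eval z = QQ κ s z * (g.coeff s.card * κ + ∑ a ∈ s, g.eval (a : ℂ) / ((DD κ s a : ℝ) * (z - a))) := by
  have hκ' : (κ : ℂ) ≠ 0 := by exact_mod_cast hκ
  set v : ℝ → ℂ := fun a => (a : ℂ) with hv
  have hvi : Set.InjOn v s := fun a _ b _ h => by simpa [hv] using h
  set q := Lagrange.nodal s v with hq
  have hq1 : q.Monic := Lagrange.nodal_monic
  have hq2 : q.natDegree = s.card := Lagrange.natDegree_nodal
  set h := g - Polynomial.C (g.coeff s.card) * q with hh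
  have hdeg : h.degree < (s.card : ℕ) := by
    rw [Polynomial.degree_lt_iff_coeff_zero]
    intro m hm
    rw [hh, Polynomial.coeff_sub, Polynomial.coeff_C_mul]
    rcases eq_or_lt_of_le hm with h1 | h1
    · have : q.coeff m = 1 := by rw [← h1, ← hq2]; exact hq1.coeff_natDegree
      rw [this, ← h1]; simp
    · rw [Polynomial.coeff_eq_zero_of_natDegree_lt (by omega : g.natDegree < m),
        Polynomial.coeff_eq_zero_of_natDegree_lt (by omega : q.natDegree < m)]
      simp
  have h1 := Lagrange.eq_interpolate hvi hdeg
  have h2 : h.eval z = q.eval z * ∑ a ∈ s, Lagrange.nodalWeight s v a * (z - v a)⁻¹ * h.eval (v a) := by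
    conv_lhs => rw [h1]
    rw [Lagrange.eval_interpolate_not_at_node _ hz]
  have h3 : ∀ a ∈ s, h.eval (v a) = g.eval (v a) := by
    intro a ha
    rw [hh, Polynomial.eval_sub, Polynomial.eval_mul, hq, Lagrange.eval_nodal_at_node ha]
    simp
  have h4 : q.eval z = κ * QQ κ s z := by
    rw [hq, Lagrange.eval_nodal, QQ]
    field_simp
    rfl
  have h5 : g.eval z = h.eval z + g.coeff s.card * q.eval z := by
    rw [hh]; simp
  rw [h5, h2, h4]
  have h6 : ∀ a ∈ s, Lagrange.nodalWeight s v a * (z - v a)⁻¹ * h.eval (v a)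
      = (κ : ℂ)⁻¹ * (g.eval (a : ℂ) / ((DD κ s a : ℝ) * (z - a))) := by
    intro a ha
    rw [h3 a ha, Lagrange.nodalWeight, DD, Finset.prod_inv_distrib]
    simp only [hv]
    push_cast
    have hne : ∏ b ∈ s.erase a, ((a : ℂ) - b) ≠ 0 := by
      rw [Finset.prod_ne_zero_iff]
      intro b hb
      exact sub_ne_zero.2 (by exact_mod_cast (Finset.ne_of_mem_erase hb).symm)
    have hza : z - a ≠ 0 := sub_ne_zero.2 (hz a ha)
    field_simp
  rw [Finset.sum_congr rfl h6, ← Finset.mul_sum]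
  generalize ∑ a ∈ s, g.eval (a : ℂ) / ((DD κ s a : ℝ) * (z - a)) = T
  field_simp
  ring

lemma QQ_lower (κ : ℝ) (hκ : κ ≠ 0) (s : Finset ℝ) (w t : ℝ → ℝ) (ht : ∀ a ∈ s, |DD κ s a| * t a = w a)
    (htsum : ∑ a ∈ s, t a = 1) (ht0 : ∀ a ∈ s, 0 < t a)
    (p : Polynomial ℂ) (M : ℝ) (hM : 0 ≤ M) (hp : ∀ a ∈ s, ‖p.eval (a : ℂ)‖ ≤ M * w a)
    (hdeg : p.natDegree < s.card) (z : ℂ) : |z.im| * ‖p.eval z‖ ≤ M * ‖QQ κ s z‖ := by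
  by_cases hz : z.im = 0
  · rw [hz]; simp; positivity
  have hzs : ∀ a ∈ s, z ≠ (a : ℂ) := fun a _ h => hz (by rw [h]; simp)
  rw [part_frac κ hκ s p hdeg.le z hzs, Polynomial.coeff_eq_zero_of_natDegree_lt hdeg, zero_mul, zero_add,
    norm_mul]
  have hzp : 0 < |z.im| := abs_pos.2 hz
  have h1 : ‖∑ a ∈ s, p.eval (a : ℂ) / ((DD κ s a : ℝ) * (z - a))‖ ≤ M / |z.im| := by
    calc _ ≤ ∑ a ∈ s, ‖p.eval (a : ℂ) / ((DD κ s a : ℝ) * (z - a))‖ := norm_sum_le _ _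
      _ ≤ ∑ a ∈ s, M / |z.im| * t a := by
        apply Finset.sum_le_sum
        intro a ha
        have hD : 0 < |DD κ s a| := abs_pos.2 (DD_ne hκ s a)
        have h2 : |z.im| ≤ ‖z - a‖ := by
          have := Complex.abs_im_le_norm (z - a)
          simpa using this
        have h3 : 0 < ‖z - a‖ := hzp.trans_le h2
        rw [norm_div, norm_mul, Complex.norm_real, Real.norm_eq_abs, div_le_iff₀ (by positivity)]
        calc _ ≤ M * w a := hp a ha
          _ = M / |z.im| * t a * (|DD κ s a| * |z.im|) := by
            rw [← ht a ha]; field_simp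
          _ ≤ _ := by
            have := ht0 a ha
            gcongr
      _ = M / |z.im| := by rw [← Finset.mul_sum, htsum, mul_one]
  calc _ ≤ |z.im| * (‖QQ κ s z‖ * (M / |z.im|)) := by gcongr
    _ = _ := by field_simp

lemma QQ_upper (κ : ℝ) (hκ : κ ≠ 0) (s : Finset ℝ) (t : ℝ → ℝ)
    (htsum : ∑ a ∈ s, t a = 1) (ht0 : ∀ a ∈ s, 0 < t a) (dn : ℝ) (hdn : 0 < dn)
    (S : Polynomial ℝ) (hS : S.natDegree ≤ s.card)
    (hSa : ∀ a ∈ s, S.eval a = dn * t a * (1 + a ^ 2) * DD κ s a) (z : ℂ) (hz : 0 < z.im) :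
    ‖QQ κ s z‖ * (dn * z.im) ≤ 2 * (1 + ‖z‖ ^ 2) * ‖(S.map (algebraMap ℝ ℂ)).eval z‖ := by
  have hzs : ∀ a ∈ s, z ≠ (a : ℂ) := fun a _ h => hz.ne' (by rw [h]; simp)
  set g := S.map (algebraMap ℝ ℂ) with hg
  have hge : ∀ a : ℝ, g.eval (a : ℂ) = (S.eval a : ℝ) := by
    intro a
    rw [hg, Polynomial.eval_map_algebraMap]
    exact Polynomial.aeval_algebraMap_apply_eq_algebraMap_eval a S
  rw [part_frac κ hκ s g (Polynomial.natDegree_map_le.trans hS) z hzs]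
  set G := g.coeff s.card * κ + ∑ a ∈ s, g.eval (a : ℂ) / ((DD κ s a : ℝ) * (z - a)) with hG
  have him : dn * z.im / (2 * (1 + ‖z‖ ^ 2)) ≤ -G.im := by
    have e1 : (g.coeff s.card * κ).im = 0 := by
      rw [hg, Polynomial.coeff_map]; simp
    have e2 : ∀ a ∈ s, (g.eval (a : ℂ) / ((DD κ s a : ℝ) * (z - a))).im
        = - (dn * t a * (1 + a ^ 2) * (z.im / Complex.normSq (z - a))) := by
      intro a ha
      have hD := DD_ne hκ s a
      have : g.eval (a : ℂ) / ((DD κ s a : ℝ) * (z - a)) = ((dn * t a * (1 + a ^ 2) : ℝ) : ℂ) * (z - a)⁻¹ := by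
        rw [hge, hSa a ha]
        have h3 : z - a ≠ 0 := sub_ne_zero.2 (hzs a ha)
        have h4 : ((DD κ s a : ℝ) : ℂ) ≠ 0 := by exact_mod_cast hD
        push_cast
        field_simp
      rw [this, Complex.im_ofReal_mul, Complex.inv_im]
      simp
      ring
    rw [hG, Complex.add_im, e1, zero_add, Complex.im_sum, Finset.sum_congr rfl e2, Finset.sum_neg_distrib, neg_neg]
    calc dn * z.im / (2 * (1 + ‖z‖ ^ 2)) = ∑ a ∈ s, dn * z.im / (2 * (1 + ‖z‖ ^ 2)) * t a := by
          rw [← Finset.mul_sum, htsum, mul_one]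
      _ ≤ _ := by
        apply Finset.sum_le_sum
        intro a ha
        have ht := ht0 a ha
        have hne : 0 < Complex.normSq (z - a) := Complex.normSq_pos.2 (sub_ne_zero.2 (hzs a ha))
        have hle : Complex.normSq (z - a) ≤ 2 * (1 + ‖z‖ ^ 2) * (1 + a ^ 2) := by
          rw [Complex.sq_norm, Complex.normSq_apply, Complex.normSq_apply]
          simp
          nlinarith [sq_nonneg (z.re + a), mul_nonneg (add_nonneg (mul_self_nonneg z.re) (mul_self_nonneg z.im)) (sq_nonneg a)]
        have : 1 / (2 * (1 + ‖z‖ ^ 2)) ≤ (1 + a ^ 2) / Complex.normSq (z - a) := by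
          rw [div_le_div_iff₀ (by positivity) hne]; linarith
        calc _ = dn * z.im * t a * (1 / (2 * (1 + ‖z‖ ^ 2))) := by ring
          _ ≤ dn * z.im * t a * ((1 + a ^ 2) / Complex.normSq (z - a)) := by gcongr
          _ = _ := by ring
  have h5 : dn * z.im / (2 * (1 + ‖z‖ ^ 2)) ≤ ‖G‖ :=
    him.trans ((neg_le_abs _).trans (Complex.abs_im_le_norm G))
  rw [div_le_iff₀ (by positivity)] at h5
  rw [norm_mul]
  calc _ ≤ ‖QQ κ s z‖ * (‖G‖ * (2 * (1 + ‖z‖ ^ 2))) := by gcongr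
    _ = _ := by ring

lemma QQ_mono (κ : ℝ) (s : Finset ℝ) (x y y' : ℝ) (h : |y| ≤ |y'|) :
    ‖QQ κ s (x + y * I)‖ ≤ ‖QQ κ s (x + y' * I)‖ := by
  simp only [QQ, norm_mul, norm_prod]
  gcongr with a ha
  rw [← sq_le_sq₀ (norm_nonneg _) (norm_nonneg _), Complex.sq_norm, Complex.sq_norm,
    Complex.normSq_apply, Complex.normSq_apply]
  simp
  nlinarith [sq_le_sq' (by linarith [abs_nonneg y, abs_nonneg y'] : -|y'| ≤ |y|) h, sq_abs y, sq_abs y']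

lemma Q_family {W : ℝ → ℝ≥0∞} (hW : IsWeight W) (h : ¬ Appr W fun x => 1/((x:ℂ)-I)) :
    ∃ (κ : ℕ → ℝ) (s : ℕ → Finset ℝ) (t : ℕ → ℝ → ℝ), (∀ n, κ n ≠ 0) ∧
      (∀ ε : ℝ, 0 < ε → ∃ C : ℝ, 0 ≤ C ∧ ∀ n z, ‖QQ (κ n) (s n) z‖ ≤ C * Real.exp (ε * ‖z‖)) ∧
      (∀ (p : Polynomial ℂ) (M : ℝ), 0 ≤ M → Bd W (fun x => p.eval (x:ℂ)) M → ∀ n, p.natDegree ≤ n →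
        ∀ z : ℂ, |z.im| * ‖p.eval z‖ ≤ M * ‖QQ (κ n) (s n) z‖) ∧
      ∀ n, ∑ a ∈ s n, t n a = 1 ∧ ∀ a ∈ s n, 0 < t n a ∧ W a ≠ ⊤ ∧
        |DD (κ n) (s n) a| * t n a = (W a).toReal := by
  have h1 := hW.2.1
  obtain ⟨C0, hC0, hC⟩ := bound_at_I h
  obtain ⟨α, β, d, hd, hf1, hdist⟩ := real_dist h
  set f : ℝ → ℝ := fun x => (α * x + β) / (x ^ 2 + 1) with hf
  have hfc : Continuous f := by
    simp only [hf]
    refine Continuous.div (by fun_prop) (by fun_prop) (fun x => by positivity)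
  choose P dn s t κ hκ hP hddn hdn1 hbd hcard htsum hmain using extremalQ hW f hfc hf1 d hd hdist
  refine ⟨κ, s, t, hκ, ?_, ?_, fun n => ⟨htsum n, fun a ha => ?_⟩⟩
  · intro ε hε
    obtain ⟨B, hB⟩ := cone_bound h1 hC0 hC (ε / 4) (by positivity)
    obtain ⟨A, hA0, hA⟩ := poly_growth ((1 + Polynomial.X ^ 2) ^ 2) (ε / 4) (by positivity)
    have hA : ∀ r : ℝ, 0 ≤ r → (1 + r ^ 2) ^ 2 ≤ A * Real.exp (ε / 4 * r) := by
      intro r hr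
      have := hA (r : ℂ)
      simp only [Polynomial.eval_pow, Polynomial.eval_add, Polynomial.eval_one, Polynomial.eval_X] at this
      rw [Complex.norm_real, Real.norm_eq_abs, abs_of_nonneg hr] at this
      have e : ((1 : ℂ) + (r : ℂ) ^ 2) ^ 2 = (((1 + r ^ 2) ^ 2 : ℝ) : ℂ) := by push_cast; ring
      rw [e, Complex.norm_real, Real.norm_eq_abs, abs_of_nonneg (by positivity)] at this
      exact this
    set L := (2 / d) * (|α| + |β| + 2 * |B|) * A with hL
    have hL0 : 0 ≤ L := by positivity
    have hcone : ∀ n, ∀ z : ℂ, 1 ≤ z.im → |z.re| ≤ z.im →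
        ‖QQ (κ n) (s n) z‖ ≤ L * Real.exp (ε / 2 * ‖z‖) := by
      intro n z hz1 hz2
      set S : Polynomial ℝ := Polynomial.C α * Polynomial.X + Polynomial.C β
        - (Polynomial.X ^ 2 + 1) * P n with hS
      have hSdeg : S.natDegree ≤ (s n).card := by
        rw [hcard, hS]
        have := hP n
        have e1 : (Polynomial.C α * Polynomial.X + Polynomial.C β).natDegree ≤ 1 := Polynomial.natDegree_linear_le
        have e2 : ((Polynomial.X ^ 2 + 1) * P n).natDegree ≤ 2 + n := by
          refine Polynomial.natDegree_mul_le_of_le ?_ this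
          compute_degree
        refine (Polynomial.natDegree_sub_le _ _).trans (max_le ?_ ?_) <;> omega
      have hSa : ∀ a ∈ s n, S.eval a = dn n * t n a * (1 + a ^ 2) * DD (κ n) (s n) a := by
        intro a ha
        have h2 := (hmain n a ha).2.2.1
        have h3 : S.eval a = (1 + a ^ 2) * (f a - (P n).eval a) := by
          simp only [hS, hf, Polynomial.eval_sub, Polynomial.eval_add, Polynomial.eval_mul, Polynomial.eval_C,
            Polynomial.eval_X, Polynomial.eval_pow, Polynomial.eval_one]
          have : a ^ 2 + 1 ≠ 0 := by positivity
          field_simp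
          ring
        rw [h3, h2, DD]; ring
      have hdnp : 0 < dn n := hd.trans_le (hddn n)
      have h2 := QQ_upper (κ n) (hκ n) (s n) (t n) (htsum n) (fun a ha => (hmain n a ha).1) (dn n) hdnp
        S hSdeg hSa z (by linarith)
      set r := ‖z‖ with hr
      have hr0 : 0 ≤ r := norm_nonneg z
      have hPz : ‖((P n).map (algebraMap ℝ ℂ)).eval z‖ ≤ 2 * |B| * Real.exp (ε / 4 * r) := by
        have h3 := hB (Polynomial.C (1 / 2) * (P n).map (algebraMap ℝ ℂ)) (by
          intro x hx
          have h4 := hbd n x hx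
          have h5 := toReal_ge_one h1 hx
          have e : ((P n).map (algebraMap ℝ ℂ)).eval (x : ℂ) = ((P n).eval x : ℝ) := by
            rw [Polynomial.eval_map_algebraMap]
            exact Polynomial.aeval_algebraMap_apply_eq_algebraMap_eval x (P n)
          simp only [Polynomial.eval_mul, Polynomial.eval_C, e, norm_mul, Complex.norm_real]
          have h6 : |(P n).eval x| ≤ 2 * (W x).toReal := by
            have e1 : (P n).eval x = f x - (f x - (P n).eval x) := by ring
            have e2 := abs_sub (f x) (f x - (P n).eval x)
            rw [← e1] at e2
            have e3 := hf1 x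
            have e4 := hdn1 n
            have e5 : |f x| ≤ 1 := hf1 x
            nlinarith
          rw [Real.norm_eq_abs]
          norm_num
          linarith) z hz1 hz2
        simp only [Polynomial.eval_mul, Polynomial.eval_C, norm_mul] at h3
        rw [show ‖(1 / 2 : ℂ)‖ = 1 / 2 by norm_num, ← hr] at h3
        have h4 : B * Real.exp (ε / 4 * r) ≤ |B| * Real.exp (ε / 4 * r) := by
          gcongr; exact le_abs_self B
        linarith
      have hexp : 1 ≤ Real.exp (ε / 4 * r) := Real.one_le_exp (by positivity)
      have hSz : ‖(S.map (algebraMap ℝ ℂ)).eval z‖ ≤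
          (1 + r ^ 2) * (|α| + |β| + 2 * |B|) * Real.exp (ε / 4 * r) := by
        have e : (S.map (algebraMap ℝ ℂ)).eval z = α * z + β - (z ^ 2 + 1) * ((P n).map (algebraMap ℝ ℂ)).eval z := by
          simp [hS]
        rw [e]
        have n1 : ‖(α : ℂ) * z + β‖ ≤ |α| * r + |β| := by
          refine (norm_add_le _ _).trans ?_
          simp [hr]
        have n2 : ‖z ^ 2 + 1‖ ≤ 1 + r ^ 2 := by
          refine (norm_add_le _ _).trans ?_
          simp [hr]; linarith
        calc _ ≤ ‖(α : ℂ) * z + β‖ + ‖(z ^ 2 + 1) * ((P n).map (algebraMap ℝ ℂ)).eval z‖ := norm_sub_le _ _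
          _ ≤ (|α| * r + |β|) + (1 + r ^ 2) * (2 * |B| * Real.exp (ε / 4 * r)) := by
            rw [norm_mul]; gcongr
          _ ≤ (1 + r ^ 2) * (|α| + |β|) * Real.exp (ε / 4 * r) + (1 + r ^ 2) * (2 * |B| * Real.exp (ε / 4 * r)) := by
            gcongr
            have e1 : |α| * r + |β| ≤ (1 + r ^ 2) * (|α| + |β|) := by
              nlinarith [abs_nonneg α, abs_nonneg β, mul_nonneg (abs_nonneg α) (sq_nonneg (r - 1)),
                mul_nonneg (abs_nonneg β) (sq_nonneg r), mul_nonneg (abs_nonneg α) (sq_nonneg r)]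
            refine e1.trans (le_mul_of_one_le_right (by positivity) hexp)
          _ = _ := by ring
      have h3 : ‖QQ (κ n) (s n) z‖ * d ≤ ‖QQ (κ n) (s n) z‖ * (dn n * z.im) := by
        gcongr
        nlinarith [hddn n]
      have h4 : ‖QQ (κ n) (s n) z‖ * d ≤
          2 * (|α| + |β| + 2 * |B|) * (1 + r ^ 2) ^ 2 * Real.exp (ε / 4 * r) := by
        calc _ ≤ _ := h3
          _ ≤ _ := h2
          _ ≤ 2 * (1 + r ^ 2) * ((1 + r ^ 2) * (|α| + |β| + 2 * |B|) * Real.exp (ε / 4 * r)) := by gcongr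
          _ = _ := by ring
      rw [← le_div_iff₀ hd] at h4
      refine h4.trans ?_
      calc _ ≤ 2 * (|α| + |β| + 2 * |B|) * (A * Real.exp (ε / 4 * r)) * Real.exp (ε / 4 * r) / d := by
            gcongr; exact hA r hr0
        _ = L * (Real.exp (ε / 4 * r) * Real.exp (ε / 4 * r)) := by rw [hL]; field_simp
        _ = _ := by rw [← Real.exp_add]; congr 2; ring
    refine ⟨L * Real.exp (ε / 2), by positivity, fun n z => ?_⟩
    set Y := max (max |z.re| |z.im|) 1 with hY
    have hYre : |z.re| ≤ Y := (le_max_left _ _).trans (le_max_left _ _)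
    have hYim : |z.im| ≤ Y := (le_max_right _ _).trans (le_max_left _ _)
    have hY1 : 1 ≤ Y := le_max_right _ _
    have hYz : Y ≤ ‖z‖ + 1 := by
      refine max_le (max_le ?_ ?_) ?_
      · linarith [Complex.abs_re_le_norm z]
      · linarith [Complex.abs_im_le_norm z]
      · linarith [norm_nonneg z]
    have h2 := hcone n (z.re + Y * I) (by simpa using hY1) (by simpa using hYre)
    have h3 : ‖(z.re : ℂ) + Y * I‖ ≤ 2 * ‖z‖ + 1 := by
      refine (norm_add_le _ _).trans ?_
      simp only [Complex.norm_real, norm_mul, Complex.norm_I, mul_one, Real.norm_eq_abs]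
      rw [abs_of_pos (by linarith : 0 < Y)]
      linarith [Complex.abs_re_le_norm z]
    have h4 := QQ_mono (κ n) (s n) z.re z.im Y (by rwa [abs_of_pos (by linarith : 0 < Y)])
    rw [Complex.re_add_im] at h4
    calc _ ≤ _ := h4
      _ ≤ _ := h2
      _ ≤ L * Real.exp (ε / 2 * (2 * ‖z‖ + 1)) := by gcongr
      _ = L * Real.exp (ε / 2 + ε * ‖z‖) := by congr 2; ring
      _ = _ := by rw [Real.exp_add]; ring
  · intro p M hM hp n hn z
    exact QQ_lower (κ n) (hκ n) (s n) (fun a => (W a).toReal) (t n) (fun a ha => (hmain n a ha).2.2.2) (htsum n)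
      (fun a ha => (hmain n a ha).1) p M hM (fun a ha => hp a (hmain n a ha).2.1) (by rw [hcard]; omega) z
  · obtain ⟨h2, h3, -, h4⟩ := hmain n a ha
    exact ⟨h2, h3, h4⟩

end PartM

open Complex Filter Set MeasureTheory
open scoped ENNReal

section PartN

lemma montel_ultra (Q : ℕ → ℂ → ℂ) (hQ : ∀ n, Differentiable ℂ (Q n))
    (hb : ∀ R : ℝ, ∃ C, ∀ n z, ‖z‖ ≤ R → ‖Q n z‖ ≤ C) (U : Ultrafilter ℕ) :
    ∃ F : ℂ → ℂ, TendstoLocallyUniformly Q F (U : Filter ℕ) := by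
  have hpt : ∀ z, ∃ y, Tendsto (fun n => Q n z) (U : Filter ℕ) (nhds y) := by
    intro z
    obtain ⟨C, hC⟩ := hb ‖z‖
    have hc : IsCompact (Metric.closedBall (0:ℂ) C) := isCompact_closedBall 0 C
    obtain ⟨y, -, hy⟩ := hc.ultrafilter_le_nhds (U.map fun n => Q n z) (by
      rw [Ultrafilter.coe_map, le_principal_iff, mem_map]
      exact Filter.univ_mem' fun n => by simpa using hC n z le_rfl)
    exact ⟨y, hy⟩
  choose F hF using hpt
  refine ⟨F, ?_⟩
  have heq : Equicontinuous Q := by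
    intro z₀
    obtain ⟨C, hC⟩ := hb (‖z₀‖ + 2)
    refine Metric.equicontinuousAt_of_continuity_modulus (fun z => C * dist z₀ z) ?_ Q ?_
    · have : Continuous fun z => C * dist z₀ z := by fun_prop
      have h := this.tendsto z₀
      simpa using h
    · filter_upwards [Metric.ball_mem_nhds z₀ one_pos] with z hz n
      rw [dist_eq_norm, dist_eq_norm]
      refine Convex.norm_image_sub_le_of_norm_deriv_le (𝕜 := ℂ) (s := Metric.ball z₀ 1)
        (fun x _ => (hQ n) x) (fun x hx => ?_) (convex_ball z₀ 1) hz (Metric.mem_ball_self one_pos)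
      have := Complex.norm_deriv_le_of_forall_mem_sphere_norm_le (c := x) (R := 1) (C := C) one_pos
        (hQ n).diffContOnCl (fun w hw => hC n w (by
          rw [Metric.mem_ball, dist_eq_norm] at hx
          rw [mem_sphere_iff_norm] at hw
          have e : w = z₀ + (x - z₀) + (w - x) := by ring
          rw [e]
          refine (norm_add_le _ _).trans ?_
          have := norm_add_le z₀ (x - z₀)
          linarith))
      simpa using this
  rw [← tendstoLocallyUniformlyOn_univ, tendstoLocallyUniformlyOn_iff_forall_isCompact isOpen_univ]
  have h := (EquicontinuousOn.tendsto_uniformOnFun_iff_pi (𝔖 := {K : Set ℂ | IsCompact K}) (F := Q)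
    (fun K hK => hK) (by
      rw [eq_univ_iff_forall]
      exact fun z => ⟨{z}, isCompact_singleton, rfl⟩)
    (fun K _ => heq.equicontinuousOn K) (U : Filter ℕ) F).2 (tendsto_pi_nhds.2 hF)
  rw [UniformOnFun.tendsto_iff_tendstoUniformlyOn] at h
  intro K _ hK
  exact h K hK

lemma hurwitz_ultra (Q : ℕ → ℂ → ℂ) (hQ : ∀ n, Differentiable ℂ (Q n)) (U : Ultrafilter ℕ)
    (F : ℂ → ℂ) (hF : Differentiable ℂ F) (hQF : TendstoLocallyUniformly Q F (U : Filter ℕ))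
    (hF0 : ∃ z, F z ≠ 0) (c : ℂ) (hc : F c = 0) (δ : ℝ) (hδ : 0 < δ) :
    ∀ᶠ n in (U : Filter ℕ), ∃ z, Q n z = 0 ∧ dist z c < δ := by
  have hiso : ∀ᶠ z in nhdsWithin c {c}ᶜ, F z ≠ 0 := by
    rcases (hF.analyticAt c).eventually_eq_zero_or_eventually_ne_zero with h | h
    · exfalso
      obtain ⟨z, hz⟩ := hF0
      have hA : AnalyticOnNhd ℂ F univ := fun x _ => hF.analyticAt x
      have := hA.eqOn_zero_of_preconnected_of_eventuallyEq_zero isPreconnected_univ (mem_univ c) h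
      exact hz (this (mem_univ z))
    · exact h
  rw [eventually_nhdsWithin_iff, Metric.eventually_nhds_iff] at hiso
  obtain ⟨η, hη, hiso⟩ := hiso
  set r := min (η / 2) (δ / 2) with hr
  have hr0 : 0 < r := by positivity
  have hr1 : r < η := (min_le_left _ _).trans_lt (by linarith)
  have hr2 : r < δ := (min_le_right _ _).trans_lt (by linarith)
  have hsne : ∀ z ∈ Metric.sphere c r, F z ≠ 0 := by
    intro z hz
    rw [Metric.mem_sphere] at hz
    apply hiso (by rw [hz]; exact hr1)
    intro h
    rw [mem_singleton_iff.1 h, dist_self] at hz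
    exact hr0.ne hz
  obtain ⟨m, hm0, hm⟩ : ∃ m, 0 < m ∧ ∀ z ∈ Metric.sphere c r, m ≤ ‖F z‖ := by
    obtain ⟨z, hz, hmin⟩ := (isCompact_sphere c r).exists_isMinOn (NormedSpace.sphere_nonempty.2 hr0.le)
      (hF.continuous.norm.continuousOn)
    exact ⟨‖F z‖, norm_pos_iff.2 (hsne z hz), fun w hw => hmin hw⟩
  have hunif : TendstoUniformlyOn Q F (U : Filter ℕ) (Metric.closedBall c r) :=
    (tendstoLocallyUniformlyOn_iff_tendstoUniformlyOn_of_compact (isCompact_closedBall c r)).1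
      hQF.tendstoLocallyUniformlyOn
  rw [Metric.tendstoUniformlyOn_iff] at hunif
  filter_upwards [hunif (m / 2) (by positivity)] with n hn
  by_contra hcon
  push Not at hcon
  have hne : ∀ z ∈ Metric.closedBall c r, Q n z ≠ 0 := fun z hz h => by
    have := hcon z h
    rw [Metric.mem_closedBall] at hz
    linarith
  have hd : DiffContOnCl ℂ (fun z => (Q n z)⁻¹) (Metric.ball c r) := by
    apply DifferentiableOn.diffContOnCl
    rw [closure_ball c hr0.ne']
    exact (hQ n).differentiableOn.inv hne
  have h1 := Complex.norm_le_of_forall_mem_frontier_norm_le Metric.isBounded_ball hd (C := 2 / m) (by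
    intro z hz
    rw [frontier_ball c hr0.ne'] at hz
    have h2 := hn z (Metric.sphere_subset_closedBall hz)
    rw [dist_eq_norm] at h2
    have h3 := hm z hz
    have h4 : m / 2 ≤ ‖Q n z‖ := by
      have := norm_sub_norm_le (F z) (Q n z)
      linarith
    rw [norm_inv, inv_le_comm₀ (by linarith) (by positivity), inv_div]
    exact h4) (subset_closure (Metric.mem_ball_self hr0))
  have h2 := hn c (Metric.mem_closedBall_self hr0.le)
  rw [hc, dist_eq_norm, zero_sub, norm_neg] at h2
  rw [norm_inv, inv_le_comm₀ (norm_pos_iff.2 (hne c (Metric.mem_closedBall_self hr0.le))) (by positivity), inv_div] at h1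
  linarith

lemma QQ_diff (κ : ℝ) (s : Finset ℝ) : Differentiable ℂ (QQ κ s) := by
  have : QQ κ s = fun z => (κ : ℂ)⁻¹ * ∏ a ∈ s, (z - (a : ℂ)) := rfl
  rw [this]
  fun_prop

lemma QQ_deriv (κ : ℝ) (s : Finset ℝ) (a : ℝ) (ha : a ∈ s) : deriv (QQ κ s) (a : ℂ) = (DD κ s a : ℝ) := by
  classical
  have e : QQ κ s = fun z => (z - (a : ℂ)) * ((κ : ℂ)⁻¹ * ∏ b ∈ s.erase a, (z - (b : ℂ))) := by
    ext z
    rw [QQ, ← Finset.mul_prod_erase s _ ha]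
    ring
  have hd : Differentiable ℂ fun z : ℂ => ((κ : ℂ)⁻¹ * ∏ b ∈ s.erase a, (z - (b : ℂ))) := by fun_prop
  have h := ((hasDerivAt_id (a : ℂ)).sub_const (a : ℂ)).mul (hd (a : ℂ)).hasDerivAt
  rw [e]
  refine (HasDerivAt.deriv h).trans ?_
  simp [DD]

lemma QQ_zero {κ : ℝ} (hκ : κ ≠ 0) (s : Finset ℝ) (z : ℂ) (h : QQ κ s z = 0) : ∃ a ∈ s, z = (a : ℂ) := by
  rw [QQ, mul_eq_zero, Finset.prod_eq_zero_iff] at h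
  rcases h with h | ⟨a, ha, h⟩
  · simp [hκ] at h
  · exact ⟨a, ha, sub_eq_zero.1 h⟩

lemma poly_pow_bound (P : Polynomial ℂ) : ∃ A : ℝ, ∀ z : ℂ, 1 ≤ ‖z‖ → ‖P.eval z‖ ≤ A * ‖z‖ ^ P.natDegree := by
  refine ⟨∑ k ∈ Finset.range (P.natDegree + 1), ‖P.coeff k‖, fun z hz => ?_⟩
  rw [Polynomial.eval_eq_sum_range, Finset.sum_mul]
  refine (norm_sum_le _ _).trans (Finset.sum_le_sum fun k hk => ?_)
  rw [norm_mul, norm_pow]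
  have := Finset.mem_range.1 hk
  gcongr
  omega


lemma forward_F {W : ℝ → ℝ≥0∞} (hW : IsWeight W) (h : ¬ Appr W fun x => 1/((x:ℂ)-I)) :
    ∃ F : ℂ → ℂ, Differentiable ℂ F ∧
      (∀ ε : ℝ, 0 < ε → ∃ C : ℝ, ∀ z : ℂ, ‖F z‖ ≤ C * Real.exp (ε * ‖z‖)) ∧
      (¬ ∃ P : Polynomial ℂ, ∀ z : ℂ, F z = P.eval z) ∧
      (∀ z, F z = 0 → z.im = 0) ∧ (∀ z, F z = 0 → deriv F z ≠ 0) ∧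
      ∀ T : Finset ℝ, (∀ x ∈ T, F (x : ℂ) = 0) →
        ∑ x ∈ T, W x / ENNReal.ofReal ‖deriv F (x : ℂ)‖ ≤ 1 := by
  classical
  have h1 := hW.2.1
  obtain ⟨κ, s, t, hκ, hgrow, hlow, hts⟩ := Q_family hW h
  set Q : ℕ → ℂ → ℂ := fun n => QQ (κ n) (s n) with hQ
  have hQd : ∀ n, Differentiable ℂ (Q n) := fun n => QQ_diff _ _
  set U : Ultrafilter ℕ := hyperfilter ℕ with hU
  have hUat : (U : Filter ℕ) ≤ atTop := by
    rw [← Nat.cofinite_eq_atTop]; exact hyperfilter_le_cofinite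
  obtain ⟨F, hQF⟩ := montel_ultra Q hQd (by
    intro R
    obtain ⟨C, hC0, hC⟩ := hgrow 1 one_pos
    refine ⟨C * Real.exp (1 * R), fun n z hz => (hC n z).trans (by gcongr)⟩) U
  have hQFu : TendstoLocallyUniformlyOn Q F (U : Filter ℕ) univ := tendstoLocallyUniformlyOn_univ.2 hQF
  have hFd : Differentiable ℂ F := by
    rw [← differentiableOn_univ]
    exact hQFu.differentiableOn (Eventually.of_forall fun n => (hQd n).differentiableOn) isOpen_univ
  have hpt : ∀ z, Tendsto (fun n => Q n z) (U : Filter ℕ) (nhds (F z)) := fun z => hQFu.tendsto_at (mem_univ z)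
  have hderiv : TendstoLocallyUniformlyOn (deriv ∘ Q) (deriv F) (U : Filter ℕ) univ :=
    hQFu.deriv (Eventually.of_forall fun n => (hQd n).differentiableOn) isOpen_univ
  have hFlow : ∀ (p : Polynomial ℂ) (M : ℝ), 0 ≤ M → Bd W (fun x => p.eval (x:ℂ)) M →
      ∀ z : ℂ, |z.im| * ‖p.eval z‖ ≤ M * ‖F z‖ := by
    intro p M hM hp z
    refine ge_of_tendsto ((hpt z).norm.const_mul M) ?_
    have : ∀ᶠ n in (U : Filter ℕ), p.natDegree ≤ n := hUat (eventually_ge_atTop _)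
    filter_upwards [this] with n hn
    exact hlow p M hM hp n hn z
  have hFim : ∀ z : ℂ, |z.im| ≤ ‖F z‖ := by
    intro z
    have := hFlow 1 1 zero_le_one (by
      intro x hx
      simpa using toReal_ge_one h1 hx) z
    simpa using this
  have hFne : ∃ z, F z ≠ 0 := ⟨I, fun h => by have := hFim I; rw [h] at this; norm_num at this⟩
  have hreal : ∀ z, F z = 0 → z.im = 0 := by
    intro z hz
    have := hFim z
    rw [hz, norm_zero] at this
    exact abs_nonpos_iff.1 this
  -- nearest nodes
  have hnear : ∀ (c : ℝ), ∃ a : ℕ → ℝ, ∀ n, a n ∈ s n ∧ ∀ b ∈ s n, |a n - c| ≤ |b - c| := by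
    intro c
    have : ∀ n, ∃ a ∈ s n, ∀ b ∈ s n, |a - c| ≤ |b - c| := by
      intro n
      apply Finset.exists_min_image
      by_contra hne
      rw [Finset.not_nonempty_iff_eq_empty] at hne
      have := (hts n).1
      rw [hne] at this; simp at this
    choose a ha using this
    exact ⟨a, fun n => ⟨(ha n).1, (ha n).2⟩⟩
  choose a ha using hnear
  have ha1 : ∀ c n, a c n ∈ s n := fun c n => (ha c n).1
  have ha2 : ∀ c n, ∀ b ∈ s n, |a c n - c| ≤ |b - c| := fun c n => (ha c n).2
  have hatend : ∀ c : ℝ, F (c : ℂ) = 0 → Tendsto (a c) (U : Filter ℕ) (nhds c) := by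
    intro c hc
    rw [Metric.tendsto_nhds]
    intro δ hδ
    filter_upwards [hurwitz_ultra Q hQd U F hFd hQF hFne c hc δ hδ] with n hn
    obtain ⟨z, hz, hzc⟩ := hn
    obtain ⟨b, hb, rfl⟩ := QQ_zero (hκ n) (s n) z hz
    rw [Real.dist_eq]
    refine (ha2 c n b hb).trans_lt ?_
    rw [dist_eq_norm, ← Complex.ofReal_sub, Complex.norm_real, Real.norm_eq_abs] at hzc
    exact hzc
  have hDtend : ∀ c : ℝ, F (c : ℂ) = 0 →
      Tendsto (fun n => |DD (κ n) (s n) (a c n)|) (U : Filter ℕ) (nhds ‖deriv F (c : ℂ)‖) := by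
    intro c hc
    have hcd : Continuous (deriv F) := (hFd.contDiff (n := 1)).continuous_deriv le_rfl
    have h2 : Tendsto (fun n => (deriv ∘ Q) n ((a c n : ℝ) : ℂ)) (U : Filter ℕ) (nhds (deriv F (c : ℂ))) :=
      (tendstoLocallyUniformlyOn_univ.1 hderiv).tendsto_comp hcd.continuousAt
        ((Complex.continuous_ofReal.tendsto c).comp (hatend c hc))
    refine h2.norm.congr fun n => ?_
    have := QQ_deriv (κ n) (s n) (a c n) (ha1 c n)
    simp only [Function.comp_apply, hQ]
    rw [this, Complex.norm_real, Real.norm_eq_abs]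
  have ht1 : ∀ n, ∀ b ∈ s n, t n b ≤ 1 := by
    intro n b hb
    rw [← (hts n).1]
    exact Finset.single_le_sum (f := t n) (fun x hx => ((hts n).2 x hx).1.le) hb
  have hD1 : ∀ n, ∀ b ∈ s n, 1 ≤ |DD (κ n) (s n) b| := by
    intro n b hb
    obtain ⟨h2, h3, h4⟩ := (hts n).2 b hb
    have h5 := toReal_ge_one h1 h3
    have h6 := ht1 n b hb
    nlinarith [abs_nonneg (DD (κ n) (s n) b)]
  have hF1 : ∀ c : ℝ, F (c : ℂ) = 0 → 1 ≤ ‖deriv F (c : ℂ)‖ := by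
    intro c hc
    exact ge_of_tendsto (hDtend c hc) (Eventually.of_forall fun n => hD1 n _ (ha1 c n))
  refine ⟨F, hFd, ?_, ?_, hreal, ?_, ?_⟩
  · intro ε hε
    obtain ⟨C, hC0, hC⟩ := hgrow ε hε
    exact ⟨C, fun z => le_of_tendsto (hpt z).norm (Eventually.of_forall fun n => hC n z)⟩
  · rintro ⟨P, hP⟩
    obtain ⟨A, hA⟩ := poly_pow_bound P
    set k := P.natDegree with hk
    obtain ⟨M, hM1, hM⟩ := weight_pow hW k
    have hBd : Bd W (fun x => (Polynomial.X ^ k : Polynomial ℂ).eval (x:ℂ)) M := by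
      intro x hx
      have h2 := ENNReal.toReal_mono (by finiteness) (hM x)
      rw [ENNReal.toReal_mul, ENNReal.toReal_ofReal (by positivity), ENNReal.toReal_ofReal (by positivity)] at h2
      simpa using h2
    have h3 : ∀ y : ℝ, 1 ≤ y → y ≤ M * A := by
      intro y hy
      have h4 := hFlow _ M (by linarith) hBd (y * I)
      have hyn : ‖(y : ℂ) * I‖ = y := by
        simp; linarith
      have h5 := hA (y * I) (by rw [hyn]; exact hy)
      rw [← hP, hyn] at h5
      have e : ((y : ℂ) * I).im = y := by simp
      rw [e, Polynomial.eval_pow, Polynomial.eval_X, norm_pow, hyn, abs_of_pos (by linarith)] at h4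
      have hyk : 0 < y ^ k := by positivity
      have h6 : y * y ^ k ≤ (M * A) * y ^ k := by
        calc _ ≤ _ := h4
          _ ≤ M * (A * y ^ k) := by gcongr
          _ = _ := by ring
      exact le_of_mul_le_mul_right h6 hyk
    have h4 := h3 (max 1 (M * A + 1)) (le_max_left _ _)
    have h5 := le_max_right 1 (M * A + 1)
    linarith
  · intro z hz h0
    have e : z = (z.re : ℂ) := by
      apply Complex.ext <;> simp [hreal z hz]
    rw [e] at hz h0
    have := hF1 z.re hz
    rw [h0, norm_zero] at this
    linarith
  · intro T hT
    have hτ : ∀ c ∈ T, ∃ τ : ℝ, 0 ≤ τ ∧ Tendsto (fun n => t n (a c n)) (U : Filter ℕ) (nhds τ) := by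
      intro c hc
      obtain ⟨y, hy1, hy⟩ := (isCompact_Icc (a := (0:ℝ)) (b := 1)).ultrafilter_le_nhds (U.map fun n => t n (a c n)) (by
        rw [Ultrafilter.coe_map, le_principal_iff, mem_map]
        exact Filter.univ_mem' fun n => ⟨((hts n).2 _ (ha1 c n)).1.le, ht1 n _ (ha1 c n)⟩)
      exact ⟨y, hy1.1, hy⟩
    choose! τ hτ0 hτ using hτ
    have hsum : ∑ c ∈ T, τ c ≤ 1 := by
      have h2 : Tendsto (fun n => ∑ c ∈ T, t n (a c n)) (U : Filter ℕ) (nhds (∑ c ∈ T, τ c)) :=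
        tendsto_finset_sum _ fun c hc => hτ c hc
      refine le_of_tendsto h2 ?_
      have hinj : ∀ᶠ n in (U : Filter ℕ), ∀ c ∈ T, ∀ c' ∈ T, c ≠ c' → a c n ≠ a c' n := by
        rw [Filter.eventually_all_finset]
        intro c hc
        rw [Filter.eventually_all_finset]
        intro c' hc'
        by_cases hcc : c = c'
        · simp [hcc]
        · filter_upwards [((hatend c (hT c hc)).sub (hatend c' (hT c' hc'))).eventually_ne (sub_ne_zero.2 hcc)] with n hn _
          exact sub_ne_zero.1 hn
      filter_upwards [hinj] with n hn
      rw [← (hts n).1, ← Finset.sum_image (f := t n) (g := fun c => a c n)]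
      · apply Finset.sum_le_sum_of_subset_of_nonneg
        · intro b hb
          obtain ⟨c, -, rfl⟩ := Finset.mem_image.1 hb
          exact ha1 c n
        · intro b hb _
          exact ((hts n).2 b hb).1.le
      · intro c hc c' hc' hcc
        by_contra hne
        exact hn c hc c' hc' hne hcc
    have hWle : ∀ c ∈ T, W c / ENNReal.ofReal ‖deriv F (c : ℂ)‖ ≤ ENNReal.ofReal (τ c) := by
      intro c hc
      have hFc := hF1 c (hT c hc)
      have h2 : Tendsto (fun n => ENNReal.ofReal (|DD (κ n) (s n) (a c n)| * t n (a c n))) (U : Filter ℕ)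
          (nhds (ENNReal.ofReal (‖deriv F (c : ℂ)‖ * τ c))) :=
        (ENNReal.continuous_ofReal.tendsto _).comp ((hDtend c (hT c hc)).mul (hτ c hc))
      have h3 : W c ≤ ENNReal.ofReal (‖deriv F (c : ℂ)‖ * τ c) := by
        apply le_of_forall_lt
        intro y hy
        obtain ⟨y', hy1, hy2⟩ := exists_between hy
        refine hy1.trans_le ?_
        refine ge_of_tendsto h2 ?_
        have h4 := (hatend c (hT c hc)).eventually (hW.1 c y' hy2)
        filter_upwards [h4] with n hn
        obtain ⟨-, h5, h6⟩ := (hts n).2 _ (ha1 c n)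
        rw [h6, ENNReal.ofReal_toReal h5]
        exact hn.le
      rw [ENNReal.ofReal_mul (by positivity)] at h3
      exact ENNReal.div_le_of_le_mul' h3
    calc _ ≤ ∑ c ∈ T, ENNReal.ofReal (τ c) := Finset.sum_le_sum hWle
      _ = ENNReal.ofReal (∑ c ∈ T, τ c) := (ENNReal.ofReal_sum_of_nonneg hτ0).symm
      _ ≤ 1 := by rw [← ENNReal.ofReal_one]; exact ENNReal.ofReal_le_ofReal hsum

end PartN

open Complex Filter Set MeasureTheory
open scoped ENNReal
section PartO

lemma poly_of_finite (F : ℂ → ℂ) (hF : Differentiable ℂ F) (h0 : F 0 ≠ 0)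
    (ht : ∀ ε : ℝ, 0 < ε → ∃ C : ℝ, ∀ z : ℂ, ‖F z‖ ≤ C * Real.exp (ε * ‖z‖))
    (hs : ∀ z, F z = 0 → deriv F z ≠ 0) (hfin : {z | F z = 0}.Finite) :
    ∃ P : Polynomial ℂ, ∀ z, F z = P.eval z := by
  classical
  set Z := hfin.toFinset with hZ
  have hmem : ∀ z, z ∈ Z ↔ F z = 0 := by intro z; simp [hZ]
  refine ⟨Polynomial.C (F 0) * ∏ a ∈ Z, (1 - Polynomial.C (a⁻¹) * Polynomial.X), fun z => ?_⟩
  have hev : (Polynomial.C (F 0) * ∏ a ∈ Z, (1 - Polynomial.C (a⁻¹) * Polynomial.X)).eval z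
      = (∏ a ∈ Z, (1 - z / a)) * F 0 := by
    rw [Polynomial.eval_mul, Polynomial.eval_prod, Polynomial.eval_C, mul_comm]
    congr 1
    refine Finset.prod_congr rfl fun a _ => ?_
    rw [Polynomial.eval_sub, Polynomial.eval_one, Polynomial.eval_mul, Polynomial.eval_C,
      Polynomial.eval_X, div_eq_inv_mul]
  rw [hev]
  obtain ⟨B, hB⟩ : ∃ B : ℝ, ∀ w ∈ Z, ‖w‖ ≤ B := by
    refine ⟨∑ w ∈ Z, ‖w‖, fun w hw => ?_⟩
    exact Finset.single_le_sum (f := fun w : ℂ => ‖w‖) (fun _ _ => norm_nonneg _) hw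
  have key : ∀ n : ℕ, ∃ g : ℂ, F z = (∏ a ∈ Z, (1 - z / a)) * (F 0 * Complex.exp g) ∧
      ‖g‖ ≤ (1 / ((n:ℝ) + 1)) * ‖z‖ := by
    intro n
    obtain ⟨R₀, hR₀, h⟩ := lindelof F hF h0 ht hs (1 / ((n:ℝ)+1)) (by positivity)
    obtain ⟨-, g, hg⟩ := h (max R₀ (max B (2 * ‖z‖))) (le_max_left _ _) Z (by
      intro w
      rw [hmem]
      refine ⟨fun hw => ⟨hw, ?_⟩, fun hw => hw.1⟩
      exact (hB w ((hmem w).2 hw)).trans ((le_max_left _ _).trans (le_max_right _ _)))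
    have h2 : 2 * ‖z‖ ≤ max R₀ (max B (2 * ‖z‖)) := (le_max_right _ _).trans (le_max_right _ _)
    exact ⟨g z, hg z (by linarith)⟩
  choose g hg1 hg2 using key
  have hgt : Tendsto g atTop (nhds 0) := by
    apply squeeze_zero_norm hg2
    simpa using tendsto_one_div_add_atTop_nhds_zero_nat.mul_const ‖z‖
  have h3 : Tendsto (fun n => (∏ a ∈ Z, (1 - z / a)) * (F 0 * Complex.exp (g n))) atTop
      (nhds ((∏ a ∈ Z, (1 - z / a)) * (F 0 * Complex.exp 0))) :=
    (((Complex.continuous_exp.tendsto 0).comp hgt).const_mul _).const_mul _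
  have h4 : Tendsto (fun n => (∏ a ∈ Z, (1 - z / a)) * (F 0 * Complex.exp (g n))) atTop
      (nhds (F z)) := by
    refine tendsto_const_nhds.congr fun n => hg1 n
  have := tendsto_nhds_unique h4 h3
  simpa using this

lemma zeros_infinite (F : ℂ → ℂ) (hF : Differentiable ℂ F)
    (ht : ∀ ε : ℝ, 0 < ε → ∃ C : ℝ, ∀ z : ℂ, ‖F z‖ ≤ C * Real.exp (ε * ‖z‖))
    (hs : ∀ z, F z = 0 → deriv F z ≠ 0) (hr : ∀ z, F z = 0 → z.im = 0)
    (hp : ¬ ∃ P : Polynomial ℂ, ∀ z, F z = P.eval z) : {z | F z = 0}.Infinite := by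
  intro hfin
  apply hp
  have hder : ∀ z, deriv (fun z => F (z + I)) z = deriv F (z + I) := fun z => by
    rw [deriv_comp_add_const]
  obtain ⟨P, hP⟩ := poly_of_finite (fun z => F (z + I)) (by fun_prop)
    (fun h => by have := hr _ h; simp at this)
    (by
      intro ε hε
      obtain ⟨C, hC⟩ := ht ε hε
      have hC0 : 0 ≤ C := by
        have := (norm_nonneg _).trans (hC 0)
        simpa using this
      refine ⟨C * Real.exp ε, fun z => (hC (z + I)).trans ?_⟩
      rw [mul_assoc, ← Real.exp_add]
      gcongr
      have := norm_add_le z I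
      rw [norm_I] at this
      nlinarith)
    (fun z hz => by rw [hder]; exact hs _ hz)
    (by
      have : {z | F (z + I) = 0} = (fun z => z + I) ⁻¹' {z | F z = 0} := rfl
      rw [this]
      exact hfin.preimage (add_left_injective I).injOn)
  refine ⟨P.comp (Polynomial.X - Polynomial.C I), fun z => ?_⟩
  have := hP (z - I)
  simpa using this

lemma forward_dir (W : ℝ → ℝ≥0∞) (hW : IsWeight W) (hn : ¬ PolyDense W) :
      ∃ F : ℂ → ℂ, Differentiable ℂ F ∧
        (∀ ε : ℝ, 0 < ε → ∃ C : ℝ, ∀ z : ℂ,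
          ‖F z‖ ≤ C * Real.exp (ε * ‖z‖)) ∧
        (¬ ∃ P : Polynomial ℂ, ∀ z : ℂ, F z = P.eval z) ∧
        ∃ lam : ℕ → ℝ, Function.Injective lam ∧
          (∀ z : ℂ, F z = 0 ↔ ∃ n, z = (lam n : ℂ)) ∧
          (∀ n, deriv F (lam n) ≠ 0) ∧
          (∑' n, W (lam n) / ENNReal.ofReal (‖deriv F (lam n)‖)) < ⊤ := by
  classical
  obtain ⟨F, hF, ht, hp, hr, hs, hsum⟩ := forward_F hW (fun h => hn (polyDense_of_appr hW.2.1 h))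
  have hinf := zeros_infinite F hF ht hs hr hp
  have hre : ∀ z, F z = 0 → z = (z.re : ℂ) := by
    intro z hz
    apply Complex.ext <;> simp [hr z hz]
  have hcount : {z | F z = 0}.Countable := by
    have : {z | F z = 0} = ⋃ n : ℕ, {z : ℂ | F z = 0 ∧ ‖z‖ ≤ n} := by
      ext z
      simp only [mem_setOf_eq, mem_iUnion]
      refine ⟨fun h => ?_, fun ⟨n, h⟩ => h.1⟩
      obtain ⟨n, hn⟩ := exists_nat_ge ‖z‖
      exact ⟨n, h, hn⟩
    rw [this]
    exact countable_iUnion fun n => (zeros_finite F hF hs n).countable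
  have := hcount.to_subtype
  have := hinf.to_subtype
  obtain ⟨e⟩ := nonempty_equiv_of_countable (α := ℕ) (β := {z | F z = 0})
  have hlam : ∀ n, ((e n : ℂ).re : ℂ) = (e n : ℂ) := fun n => (hre _ (e n).2).symm
  have hinj : Function.Injective fun n => (e n : ℂ).re := by
    intro m n h
    apply e.injective
    apply Subtype.ext
    rw [← hlam m, ← hlam n]
    exact congrArg _ h
  refine ⟨F, hF, ht, hp, fun n => (e n : ℂ).re, hinj, ?_, ?_, ?_⟩
  · intro z
    constructor
    · intro hz
      refine ⟨e.symm ⟨z, hz⟩, ?_⟩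
      rw [hlam]; simp
    · rintro ⟨n, rfl⟩
      rw [hlam]; exact (e n).2
  · intro n
    rw [hlam]; exact hs _ (e n).2
  · refine lt_of_le_of_lt ?_ ENNReal.one_lt_top
    rw [ENNReal.tsum_eq_iSup_sum]
    refine iSup_le fun T => ?_
    have := hsum (T.map ⟨_, hinj⟩) (by
      intro x hx
      obtain ⟨n, -, rfl⟩ := Finset.mem_map.1 hx
      simp only [Function.Embedding.coeFn_mk]
      rw [hlam]; exact (e n).2)
    rw [Finset.sum_map] at this
    exact this

end PartO

theorem stmt15 (W : ℝ → ℝ≥0∞) (hW : IsWeight W) :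
    ¬ PolyDense W ↔
      ∃ F : ℂ → ℂ, Differentiable ℂ F ∧
        (∀ ε : ℝ, 0 < ε → ∃ C : ℝ, ∀ z : ℂ,
          ‖F z‖ ≤ C * Real.exp (ε * ‖z‖)) ∧
        (¬ ∃ P : Polynomial ℂ, ∀ z : ℂ, F z = P.eval z) ∧
        ∃ lam : ℕ → ℝ, Function.Injective lam ∧
          (∀ z : ℂ, F z = 0 ↔ ∃ n, z = (lam n : ℂ)) ∧
          (∀ n, deriv F (lam n) ≠ 0) ∧
          (∑' n, W (lam n) / ENNReal.ofReal (‖deriv F (lam n)‖)) < ⊤ := by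
  constructor
  · exact forward_dir W hW
  · rintro ⟨F, hF, ht, -, lam, hinj, hz, hd, hsum⟩
    exact back_dir W hW F hF ht lam hinj hz hd hsum
end

section
/- Let W : ℝ → [1, +∞) be an even continuous function, nondecreasing on [0, +∞), such that t ↦ log W(e^t) is convex on ℝ and x^n/W(x) → 0 as x → +∞ for every integer n ≥ 0. Then log M_W(x)/log W(x) → 1 as x → +∞. -/
open Complex Filter Set

/-- The Hall majorant on the real line, for a finite-valued weight `W`:
the supremum of `|P(x)|` over polynomials `P` with `|P| ≤ W` on `ℝ`. -/
noncomputable def MWr (W : ℝ → ℝ) (x : ℝ) : ℝ :=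
  sSup ((fun P : Polynomial ℂ => ‖P.eval (x : ℂ)‖) ''
    {P : Polynomial ℂ | ∀ t : ℝ, ‖P.eval (t : ℂ)‖ ≤ W t})

theorem aux_subgrad (f : ℝ → ℝ) (hf : ConvexOn ℝ univ f) (s : ℝ) :
    ∃ p : ℝ, ∀ t, f s + p * (t - s) ≤ f t := by
  refine ⟨derivWithin f (Ioi s) s, fun t => ?_⟩
  rcases lt_trichotomy t s with h | h | h
  · have h1 := hf.slope_le_leftDeriv_of_mem_interior (x := t) (y := s) (by simp) (by simp) h
    have h2 := hf.leftDeriv_le_rightDeriv_of_mem_interior (x := s) (by simp)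
    have h3 := h1.trans h2
    rw [slope_def_field, div_le_iff₀ (by linarith)] at h3
    linarith
  · subst h; simp
  · have h1 := hf.rightDeriv_le_slope_of_mem_interior (x := s) (y := t) (by simp) (by simp) h
    rw [slope_def_field, le_div_iff₀ (by linarith)] at h1
    linarith

theorem aux_line (f : ℝ → ℝ) (hf : ConvexOn ℝ univ f) (h0 : ∀ t, 0 ≤ f t) (s : ℝ) (hs : 0 < s)
    (N : ℕ) (hN : f 0 + N * s ≤ f s) :
    ∃ n : ℕ, N ≤ n ∧ ∀ t, (n / (n + 1) : ℝ) * f s + n * (t - s) ≤ f t := by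
  obtain ⟨p, hp⟩ := aux_subgrad f hf s
  have hpN : (N : ℝ) ≤ p := by
    have := hp 0
    by_contra! hlt
    nlinarith
  have hp0 : 0 ≤ p := le_trans (by positivity) hpN
  refine ⟨⌊p⌋₊, Nat.le_floor hpN, fun t => ?_⟩
  have hn1 := Nat.floor_le hp0
  have hn2 := Nat.lt_floor_add_one p
  have hn0 : (0 : ℝ) ≤ (⌊p⌋₊ : ℝ) := by positivity
  generalize (⌊p⌋₊ : ℝ) = n at *
  have hq0 : 0 ≤ n / (n + 1) := by positivity
  have hq1 : n / (n + 1) ≤ 1 := by rw [div_le_one (by positivity)]; linarith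
  have hq2 : n / (n + 1) * (n + 1) = n := by field_simp
  generalize n / (n + 1) = q at *
  have hpt := hp t
  have hs0 := h0 s
  have ht0 := h0 t
  rcases le_total s t with h | h
  · nlinarith
  · have e : q * f s + n * (t - s) = q * (f s + (n + 1) * (t - s)) := by
      linear_combination (s - t) * hq2
    rw [e]
    have h5 : f s + (n + 1) * (t - s) ≤ f t := by nlinarith
    nlinarith

theorem aux_bdd (W : ℝ → ℝ) (x : ℝ) : W x ∈ upperBounds
    ((fun P : Polynomial ℂ => ‖P.eval (x : ℂ)‖) ''
    {P : Polynomial ℂ | ∀ t : ℝ, ‖P.eval (t : ℂ)‖ ≤ W t}) := by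
  rintro _ ⟨P, hP, rfl⟩
  exact hP x

theorem aux_ge (W : ℝ → ℝ) (x : ℝ) (P : Polynomial ℂ)
    (hP : ∀ t : ℝ, ‖P.eval (t : ℂ)‖ ≤ W t) : ‖P.eval (x : ℂ)‖ ≤ MWr W x :=
  le_csSup ⟨W x, aux_bdd W x⟩ ⟨P, hP, rfl⟩

theorem aux_one (W : ℝ → ℝ) (hW1 : ∀ x, 1 ≤ W x) (x : ℝ) : 1 ≤ MWr W x := by
  have := aux_ge W x 1 (fun t => by simpa using hW1 t)
  simpa using this

theorem aux_le (W : ℝ → ℝ) (hW1 : ∀ x, 1 ≤ W x) (x : ℝ) : MWr W x ≤ W x :=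
  csSup_le ⟨_, 1, fun t => by simpa using hW1 t, rfl⟩ (aux_bdd W x)

theorem aux_lower (W : ℝ → ℝ)
    (hW1 : ∀ x, 1 ≤ W x)
    (hWeven : ∀ x, W (-x) = W x)
    (hWconv : ConvexOn ℝ univ (fun t : ℝ => Real.log (W (Real.exp t))))
    (N : ℕ) (x : ℝ) (hx : 1 < x) (h : W 1 * x ^ N ≤ W x) :
    (N / (N + 1) : ℝ) * Real.log (W x) ≤ Real.log (MWr W x) := by
  have hx0 : 0 < x := by linarith
  have hpos : ∀ t, 0 < W t := fun t => lt_of_lt_of_le one_pos (hW1 t)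
  have hlog := Real.log_le_log (mul_pos (hpos 1) (pow_pos hx0 N)) h
  rw [Real.log_mul (hpos 1).ne' (pow_pos hx0 N).ne', Real.log_pow] at hlog
  obtain ⟨n, hn, hl⟩ := aux_line _ hWconv (fun t => Real.log_nonneg (hW1 _)) (Real.log x)
    (Real.log_pos hx) N (by simpa [Real.exp_log hx0] using hlog)
  simp only [Real.exp_log hx0] at hl
  have hL : 0 ≤ Real.log (W x) := Real.log_nonneg (hW1 x)
  set c : ℝ := (n / (n + 1) : ℝ) * Real.log (W x) - n * Real.log x with hc
  have hev : ∀ t : ℝ, ‖(Polynomial.C ((Real.exp c : ℝ) : ℂ) * Polynomial.X ^ n).eval (t : ℂ)‖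
      = Real.exp c * |t| ^ n := by
    intro t
    simp only [Polynomial.eval_mul, Polynomial.eval_C, Polynomial.eval_pow, Polynomial.eval_X,
      norm_mul, norm_pow, Complex.norm_real, Real.norm_eq_abs, Real.abs_exp]
  have hexp : ∀ t : ℝ, t ≠ 0 → Real.exp c * |t| ^ n = Real.exp (c + n * Real.log |t|) := by
    intro t ht
    rw [Real.exp_add, Real.exp_nat_mul, Real.exp_log (abs_pos.mpr ht)]
  have hge := aux_ge W x (Polynomial.C ((Real.exp c : ℝ) : ℂ) * Polynomial.X ^ n) (by
    intro t
    rw [hev]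
    by_cases ht : t = 0
    · subst ht
      rcases Nat.eq_zero_or_pos n with h0 | h0
      · subst h0
        simpa [hc] using hW1 0
      · rw [abs_zero, zero_pow h0.ne', mul_zero]
        exact (hpos 0).le
    · rw [hexp t ht, ← Real.le_log_iff_exp_le (hpos t)]
      have h1 := hl (Real.log |t|)
      rw [Real.exp_log (abs_pos.mpr ht)] at h1
      have h2 : W |t| = W t := by
        rcases abs_choice t with h | h <;> rw [h]
        exact hWeven t
      rw [h2] at h1
      rw [hc]
      linarith)
  rw [hev, hexp x hx0.ne', ← Real.le_log_iff_exp_le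
    (lt_of_lt_of_le one_pos (aux_one W hW1 x)), abs_of_pos hx0] at hge
  refine le_trans (mul_le_mul_of_nonneg_right (c := (n / (n + 1) : ℝ)) ?_ hL) (le_trans (le_of_eq ?_) hge)
  · have : (N : ℝ) ≤ n := by exact_mod_cast hn
    rw [div_le_div_iff₀ (by positivity) (by positivity)]
    linarith
  · rw [hc]; ring

theorem stmt18 (W : ℝ → ℝ)
    (hW1 : ∀ x, 1 ≤ W x)
    (hWeven : ∀ x, W (-x) = W x)
    (hWcont : Continuous W)
    (hWmono : MonotoneOn W (Ici 0))
    (hWconv : ConvexOn ℝ univ (fun t : ℝ => Real.log (W (Real.exp t))))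
    (hWdecay : ∀ n : ℕ, Tendsto (fun x : ℝ => x ^ n / W x) atTop (nhds 0)) :
    Tendsto (fun x : ℝ => Real.log (MWr W x) / Real.log (W x)) atTop (nhds 1) := by
  have hpos : ∀ t, 0 < W t := fun t => lt_of_lt_of_le one_pos (hW1 t)
  have hgrow : ∀ N : ℕ, ∀ᶠ x in atTop, W 1 * x ^ N ≤ W x := by
    intro N
    have h := (hWdecay N).eventually (gt_mem_nhds (inv_pos.mpr (hpos 1)))
    filter_upwards [h] with x hx
    rw [div_lt_iff₀ (hpos x), inv_mul_eq_div, lt_div_iff₀ (hpos 1)] at hx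
    linarith
  have hLpos : ∀ᶠ x in atTop, 0 < Real.log (W x) := by
    filter_upwards [hgrow 1, eventually_gt_atTop 1] with x h1 h2
    apply Real.log_pos
    have := hW1 1
    nlinarith
  rw [tendsto_order]
  constructor
  · intro a ha
    have hlim := (tendsto_natCast_div_add_atTop (1 : ℝ)).eventually (lt_mem_nhds ha)
    obtain ⟨N, hN⟩ := hlim.exists
    filter_upwards [hgrow N, eventually_gt_atTop 1, hLpos] with x h1 h2 h3
    refine lt_of_lt_of_le hN ?_
    rw [le_div_iff₀ h3]
    exact aux_lower W hW1 hWeven hWconv N x h2 h1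
  · intro a ha
    filter_upwards [hLpos] with x h3
    refine lt_of_le_of_lt ?_ ha
    rw [div_le_one h3]
    exact Real.log_le_log (lt_of_lt_of_le one_pos (aux_one W hW1 x)) (aux_le W hW1 x)
end
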